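/- arXiv:2509.02561 — 3 statements merged into one kernel-verified Lean document; each statement's English description precedes it below -/
import Mathlib

section
/- There exist absolute constants C, c > 0 such that for every finite abelian group G of order n ≥ 2 there exists a subset T ⊆ G with |T| ≥ n − C·n^{3/5}·(log n)^{19/10} such that no subset B ⊆ G satisfies B + B = T. -/
open scoped Pointwise
open Finset

/-- The colour class of `0`. -/
def zeroClass {G : Type*} [Fintype G] {q : ℕ} [NeZero q] (φ : G → Fin q) :
    Finset G :=
  univ.filter fun s => φ s = 0

/-- The centred indicator function of `zeroClass φ`. -/
noncomputable def centred {G : Type*} {q : ℕ} [NeZero q] (φ : G → Fin q) (s : G) : ℝ :=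
  (if φ s = 0 then 1 else 0) - 1 / q

lemma mem_zeroClass {G : Type*} [Fintype G] {q : ℕ} [NeZero q] {φ : G → Fin q} {s : G} :
    s ∈ zeroClass φ ↔ φ s = 0 := by
  simp [zeroClass]

lemma card_piFinset_le_exp {G : Type*} [Fintype G] [DecidableEq G] {q : ℕ}
    (hq : 2 ≤ q) (A : G → Finset (Fin q)) (W : Finset G)
    (hA : ∀ s ∈ W, #(A s) ≤ q - 1) :
    (#(Fintype.piFinset A) : ℝ) ≤ (q : ℝ) ^ Fintype.card G * Real.exp (-(#W / q)) := by
  have hq0 : (0 : ℝ) < q := by positivity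
  rw [Fintype.card_piFinset]
  push_cast
  calc ∏ s, (#(A s) : ℝ) ≤ ∏ s, ((q : ℝ) * if s ∈ W then Real.exp (-(1 / q)) else 1) := by
        apply Finset.prod_le_prod
        · intros; positivity
        · intro s _
          split_ifs with hs
          · have h1 : (#(A s) : ℝ) ≤ q - 1 := by
              have := hA s hs
              have h2 : #(A s) + 1 ≤ q := by omega
              have h3 : ((#(A s) + 1 : ℕ) : ℝ) ≤ q := by exact_mod_cast h2
              push_cast at h3
              linarith
            have h2 : -(1 / (q : ℝ)) + 1 ≤ Real.exp (-(1 / q)) := Real.add_one_le_exp _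
            calc (#(A s) : ℝ) ≤ q - 1 := h1
              _ = q * (-(1 / (q : ℝ)) + 1) := by field_simp; ring
              _ ≤ _ := by gcongr
          · have : #(A s) ≤ q := by simpa using card_le_univ (A s)
            simpa using this
    _ = _ := by
        rw [prod_mul_distrib, prod_const, card_univ, prod_ite_mem, univ_inter, prod_const,
          ← Real.exp_nat_mul]
        congr 2
        ring

lemma card_avoid_le {G : Type*} [Fintype G] [DecidableEq G] {q : ℕ} [NeZero q]
    (hq : 2 ≤ q) (W : Finset G) :
    (#(univ.filter fun φ : G → Fin q => Disjoint (zeroClass φ) W) : ℝ) ≤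
      (q : ℝ) ^ Fintype.card G * Real.exp (-(#W / q)) := by
  refine le_trans ?_ (card_piFinset_le_exp hq
    (fun s => if s ∈ W then univ.erase 0 else univ) W ?_)
  · norm_cast
    apply card_le_card
    intro φ hφ
    simp only [mem_filter, mem_univ, true_and] at hφ
    rw [Fintype.mem_piFinset]
    intro s
    split_ifs with hs
    · simp only [mem_erase, mem_univ, and_true]
      intro h
      exact Finset.disjoint_left.1 hφ (mem_zeroClass.2 h) hs
    · simp
  · intro s hs
    simp [hs, card_erase_of_mem]

lemma card_zeroClass_eq_le {G : Type*} [Fintype G] [DecidableEq G] {q : ℕ} [NeZero q]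
    (hq : 2 ≤ q) (U : Finset G) :
    (#(univ.filter fun φ : G → Fin q => zeroClass φ = U) : ℝ) ≤
      (q : ℝ) ^ Fintype.card G * Real.exp (-(Fintype.card G / q)) := by
  rw [← card_univ (α := G)]
  refine le_trans ?_ (card_piFinset_le_exp hq
    (fun s => if s ∈ U then {0} else univ.erase 0) univ ?_)
  · norm_cast
    apply card_le_card
    intro φ hφ
    simp only [mem_filter, mem_univ, true_and] at hφ
    rw [Fintype.mem_piFinset]
    intro s
    split_ifs with hs
    · rw [← hφ, mem_zeroClass] at hs
      simp [hs]
    · rw [← hφ, mem_zeroClass] at hs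
      simp [hs]
  · intro s _
    split_ifs
    · simp; omega
    · simp [card_erase_of_mem]

lemma sum_card_zeroClass {G : Type*} [Fintype G] [DecidableEq G] {q : ℕ} [NeZero q] :
    ∑ φ : G → Fin q, (#(zeroClass φ) : ℝ) * q = Fintype.card G * (q : ℝ) ^ Fintype.card G := by
  have hq0 : (q : ℝ) ≠ 0 := by exact_mod_cast NeZero.ne q
  have h : ∀ φ : G → Fin q, (#(zeroClass φ) : ℝ) = ∑ s, if φ s = 0 then 1 else 0 := by
    intro φ; simp [zeroClass]
  simp_rw [h, sum_mul]
  rw [sum_comm]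
  have h2 : ∀ s : G, ∑ φ : G → Fin q, (if φ s = 0 then (1 : ℝ) else 0) * q =
      (q : ℝ) ^ Fintype.card G := by
    intro s
    have := (prod_univ_sum (fun _ : G => (univ : Finset (Fin q)))
      (fun t u => if t = s then (if u = 0 then (q : ℝ) else 0) else 1)).symm
    rw [Fintype.piFinset_univ] at this
    have h3 : ∀ φ : G → Fin q, (∏ i, if i = s then (if φ i = 0 then (q : ℝ) else 0) else 1) =
        (if φ s = 0 then (1 : ℝ) else 0) * q := by
      intro φ
      rw [prod_ite_eq']
      simp
    simp_rw [h3] at this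
    rw [this]
    have h4 : ∀ t : G, ∑ u : Fin q, (if t = s then (if u = 0 then (q : ℝ) else 0) else 1) = q := by
      intro t
      split_ifs <;> simp
    simp_rw [h4]
    simp
  simp_rw [h2]
  simp

lemma card_zeroClass_large_le {G : Type*} [Fintype G] [DecidableEq G] {q : ℕ} [NeZero q]
    (c : ℝ) (hc : 0 < c) (hG : 0 < Fintype.card G) :
    (#(univ.filter fun φ : G → Fin q => c * Fintype.card G ≤ #(zeroClass φ) * q) : ℝ) ≤
      (q : ℝ) ^ Fintype.card G / c := by
  have hG' : (0 : ℝ) < Fintype.card G := by exact_mod_cast hG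
  rw [le_div_iff₀ hc]
  have h1 : (#(univ.filter fun φ : G → Fin q => c * Fintype.card G ≤ #(zeroClass φ) * q) : ℝ) *
      (c * Fintype.card G) ≤ Fintype.card G * (q : ℝ) ^ Fintype.card G := by
    rw [← sum_card_zeroClass (G := G) (q := q), ← nsmul_eq_mul, ← sum_const]
    calc _ ≤ ∑ φ ∈ univ.filter fun φ : G → Fin q => c * Fintype.card G ≤ #(zeroClass φ) * q,
          (#(zeroClass φ) : ℝ) * q := sum_le_sum fun φ hφ => (mem_filter.1 hφ).2
      _ ≤ _ := sum_le_sum_of_subset_of_nonneg (filter_subset _ _) fun _ _ _ => by positivity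
  nlinarith

lemma abs_sum_centred_pow_le {q : ℕ} [NeZero q] (hq : 1 ≤ q) {Y : ℝ} (hY : 1 ≤ Y) (k : ℕ) :
    |∑ u : Fin q, ((if u = 0 then (1 : ℝ) else 0) - 1 / q) ^ k| ≤
      q * (Y ^ k * if k = 0 then 1 else 1 / (q * Y ^ 2)) := by
  have hq0 : (0 : ℝ) < q := by positivity
  have hq1 : (1 : ℝ) ≤ q := by exact_mod_cast hq
  have hinv : 1 / (q : ℝ) ≤ 1 := by rw [div_le_one hq0]; exact hq1
  have hinv0 : 0 ≤ 1 / (q : ℝ) := by positivity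
  have hsplit : ∀ j : ℕ, ∑ u : Fin q, ((if u = 0 then (1 : ℝ) else 0) - 1 / q) ^ j =
      (1 - 1 / q) ^ j + (q - 1) * (-(1 / q)) ^ j := by
    intro j
    rw [← add_sum_erase univ (fun u : Fin q => ((if u = 0 then (1 : ℝ) else 0) - 1 / q) ^ j)
      (mem_univ (0 : Fin q))]
    congr 1
    rw [sum_congr rfl (g := fun _ => (-(1 / (q : ℝ))) ^ j)]
    · rw [sum_const, card_erase_of_mem (mem_univ _)]
      simp [Nat.cast_sub hq]
    · intro u hu
      rw [if_neg (ne_of_mem_erase hu)]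
      simp
  obtain rfl | rfl | k := k
  · simp
  · rw [hsplit]
    have : (1 - 1 / (q : ℝ)) ^ (0 + 1) + (q - 1) * (-(1 / q)) ^ (0 + 1) = 0 := by
      field_simp; ring
    rw [this]
    simp
    positivity
  · have h1 : |∑ u : Fin q, ((if u = 0 then (1 : ℝ) else 0) - 1 / q) ^ (k + 2)| ≤
        ∑ u : Fin q, ((if u = 0 then (1 : ℝ) else 0) - 1 / q) ^ 2 := by
      refine (abs_sum_le_sum_abs _ _).trans (sum_le_sum fun u _ => ?_)
      rw [abs_pow, pow_add, sq_abs]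
      refine mul_le_of_le_one_left (sq_nonneg _) (pow_le_one₀ (abs_nonneg _) ?_)
      rw [abs_le]
      split_ifs <;> constructor <;> linarith
    have h2 : ∑ u : Fin q, ((if u = 0 then (1 : ℝ) else 0) - 1 / q) ^ 2 ≤ 1 := by
      rw [hsplit]
      have : (1 - 1 / (q : ℝ)) ^ 2 + (q - 1) * (-(1 / q)) ^ 2 = 1 - 1 / q := by
        field_simp; ring
      linarith
    have hYk : (1 : ℝ) ≤ Y ^ k := one_le_pow₀ hY
    have h3 : (q : ℝ) * (Y ^ (k + 2) * if k + 2 = 0 then 1 else 1 / (q * Y ^ 2)) = Y ^ k := by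
      have : Y ≠ 0 := by positivity
      simp
      field_simp
      ring
    rw [h3]
    linarith

lemma abs_sum_prod_centred_le {G : Type*} [Fintype G] [DecidableEq G] {q : ℕ} [NeZero q]
    (hq : 1 ≤ q) {Y : ℝ} (hY : 1 ≤ Y) (M : Multiset G) :
    |∑ φ : G → Fin q, (M.map (centred φ)).prod| ≤
      (q : ℝ) ^ Fintype.card G *
        (Y ^ Multiset.card M * (1 / (q * Y ^ 2)) ^ #M.toFinset) := by
  have h1 : ∀ φ : G → Fin q, (M.map (centred φ)).prod =
      ∏ s, ((if φ s = 0 then (1 : ℝ) else 0) - 1 / q) ^ M.count s := by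
    intro φ
    rw [prod_multiset_map_count]
    apply prod_subset (subset_univ _)
    intro s _ hs
    rw [Multiset.mem_toFinset, ← Multiset.count_eq_zero] at hs
    simp [hs]
  simp_rw [h1]
  have h2 := prod_univ_sum (fun _ : G => (univ : Finset (Fin q)))
      (fun s u => ((if u = 0 then (1 : ℝ) else 0) - 1 / q) ^ M.count s)
  rw [Fintype.piFinset_univ] at h2
  rw [← h2, abs_prod]
  calc _ ≤ ∏ s : G, ((q : ℝ) * (Y ^ M.count s * if M.count s = 0 then 1 else 1 / (q * Y ^ 2))) :=
        prod_le_prod (fun _ _ => abs_nonneg _) fun s _ => abs_sum_centred_pow_le hq hY _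
    _ = _ := by
        rw [prod_mul_distrib, prod_mul_distrib, prod_const, card_univ, prod_pow_eq_pow_sum]
        congr 3
        · exact Multiset.sum_count_eq_card fun _ _ => mem_univ _
        · have : ∀ s : G, (if M.count s = 0 then (1 : ℝ) else 1 / (q * Y ^ 2)) =
              if s ∈ M.toFinset then 1 / (q * Y ^ 2) else 1 := by
            intro s
            simp [Multiset.count_eq_zero, ite_not]
          simp_rw [this]
          rw [prod_ite_mem, univ_inter, prod_const]

open Matrix in
lemma sq_dotProduct_mulVec_le {G : Type*} [Fintype G] {A : Matrix G G ℝ} (hA : A.IsSymm)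
    (v : G → ℝ) : (v ⬝ᵥ A *ᵥ v) ^ 2 ≤ (v ⬝ᵥ v) * (v ⬝ᵥ (A * A) *ᵥ v) := by
  have h : v ⬝ᵥ (A * A) *ᵥ v = (A *ᵥ v) ⬝ᵥ (A *ᵥ v) := by
    rw [← mulVec_mulVec, dotProduct_mulVec, ← mulVec_transpose, hA.eq]
  rw [h]
  have := sum_mul_sq_le_sq_mul_sq univ v (A *ᵥ v)
  simpa [dotProduct, sq] using this

open Matrix in
lemma dotProduct_mulVec_pow_le {G : Type*} [Fintype G] [DecidableEq G] (v : G → ℝ) (j : ℕ) :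
    ∀ A : Matrix G G ℝ, A.IsSymm →
      (v ⬝ᵥ A *ᵥ v) ^ 2 ^ (j + 1) ≤ (v ⬝ᵥ v) ^ 2 ^ (j + 1) * (A ^ 2 ^ (j + 1)).trace := by
  induction j with
  | zero =>
    intro A hA
    have h1 : v ⬝ᵥ A *ᵥ v = ∑ p : G × G, (v p.1 * v p.2) * A p.1 p.2 := by
      rw [Fintype.sum_prod_type]
      simp only [dotProduct, mulVec, mul_sum]
      refine sum_congr rfl fun x _ => sum_congr rfl fun y _ => by ring
    have h2 : v ⬝ᵥ v * (v ⬝ᵥ v) = ∑ p : G × G, (v p.1 * v p.2) ^ 2 := by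
      rw [Fintype.sum_prod_type]
      simp only [dotProduct, sum_mul_sum]
      refine sum_congr rfl fun x _ => sum_congr rfl fun y _ => by ring
    have h3 : (A * A).trace = ∑ p : G × G, A p.1 p.2 ^ 2 := by
      rw [Fintype.sum_prod_type]
      simp only [trace, Matrix.diag, mul_apply]
      refine sum_congr rfl fun x _ => sum_congr rfl fun y _ => ?_
      rw [hA.apply, sq]
    simp only [zero_add, pow_one]
    rw [sq (v ⬝ᵥ v), sq A, h1, h2, h3]
    exact sum_mul_sq_le_sq_mul_sq _ _ _
  | succ j ih =>
    intro A hA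
    have hAA : (A * A).IsSymm := by
      unfold Matrix.IsSymm
      rw [transpose_mul, hA.eq]
    have h1 := ih (A * A) hAA
    rw [← sq A, ← pow_mul, ← pow_succ'] at h1
    have hvv : 0 ≤ v ⬝ᵥ v := sum_nonneg fun x _ => mul_self_nonneg _
    calc (v ⬝ᵥ A *ᵥ v) ^ 2 ^ (j + 1 + 1) = ((v ⬝ᵥ A *ᵥ v) ^ 2) ^ 2 ^ (j + 1) := by
          rw [← pow_mul, ← pow_succ']
      _ ≤ ((v ⬝ᵥ v) * (v ⬝ᵥ (A * A) *ᵥ v)) ^ 2 ^ (j + 1) := by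
          gcongr
          exact sq_dotProduct_mulVec_le hA v
      _ = (v ⬝ᵥ v) ^ 2 ^ (j + 1) * (v ⬝ᵥ (A ^ 2) *ᵥ v) ^ 2 ^ (j + 1) := by
          rw [mul_pow, sq A]
      _ ≤ (v ⬝ᵥ v) ^ 2 ^ (j + 1) * ((v ⬝ᵥ v) ^ 2 ^ (j + 1) * (A ^ 2 ^ (j + 1 + 1)).trace) := by
          gcongr
      _ = _ := by
          rw [← mul_assoc, ← pow_add, ← two_mul, ← pow_succ']

lemma trace_pow_two_mul_nonneg {G : Type*} [Fintype G] [DecidableEq G] {A : Matrix G G ℝ}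
    (hA : A.IsSymm) (m : ℕ) : 0 ≤ (A ^ (2 * m)).trace := by
  rw [two_mul, pow_add]
  have hm : (A ^ m).IsSymm := by
    unfold Matrix.IsSymm
    rw [Matrix.transpose_pow, hA.eq]
  simp only [Matrix.trace, Matrix.diag, Matrix.mul_apply]
  refine sum_nonneg fun x _ => sum_nonneg fun y _ => ?_
  rw [hm.apply]
  exact mul_self_nonneg _

/-- The matrix `(x, y) ↦ centred φ (x + y)` restricted to `X × X`. -/
noncomputable def sumMatrix {G : Type*} [AddCommGroup G] [DecidableEq G] {q : ℕ} [NeZero q]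
    (X : Finset G) (φ : G → Fin q) : Matrix G G ℝ :=
  Matrix.of fun x y => if x ∈ X ∧ y ∈ X then centred φ (x + y) else 0

lemma sumMatrix_isSymm {G : Type*} [AddCommGroup G] [DecidableEq G] {q : ℕ} [NeZero q]
    (X : Finset G) (φ : G → Fin q) : (sumMatrix X φ).IsSymm := by
  ext x y
  simp only [sumMatrix, Matrix.transpose_apply, Matrix.of_apply, add_comm y x, and_comm]

lemma sum_pow_card_insert_le {G : Type*} [AddCommGroup G] [DecidableEq G] {θ : ℝ} (hθ : 0 ≤ θ)
    (X U : Finset G) (x : G) :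
    ∑ y ∈ X, θ ^ #(insert (x + y) U) ≤ θ ^ #U * (#X * θ + #U) := by
  calc _ ≤ ∑ y ∈ X, θ ^ #U * (θ + if x + y ∈ U then 1 else 0) := by
        refine sum_le_sum fun y _ => ?_
        split_ifs with h
        · rw [insert_eq_of_mem h]
          nlinarith [pow_nonneg hθ #U]
        · rw [card_insert_of_notMem h, pow_succ]
          simp
    _ = θ ^ #U * (#X * θ + #(X.filter fun y => x + y ∈ U)) := by
        rw [← mul_sum, sum_add_distrib]
        simp
    _ ≤ _ := by
        have : #(X.filter fun y => x + y ∈ U) ≤ #U :=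
          card_le_card_of_injOn (fun y => x + y) (fun y hy => (mem_filter.1 hy).2)
            (fun _ _ _ _ h => add_left_cancel h)
        gcongr

lemma sum_abs_sum_prod_mul_sumMatrix_pow_le {G : Type*} [AddCommGroup G] [Fintype G]
    [DecidableEq G] {q : ℕ} [NeZero q] (hq : 1 ≤ q) {Y : ℝ} (hY : 1 ≤ Y) (X : Finset G) (l : ℕ) :
    ∀ (M : Multiset G) (x : G),
      ∑ z, |∑ φ : G → Fin q, (M.map (centred φ)).prod * (sumMatrix X φ ^ l) x z| ≤
        (q : ℝ) ^ Fintype.card G * (Y ^ (Multiset.card M + l) * ((1 / (q * Y ^ 2)) ^ #M.toFinset *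
          (#X * (1 / (q * Y ^ 2)) + Multiset.card M + l) ^ l)) := by
  have hY0 : 0 ≤ Y := by linarith
  have hθ : 0 ≤ 1 / (q * Y ^ 2) := by positivity
  have hzero := abs_sum_prod_centred_le (G := G) hq hY
  generalize 1 / (q * Y ^ 2) = θ at hθ hzero ⊢
  induction l with
  | zero =>
    intro M x
    have := hzero M
    rw [sum_eq_single x]
    · simpa using this
    · intro z _ hz
      simp [Matrix.one_apply_ne' hz]
    · simp
  | succ l ih =>
    intro M x
    by_cases hx : x ∈ X
    swap
    · have h0 : ∀ (φ : G → Fin q) z, (sumMatrix X φ ^ (l + 1)) x z = 0 := by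
        intro φ z
        rw [pow_succ', Matrix.mul_apply]
        refine sum_eq_zero fun y _ => ?_
        simp [sumMatrix, hx]
      simp only [h0, mul_zero, sum_const_zero, abs_zero]
      positivity
    have hrw : ∀ z, ∑ φ : G → Fin q, (M.map (centred φ)).prod * (sumMatrix X φ ^ (l + 1)) x z =
        ∑ y ∈ X, ∑ φ : G → Fin q,
          (((x + y) ::ₘ M).map (centred φ)).prod * (sumMatrix X φ ^ l) y z := by
      intro z
      rw [sum_comm]
      refine sum_congr rfl fun φ _ => ?_
      rw [pow_succ', Matrix.mul_apply, mul_sum]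
      rw [← sum_subset (subset_univ X)]
      · refine sum_congr rfl fun y hy => ?_
        simp [sumMatrix, hx, hy]
        ring
      · intro y _ hy
        simp [sumMatrix, hy]
    calc _ ≤ ∑ z, ∑ y ∈ X, |∑ φ : G → Fin q,
          (((x + y) ::ₘ M).map (centred φ)).prod * (sumMatrix X φ ^ l) y z| := by
          refine sum_le_sum fun z _ => ?_
          rw [hrw]
          exact abs_sum_le_sum_abs _ _
      _ = ∑ y ∈ X, ∑ z, |∑ φ : G → Fin q,
          (((x + y) ::ₘ M).map (centred φ)).prod * (sumMatrix X φ ^ l) y z| := sum_comm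
      _ ≤ ∑ y ∈ X, (q : ℝ) ^ Fintype.card G * (Y ^ (Multiset.card M + 1 + l) *
          (θ ^ #(insert (x + y) M.toFinset) * (#X * θ + (Multiset.card M + 1 : ℕ) + l) ^ l)) := by
          refine sum_le_sum fun y _ => ?_
          have := ih ((x + y) ::ₘ M) y
          rwa [Multiset.card_cons, Multiset.toFinset_cons] at this
      _ = (q : ℝ) ^ Fintype.card G * (Y ^ (Multiset.card M + 1 + l) *
          ((∑ y ∈ X, θ ^ #(insert (x + y) M.toFinset)) *
            (#X * θ + (Multiset.card M + 1 : ℕ) + l) ^ l)) := by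
          rw [← mul_sum, ← mul_sum, ← sum_mul]
      _ ≤ (q : ℝ) ^ Fintype.card G * (Y ^ (Multiset.card M + 1 + l) *
          ((θ ^ #M.toFinset * (#X * θ + (Multiset.card M + 1 : ℕ) + l)) *
            (#X * θ + (Multiset.card M + 1 : ℕ) + l) ^ l)) := by
          gcongr
          refine (sum_pow_card_insert_le hθ X M.toFinset x).trans
            (mul_le_mul_of_nonneg_left ?_ (pow_nonneg hθ _))
          have : (#M.toFinset : ℝ) ≤ (Multiset.card M : ℝ) := by
            exact_mod_cast Multiset.toFinset_card_le M
          push_cast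
          have : (0 : ℝ) ≤ l := by positivity
          linarith
      _ = _ := by
          push_cast
          ring

lemma sum_trace_sumMatrix_pow_le {G : Type*} [AddCommGroup G] [Fintype G]
    [DecidableEq G] {q : ℕ} [NeZero q] (hq : 1 ≤ q) {Y : ℝ} (hY : 1 ≤ Y) (X : Finset G) (l : ℕ) :
    ∑ φ : G → Fin q, (sumMatrix X φ ^ l).trace ≤
      Fintype.card G * ((q : ℝ) ^ Fintype.card G * (Y * (#X * (1 / (q * Y ^ 2)) + l)) ^ l) := by
  simp only [Matrix.trace, Matrix.diag]
  rw [sum_comm, ← card_univ (α := G), ← nsmul_eq_mul, ← sum_const]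
  refine sum_le_sum fun x _ => ?_
  have := sum_abs_sum_prod_mul_sumMatrix_pow_le hq hY X l 0 x
  simp only [Multiset.map_zero, Multiset.prod_zero, one_mul, Multiset.card_zero,
    Multiset.toFinset_zero, card_empty, pow_zero, zero_add, Nat.cast_zero, add_zero] at this
  rw [mul_pow]
  refine le_trans (le_abs_self _) (le_trans ?_ this)
  exact single_le_sum (f := fun z => |∑ φ : G → Fin q, (sumMatrix X φ ^ l) x z|)
    (fun _ _ => abs_nonneg _) (mem_univ x)

open Matrix in
lemma pow_le_trace_sumMatrix {G : Type*} [AddCommGroup G] [Fintype G]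
    [DecidableEq G] {q : ℕ} [NeZero q] {X B : Finset G} {φ : G → Fin q} (hBX : B ⊆ X)
    (hB : B.Nonempty) (h : ∀ s ∈ B, ∀ t ∈ B, s + t ∉ zeroClass φ) (j : ℕ) :
    ((#B : ℝ) / q) ^ 2 ^ (j + 1) ≤ (sumMatrix X φ ^ 2 ^ (j + 1)).trace := by
  have hq0 : (q : ℝ) ≠ 0 := by exact_mod_cast NeZero.ne q
  have hB0 : (0 : ℝ) < #B := by exact_mod_cast hB.card_pos
  set v : G → ℝ := fun x => if x ∈ B then 1 else 0 with hv
  have h1 : v ⬝ᵥ v = #B := by simp [dotProduct, hv]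
  have h2 : v ⬝ᵥ sumMatrix X φ *ᵥ v = -(#B * (#B / q)) := by
    have : v ⬝ᵥ sumMatrix X φ *ᵥ v = ∑ x ∈ B, ∑ y ∈ B, sumMatrix X φ x y := by
      simp [dotProduct, mulVec, hv]
    rw [this]
    have h3 : ∀ x ∈ B, ∀ y ∈ B, sumMatrix X φ x y = -(1 / q) := by
      intro x hx y hy
      have := h x hx y hy
      rw [mem_zeroClass] at this
      simp [sumMatrix, centred, hBX hx, hBX hy, this]
    rw [sum_congr rfl fun x hx => sum_congr rfl (h3 x hx)]
    simp only [sum_const, nsmul_eq_mul]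
    field_simp
  have := dotProduct_mulVec_pow_le v j _ (sumMatrix_isSymm X φ)
  rw [h1, h2, Even.neg_pow (by rw [pow_succ']; exact even_two_mul _), mul_pow] at this
  exact le_of_mul_le_mul_left this (by positivity)

lemma card_dense_independent_le {G : Type*} [AddCommGroup G] [Fintype G]
    [DecidableEq G] {q : ℕ} [NeZero q] (hq : 1 ≤ q) (X : Finset G) (j : ℕ) :
    (#(univ.filter fun φ : G → Fin q => ∃ B ⊆ X, B.Nonempty ∧
      (∀ s ∈ B, ∀ t ∈ B, s + t ∉ zeroClass φ) ∧
      (64 * q * 2 ^ (j + 1) * #X : ℝ) ≤ (#B : ℝ) ^ 2) : ℝ) ≤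
      Fintype.card G * (q : ℝ) ^ Fintype.card G * (1 / 4) ^ 2 ^ (j + 1) := by
  classical
  set E := univ.filter fun φ : G → Fin q => ∃ B ⊆ X, B.Nonempty ∧
      (∀ s ∈ B, ∀ t ∈ B, s + t ∉ zeroClass φ) ∧
      (64 * q * 2 ^ (j + 1) * #X : ℝ) ≤ (#B : ℝ) ^ 2 with hE
  have hq0 : (0 : ℝ) < q := by positivity
  rcases E.eq_empty_or_nonempty with h0 | ⟨φ₀, hφ₀⟩
  · rw [h0]
    simp
    positivity
  obtain ⟨B₀, hB₀X, hB₀, -, hd⟩ := (mem_filter.1 hφ₀).2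
  set l : ℕ := 2 ^ (j + 1) with hl
  have hlr : (2 : ℝ) ^ (j + 1) = l := by simp [hl]
  have hl1 : (1 : ℝ) ≤ l := by rw [← hlr]; exact one_le_pow₀ one_le_two
  have hB₀0 : (0 : ℝ) < #B₀ := by exact_mod_cast hB₀.card_pos
  have hBX : (#B₀ : ℝ) ≤ #X := by exact_mod_cast card_le_card hB₀X
  have hX0 : (0 : ℝ) < #X := by linarith
  rw [hlr] at hd
  have hX : 64 * q * l ≤ (#X : ℝ) := by
    have : 64 * q * l * #X ≤ (#X : ℝ) * #X := by nlinarith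
    exact le_of_mul_le_mul_right this hX0
  set D : ℝ := #X / q with hD
  have hDl : (l : ℝ) ≤ D := by
    rw [hD, le_div_iff₀ hq0]
    nlinarith
  have hD0 : 0 < D := by linarith
  set Y : ℝ := √(D / l) with hYdef
  have hY : 1 ≤ Y := by
    rw [hYdef, Real.one_le_sqrt, one_le_div (by linarith)]
    exact hDl
  have hY2 : Y ^ 2 = D / l := Real.sq_sqrt (by positivity)
  have hR : Y * (#X * (1 / (q * Y ^ 2)) + l) = 2 * √(D * l) := by
    have h1 : (#X : ℝ) * (1 / (q * Y ^ 2)) = l := by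
      rw [hY2, hD]
      field_simp
    have h2 : Y * l = √(D * l) := by
      rw [hYdef, ← Real.sqrt_sq (by positivity : 0 ≤ √(D / l) * l), mul_pow,
        Real.sq_sqrt (by positivity)]
      congr 1
      field_simp
    rw [h1, ← h2]
    ring
  have hsum := sum_trace_sumMatrix_pow_le (q := q) hq hY X l
  rw [hR] at hsum
  have hlow : ∀ φ ∈ E, (8 * √(D * l)) ^ l ≤ (sumMatrix X φ ^ l).trace := by
    intro φ hφ
    obtain ⟨B, hBX', hB, hind, hd'⟩ := (mem_filter.1 hφ).2
    refine le_trans ?_ (pow_le_trace_sumMatrix hBX' hB hind j)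
    rw [← hl]
    gcongr
    have h8 : 8 * √(D * l) = √(64 * (D * l)) := by
      rw [Real.sqrt_mul (by norm_num) (D * l), show (64 : ℝ) = 8 ^ 2 by norm_num,
        Real.sqrt_sq (by norm_num)]
    rw [h8]
    apply Real.sqrt_le_iff.2
    refine ⟨by positivity, ?_⟩
    rw [hlr] at hd'
    rw [hD, div_pow, le_div_iff₀ (by positivity)]
    calc 64 * (#X / q * l) * (q : ℝ) ^ 2 = 64 * q * l * #X := by field_simp
      _ ≤ _ := hd'
  have hmark : (#E : ℝ) * (8 * √(D * l)) ^ l ≤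
      Fintype.card G * ((q : ℝ) ^ Fintype.card G * (2 * √(D * l)) ^ l) := by
    refine le_trans ?_ hsum
    rw [← nsmul_eq_mul, ← sum_const]
    refine (sum_le_sum hlow).trans (sum_le_sum_of_subset_of_nonneg (filter_subset _ _) ?_)
    intro φ _ _
    rw [hl, pow_succ']
    exact trace_pow_two_mul_nonneg (sumMatrix_isSymm X φ) _
  have hpos : 0 < (8 * √(D * l)) ^ l := by positivity
  have h24 : (2 * √(D * l)) ^ l = (1 / 4) ^ l * (8 * √(D * l)) ^ l := by
    rw [← mul_pow]
    congr 1
    ring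
  rw [h24] at hmark
  refine le_of_mul_le_mul_right ?_ hpos
  calc _ ≤ _ := hmark
    _ = _ := by ring

open ComplexConjugate in
lemma sum_norm_sq_of_orthogonal {I K : Type*} [Fintype I] [DecidableEq I] [Fintype K]
    (e : I → K → ℂ) (N : ℝ)
    (he : ∀ i i', ∑ k, e i k * conj (e i' k) = if i = i' then (N : ℂ) else 0)
    (g : I → ℂ) : ∑ k, ‖∑ i, g i * e i k‖ ^ 2 = N * ∑ i, ‖g i‖ ^ 2 := by
  have h : ((∑ k, ‖∑ i, g i * e i k‖ ^ 2 : ℝ) : ℂ) = ((N * ∑ i, ‖g i‖ ^ 2 : ℝ) : ℂ) := by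
    push_cast
    calc ∑ k, (‖∑ i, g i * e i k‖ : ℂ) ^ 2
        = ∑ k, ∑ i, ∑ i', g i * conj (g i') * (e i k * conj (e i' k)) := by
          refine sum_congr rfl fun k _ => ?_
          rw [← Complex.mul_conj', map_sum, sum_mul_sum]
          refine sum_congr rfl fun i _ => sum_congr rfl fun i' _ => ?_
          rw [map_mul]
          ring
      _ = ∑ i, ∑ i', g i * conj (g i') * ∑ k, e i k * conj (e i' k) := by
          rw [sum_comm]
          refine sum_congr rfl fun i _ => ?_
          rw [sum_comm]
          simp_rw [mul_sum]
      _ = _ := by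
          simp_rw [he, mul_ite, mul_zero]
          rw [mul_sum]
          refine sum_congr rfl fun i _ => ?_
          rw [sum_ite_eq univ i]
          simp only [mem_univ, if_true]
          rw [Complex.mul_conj', mul_comm]
  exact_mod_cast h

open ComplexConjugate in
lemma sum_norm_sq_fourier {G : Type*} [AddCommGroup G] [Fintype G] [DecidableEq G] (g : G → ℂ) :
    ∑ χ : AddChar G ℂ, ‖∑ x, g x * χ x‖ ^ 2 = Fintype.card G * ∑ x, ‖g x‖ ^ 2 := by
  have := sum_norm_sq_of_orthogonal (fun (x : G) (χ : AddChar G ℂ) => χ x) (Fintype.card G) ?_ g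
  · exact this
  · intro x y
    have h : ∀ χ : AddChar G ℂ, χ x * conj (χ y) = χ (x - y) := by
      intro χ
      rw [← AddChar.map_neg_eq_conj, ← AddChar.map_add_eq_mul, sub_eq_add_neg]
    simp_rw [h]
    rw [AddChar.sum_apply_eq_ite]
    simp [sub_eq_zero]

open ComplexConjugate in
lemma sum_norm_sq_fourier_dual {G : Type*} [AddCommGroup G] [Fintype G] [DecidableEq G]
    (c : AddChar G ℂ → ℂ) :
    ∑ x, ‖∑ χ, c χ * conj (χ x)‖ ^ 2 = Fintype.card G * ∑ χ, ‖c χ‖ ^ 2 := by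
  classical
  have := sum_norm_sq_of_orthogonal (fun (χ : AddChar G ℂ) (x : G) => conj (χ x))
    (Fintype.card G) ?_ c
  · exact this
  · intro χ ψ
    have h : ∀ x : G, conj (χ x) * conj (conj (ψ x)) = (ψ - χ) x := by
      intro x
      rw [Complex.conj_conj, AddChar.sub_apply', ← AddChar.map_neg_eq_conj, mul_comm,
        AddChar.map_neg_eq_inv, div_eq_mul_inv]
    simp_rw [h]
    rw [AddChar.sum_eq_ite]
    simp [sub_eq_zero, eq_comm]

/-- The normalised Fourier coefficient of a finite set. -/
noncomputable def coeff {G : Type*} [AddCommGroup G] (B : Finset G) (χ : AddChar G ℂ) : ℂ :=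
  (∑ x ∈ B, χ x) / #B

/-- The normalised Fourier coefficient of a finite sequence. -/
noncomputable def seqCoeff {G : Type*} [AddCommGroup G] {f : ℕ} (a : Fin f → G)
    (χ : AddChar G ℂ) : ℂ :=
  (∑ i, χ (a i)) / f

lemma norm_coeff_le_one {G : Type*} [AddCommGroup G] [Finite G] (B : Finset G) (χ : AddChar G ℂ) :
    ‖coeff B χ‖ ≤ 1 := by
  unfold coeff
  rw [norm_div, Complex.norm_natCast]
  refine div_le_one_of_le₀ ?_ (by positivity)
  refine (norm_sum_le _ _).trans ?_
  simp [AddChar.norm_apply]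

lemma sum_norm_coeff_sq {G : Type*} [AddCommGroup G] [Fintype G] [DecidableEq G] {B : Finset G}
    (hB : B.Nonempty) : #B * ∑ χ : AddChar G ℂ, ‖coeff B χ‖ ^ 2 = Fintype.card G := by
  have hb : (#B : ℝ) ≠ 0 := by exact_mod_cast hB.card_pos.ne'
  have := sum_norm_sq_fourier (fun x => if x ∈ B then (1 : ℂ) else 0)
  have h1 : ∀ χ : AddChar G ℂ, ∑ x, (if x ∈ B then (1 : ℂ) else 0) * χ x = ∑ x ∈ B, χ x := by
    intro χ; simp
  have h2 : ∑ x : G, ‖(if x ∈ B then (1 : ℂ) else 0)‖ ^ 2 = #B := by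
    rw [← sum_subset (subset_univ B)]
    · rw [sum_congr rfl (g := fun _ => (1 : ℝ))]
      · simp
      · intro x hx; simp [hx]
    · intro x _ hx; simp [hx]
  simp_rw [h1, h2] at this
  unfold coeff
  simp_rw [norm_div, Complex.norm_natCast, div_pow]
  rw [← sum_div, this]
  field_simp

lemma sum_sum_apply_mul_card {α : Type*} [Fintype α] (z : α → ℂ) (f : ℕ) :
    (∑ a : Fin f → α, ∑ i, z (a i)) * Fintype.card α = f * (Fintype.card α : ℂ) ^ f * ∑ x, z x := by
  induction f with
  | zero => simp
  | succ f ih =>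
    rw [← (Fin.consEquiv fun _ : Fin (f + 1) => α).sum_comp, Fintype.sum_prod_type]
    simp only [Fin.consEquiv_apply, Fin.sum_univ_succ, Fin.cons_zero, Fin.cons_succ,
      sum_add_distrib, sum_const, card_univ, nsmul_eq_mul, Fintype.card_fun, Fintype.card_fin]
    rw [add_mul, ← mul_sum, mul_assoc (Fintype.card α : ℂ), ih]
    push_cast
    ring

open ComplexConjugate in
lemma sum_norm_sq_sum_apply_le {α : Type*} [Fintype α] (z : α → ℂ) (hz : ∀ x, ‖z x‖ ≤ 1) (f : ℕ) :
    (∑ a : Fin f → α, ‖∑ i, z (a i)‖ ^ 2) * (Fintype.card α : ℝ) ^ 2 ≤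
      (Fintype.card α : ℝ) ^ f * (f * (Fintype.card α : ℝ) ^ 2 + f ^ 2 * ‖∑ x, z x‖ ^ 2) := by
  induction f with
  | zero => simp
  | succ f ih =>
    rw [← (Fin.consEquiv fun _ : Fin (f + 1) => α).sum_comp, Fintype.sum_prod_type]
    simp only [Fin.consEquiv_apply, Fin.sum_univ_succ, Fin.cons_zero, Fin.cons_succ]
    set b : ℝ := (Fintype.card α : ℝ) with hb
    have hmean := sum_sum_apply_mul_card z f
    set Z := ∑ x, z x with hZ
    have h1 : ∀ (x : α) (a : Fin f → α), ‖z x + ∑ i, z (a i)‖ ^ 2 ≤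
        1 + ‖∑ i, z (a i)‖ ^ 2 + 2 * (conj (z x) * ∑ i, z (a i)).re := by
      intro x a
      have := hz x
      have h3 : ‖z x + ∑ i, z (a i)‖ ^ 2 =
          ‖z x‖ ^ 2 + ‖∑ i, z (a i)‖ ^ 2 + 2 * (conj (z x) * ∑ i, z (a i)).re := by
        rw [← Complex.normSq_eq_norm_sq, ← Complex.normSq_eq_norm_sq, ← Complex.normSq_eq_norm_sq,
          Complex.normSq_add]
        congr 2
        simp [Complex.mul_re]
      rw [h3]
      have : ‖z x‖ ^ 2 ≤ 1 := pow_le_one₀ (norm_nonneg _) this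
      linarith
    have h2 : ∑ x, ∑ a : Fin f → α, ‖z x + ∑ i, z (a i)‖ ^ 2 ≤
        b ^ (f + 1) + b * ∑ a : Fin f → α, ‖∑ i, z (a i)‖ ^ 2 +
          2 * (conj Z * ∑ a : Fin f → α, ∑ i, z (a i)).re := by
      calc _ ≤ ∑ x, ∑ a : Fin f → α,
            (1 + ‖∑ i, z (a i)‖ ^ 2 + 2 * (conj (z x) * ∑ i, z (a i)).re) :=
            sum_le_sum fun x _ => sum_le_sum fun a _ => h1 x a
        _ = _ := by
            simp only [sum_add_distrib, ← mul_sum, ← Complex.re_sum, ← sum_mul, sum_const,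
              card_univ, nsmul_eq_mul, Fintype.card_fun, Fintype.card_fin, hZ, map_sum]
            push_cast
            ring
    have h3 : (conj Z * ∑ a : Fin f → α, ∑ i, z (a i)).re * b = f * b ^ f * ‖Z‖ ^ 2 := by
      have h4 : (conj Z * ∑ a : Fin f → α, ∑ i, z (a i)) * b = ((f * b ^ f * ‖Z‖ ^ 2 : ℝ) : ℂ) := by
        rw [mul_assoc, hb]
        push_cast
        rw [hmean, ← Complex.conj_mul']
        ring
      have h5 := congrArg Complex.re h4
      rwa [Complex.re_mul_ofReal, Complex.ofReal_re] at h5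
    have hb0 : 0 ≤ b := by positivity
    calc _ ≤ (b ^ (f + 1) + b * ∑ a : Fin f → α, ‖∑ i, z (a i)‖ ^ 2 +
          2 * (conj Z * ∑ a : Fin f → α, ∑ i, z (a i)).re) * b ^ 2 := by gcongr
      _ = b ^ (f + 1) * b ^ 2 + b * ((∑ a : Fin f → α, ‖∑ i, z (a i)‖ ^ 2) * b ^ 2) +
          2 * b * ((conj Z * ∑ a : Fin f → α, ∑ i, z (a i)).re * b) := by ring
      _ ≤ b ^ (f + 1) * b ^ 2 + b * (b ^ f * (f * b ^ 2 + f ^ 2 * ‖Z‖ ^ 2)) +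
          2 * b * (f * b ^ f * ‖Z‖ ^ 2) := by rw [h3]; gcongr
      _ ≤ _ := by
          push_cast
          have : 0 ≤ b ^ (f + 1) * ‖Z‖ ^ 2 := by positivity
          rw [← sub_nonneg]
          convert this using 1
          ring

lemma card_pow_four_le_card_image_mul {G : Type*} [AddCommGroup G] [Fintype G] [DecidableEq G]
    {f : ℕ} (a a' : Fin f → G) :
    (f : ℝ) ^ 4 * Fintype.card G ≤ #(univ.image fun p : Fin f × Fin f => a p.1 + a' p.2) *
      ∑ χ : AddChar G ℂ, ‖∑ i, χ (a i)‖ ^ 2 * ‖∑ i, χ (a' i)‖ ^ 2 := by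
  set s : Fin f × Fin f → G := fun p => a p.1 + a' p.2 with hs
  set r : G → ℝ := fun x => ∑ p, if s p = x then 1 else 0 with hr
  have h1 : ∀ χ : AddChar G ℂ, ∑ x, (r x : ℂ) * χ x = (∑ i, χ (a i)) * ∑ i, χ (a' i) := by
    intro χ
    simp only [hr, Complex.ofReal_sum, sum_mul]
    rw [sum_comm]
    simp only [apply_ite (Complex.ofReal), Complex.ofReal_one, Complex.ofReal_zero, ite_mul,
      one_mul, zero_mul, sum_ite_eq, mem_univ, if_true, Fintype.sum_prod_type, hs,
      AddChar.map_add_eq_mul, mul_sum]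
  have h2 := sum_norm_sq_fourier (fun x => (r x : ℂ))
  simp only [h1, norm_mul, mul_pow, Complex.norm_real, Real.norm_eq_abs, sq_abs] at h2
  rw [h2]
  have h3 : ∑ x ∈ univ.image s, r x = (f : ℝ) ^ 2 := by
    simp only [hr]
    rw [sum_comm, sum_congr rfl (g := fun _ => (1 : ℝ))]
    · simp [sq]
    · intro p _
      rw [sum_ite_eq, if_pos (mem_image_of_mem s (mem_univ p))]
  have h4 := sq_sum_le_card_mul_sum_sq (s := univ.image s) (f := r)
  rw [h3] at h4
  have h5 : ∑ x ∈ univ.image s, r x ^ 2 ≤ ∑ x, r x ^ 2 :=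
    sum_le_sum_of_subset_of_nonneg (subset_univ _) fun _ _ _ => sq_nonneg _
  calc (f : ℝ) ^ 4 * Fintype.card G = Fintype.card G * ((f : ℝ) ^ 2) ^ 2 := by ring
    _ ≤ Fintype.card G * (#(univ.image s) * ∑ x, r x ^ 2) := by
        gcongr
        exact h4.trans (by gcongr)
    _ = _ := by ring

lemma fourth_moment_of_card_image_le {G : Type*} [AddCommGroup G] [Fintype G] [DecidableEq G]
    {B : Finset G} (hB : B.Nonempty) (f : ℕ) {W : ℝ} (hW : 0 ≤ W)
    (h : ∀ a a' : Fin f → B,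
      (#(univ.image fun p : Fin f × Fin f => (a p.1 + a' p.2 : G)) : ℝ) ≤ W) :
    (f : ℝ) ^ 4 * #B * Fintype.card G ≤ W * (f ^ 2 * #B * Fintype.card G +
      2 * f ^ 3 * Fintype.card G + f ^ 4 * #B * ∑ χ : AddChar G ℂ, ‖coeff B χ‖ ^ 4) := by
  set b : ℝ := (#B : ℝ) with hb
  have hb0 : 0 < b := by rw [hb]; exact_mod_cast hB.card_pos
  set n : ℝ := (Fintype.card G : ℝ) with hn
  have hcard : (Fintype.card B : ℝ) = b := by simp [hb]
  set S : AddChar G ℂ → ℝ := fun χ => ∑ a : Fin f → B, ‖∑ i, χ (a i)‖ ^ 2 with hS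
  have hSle : ∀ χ, S χ ≤ b ^ f * (f + f ^ 2 * ‖coeff B χ‖ ^ 2) := by
    intro χ
    have h1 := sum_norm_sq_sum_apply_le (fun x : B => χ x) (fun x => (AddChar.norm_apply χ _).le) f
    rw [hcard] at h1
    have h2 : ‖∑ x : B, χ x‖ = b * ‖coeff B χ‖ := by
      rw [coeff, norm_div, Complex.norm_natCast, ← hb, sum_coe_sort B (fun x => χ x)]
      field_simp
    rw [h2] at h1
    have h3 : S χ * b ^ 2 ≤ (b ^ f * (f + f ^ 2 * ‖coeff B χ‖ ^ 2)) * b ^ 2 := by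
      refine h1.trans (le_of_eq ?_)
      ring
    exact le_of_mul_le_mul_right h3 (by positivity)
  have hS0 : ∀ χ, 0 ≤ S χ := fun χ => sum_nonneg fun _ _ => sq_nonneg _
  have hpair : (f : ℝ) ^ 4 * n * (b ^ f) ^ 2 ≤ W * ∑ χ, S χ ^ 2 := by
    have h1 : ∑ a : Fin f → B, ∑ a' : Fin f → B, (f : ℝ) ^ 4 * n ≤
        ∑ a : Fin f → B, ∑ a' : Fin f → B, W *
          ∑ χ : AddChar G ℂ, ‖∑ i, χ (a i)‖ ^ 2 * ‖∑ i, χ (a' i)‖ ^ 2 := by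
      refine sum_le_sum fun a _ => sum_le_sum fun a' _ => ?_
      refine (card_pow_four_le_card_image_mul (fun i => (a i : G)) (fun i => (a' i : G))).trans ?_
      exact mul_le_mul_of_nonneg_right (h a a') (sum_nonneg fun _ _ => by positivity)
    have h2 : ∑ a : Fin f → B, ∑ a' : Fin f → B, W *
          ∑ χ : AddChar G ℂ, ‖∑ i, χ (a i)‖ ^ 2 * ‖∑ i, χ (a' i)‖ ^ 2 = W * ∑ χ, S χ ^ 2 := by
      simp_rw [← mul_sum]
      congr 1
      calc _ = ∑ a : Fin f → B, ∑ χ : AddChar G ℂ, ∑ a' : Fin f → B,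
            ‖∑ i, χ (a i)‖ ^ 2 * ‖∑ i, χ (a' i)‖ ^ 2 := sum_congr rfl fun a _ => sum_comm
        _ = ∑ χ : AddChar G ℂ, ∑ a : Fin f → B, ∑ a' : Fin f → B,
            ‖∑ i, χ (a i)‖ ^ 2 * ‖∑ i, χ (a' i)‖ ^ 2 := sum_comm
        _ = _ := by
            refine sum_congr rfl fun χ _ => ?_
            rw [sq, hS, sum_mul_sum]
    rw [h2] at h1
    refine le_trans (le_of_eq ?_) h1
    simp only [sum_const, card_univ, nsmul_eq_mul, Fintype.card_fun, Fintype.card_fin]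
    push_cast
    rw [hcard]
    ring
  have hexp : ∑ χ, S χ ^ 2 ≤ (b ^ f) ^ 2 * (f ^ 2 * n + 2 * f ^ 3 * (n / b) +
      f ^ 4 * ∑ χ : AddChar G ℂ, ‖coeff B χ‖ ^ 4) := by
    calc ∑ χ, S χ ^ 2 ≤ ∑ χ, (b ^ f * (f + f ^ 2 * ‖coeff B χ‖ ^ 2)) ^ 2 := by
          refine sum_le_sum fun χ _ => ?_
          have := hS0 χ
          gcongr
          exact hSle χ
      _ = ∑ χ, ((b ^ f) ^ 2 * (f ^ 2) + (b ^ f) ^ 2 * (2 * f ^ 3) * ‖coeff B χ‖ ^ 2 +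
            (b ^ f) ^ 2 * f ^ 4 * ‖coeff B χ‖ ^ 4) := by
          refine sum_congr rfl fun χ _ => ?_
          ring
      _ = (b ^ f) ^ 2 * (f ^ 2) * n +
          (b ^ f) ^ 2 * (2 * f ^ 3) * ∑ χ : AddChar G ℂ, ‖coeff B χ‖ ^ 2 +
            (b ^ f) ^ 2 * f ^ 4 * ∑ χ : AddChar G ℂ, ‖coeff B χ‖ ^ 4 := by
          simp only [sum_add_distrib, ← mul_sum, sum_const, card_univ, AddChar.card_eq,
            nsmul_eq_mul, ← hn]
          ring
      _ = _ := by
          have h1 := sum_norm_coeff_sq (G := G) hB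
          rw [← hn, ← hb] at h1
          have h2 : ∑ χ : AddChar G ℂ, ‖coeff B χ‖ ^ 2 = n / b := by
            rw [eq_div_iff hb0.ne', ← h1]; ring
          rw [h2]
          ring
  have hfin : (f : ℝ) ^ 4 * n * (b ^ f) ^ 2 ≤ (W * (f ^ 2 * n + 2 * f ^ 3 * (n / b) +
      f ^ 4 * ∑ χ : AddChar G ℂ, ‖coeff B χ‖ ^ 4)) * (b ^ f) ^ 2 :=
    hpair.trans ((mul_le_mul_of_nonneg_left hexp hW).trans (le_of_eq (by ring)))
  have h6 := le_of_mul_le_mul_right hfin (by positivity)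
  calc (f : ℝ) ^ 4 * b * n = (f ^ 4 * n) * b := by ring
    _ ≤ _ := mul_le_mul_of_nonneg_right h6 hb0.le
    _ = _ := by field_simp

/-- If the truncated fourth moment is not tiny, some dyadic level set carries a large second
moment. -/
lemma exists_dyadic_level {ι : Type*} [Fintype ι] (t : ι → ℝ) (ht0 : ∀ i, 0 ≤ t i)
    (ht1 : ∀ i, t i ≤ 1) {J : ℕ} (hJ : 1 ≤ J) {c : ℝ}
    (h : (1 / 4) ^ J * ∑ i, t i ^ 2 + 4 * J * c ≤ ∑ i, t i ^ 4) :
    ∃ j ∈ Icc 1 J, c ≤ (1 / 4) ^ j * ∑ i with (1 / 2) ^ j ≤ t i, t i ^ 2 := by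
  by_contra! hcon
  have hpt : ∀ i, t i ^ 4 ≤ (1 / 4) ^ J * t i ^ 2 +
      ∑ j ∈ Icc 1 J, 4 * ((1 / 4) ^ j * if (1 / 2) ^ j ≤ t i then t i ^ 2 else 0) := by
    intro i
    have hsq : ∀ j : ℕ, ((1 / 2 : ℝ) ^ j) ^ 2 = (1 / 4) ^ j := by
      intro j
      rw [← pow_mul, mul_comm, pow_mul]
      norm_num
    have hnn : ∀ j ∈ Icc 1 J,
        0 ≤ 4 * ((1 / 4 : ℝ) ^ j * if (1 / 2) ^ j ≤ t i then t i ^ 2 else 0) := by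
      intro j _
      split_ifs <;> positivity
    by_cases hsmall : t i < (1 / 2) ^ J
    · have h1 : t i ^ 2 ≤ (1 / 4) ^ J := by
        rw [← hsq]
        have := ht0 i
        gcongr
      have h2 : t i ^ 4 ≤ (1 / 4) ^ J * t i ^ 2 := by
        nlinarith [sq_nonneg (t i)]
      have := sum_nonneg hnn
      linarith
    · push Not at hsmall
      have hpos : 0 < t i := lt_of_lt_of_le (by positivity) hsmall
      obtain ⟨m, hm1, hm2⟩ := exists_nat_pow_near_of_lt_one hpos (ht1 i)
        (by norm_num : (0 : ℝ) < 1 / 2) (by norm_num)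
      obtain ⟨j, hjI, hj1, hj2⟩ : ∃ j ∈ Icc 1 J, (1 / 2) ^ j ≤ t i ∧ t i ^ 2 ≤ 4 * (1 / 4) ^ j := by
        rcases lt_or_ge m J with hmJ | hmJ
        · refine ⟨m + 1, mem_Icc.2 ⟨by omega, by omega⟩, hm1.le, ?_⟩
          calc t i ^ 2 ≤ ((1 / 2) ^ m) ^ 2 := by gcongr
            _ = 4 * (1 / 4) ^ (m + 1) := by rw [hsq, pow_succ]; ring
        · refine ⟨J, mem_Icc.2 ⟨hJ, le_rfl⟩, hsmall, ?_⟩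
          calc t i ^ 2 ≤ ((1 / 2) ^ m) ^ 2 := by gcongr
            _ ≤ ((1 / 2) ^ J) ^ 2 := by
                gcongr ?_ ^ 2
                exact pow_le_pow_of_le_one (by norm_num) (by norm_num) hmJ
            _ ≤ _ := by
                rw [hsq]
                have : (0 : ℝ) ≤ (1 / 4) ^ J := by positivity
                linarith
      have h3 := single_le_sum hnn hjI
      rw [if_pos hj1] at h3
      have h4 : (0 : ℝ) ≤ (1 / 4) ^ J * t i ^ 2 := by positivity
      nlinarith [sq_nonneg (t i)]
  have hsum : ∑ i, t i ^ 4 ≤ (1 / 4) ^ J * ∑ i, t i ^ 2 +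
      ∑ j ∈ Icc 1 J, 4 * ((1 / 4) ^ j * ∑ i with (1 / 2) ^ j ≤ t i, t i ^ 2) := by
    refine (sum_le_sum fun i _ => hpt i).trans (le_of_eq ?_)
    rw [sum_add_distrib, ← mul_sum, sum_comm]
    congr 1
    refine sum_congr rfl fun j _ => ?_
    rw [← mul_sum, ← mul_sum, sum_filter]
  have hlt : ∑ j ∈ Icc 1 J, 4 * ((1 / 4) ^ j * ∑ i with (1 / 2) ^ j ≤ t i, t i ^ 2) <
      ∑ j ∈ Icc 1 J, 4 * c := by
    refine sum_lt_sum_of_nonempty ⟨1, mem_Icc.2 ⟨le_rfl, hJ⟩⟩ fun j hj => ?_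
    have := hcon j hj
    linarith
  rw [sum_const, Nat.card_Icc, nsmul_eq_mul, Nat.add_sub_cancel] at hlt
  linarith

lemma exists_sample_sum_lt {α κ : Type*} [Fintype α] [Nonempty α] [Fintype κ] (Y : κ → α → ℝ)
    (hY : ∀ k x, |Y k x| ≤ 2) (hmean : ∀ k, ∑ x, Y k x = 0)
    (hvar : ∀ k, ∑ x, Y k x ^ 2 ≤ Fintype.card α) (f : ℕ) {ε : ℝ} (hε : 0 ≤ ε) (hε1 : ε ≤ 1)
    (hf : Fintype.card κ * Real.exp (-(f * ε ^ 2 / 4)) < 1) :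
    ∃ a : Fin f → α, ∀ k, ∑ i, Y k (a i) < f * ε := by
  by_contra! hcon
  set m : ℝ := (Fintype.card α : ℝ) with hm
  have hm0 : 0 < m := by rw [hm]; exact_mod_cast Fintype.card_pos
  have hexp : ∀ k, ∑ x, Real.exp (ε / 2 * Y k x) ≤ m * Real.exp (ε ^ 2 / 4) := by
    intro k
    calc ∑ x, Real.exp (ε / 2 * Y k x)
        ≤ ∑ x, (1 + ε / 2 * Y k x + ε ^ 2 / 4 * Y k x ^ 2) := by
          refine sum_le_sum fun x _ => ?_
          have h1 : |ε / 2 * Y k x| ≤ 1 := by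
            rw [abs_mul, abs_of_nonneg (by linarith)]
            nlinarith [hY k x, abs_nonneg (Y k x)]
          have h2 := (abs_le.1 (Real.abs_exp_sub_one_sub_id_le h1)).2
          nlinarith
      _ = m + ε ^ 2 / 4 * ∑ x, Y k x ^ 2 := by
          rw [sum_add_distrib, sum_add_distrib, ← mul_sum, ← mul_sum, hmean]
          simp [hm]
      _ ≤ m * (ε ^ 2 / 4 + 1) := by
          nlinarith [hvar k, sq_nonneg ε]
      _ ≤ _ := by
          gcongr
          exact Real.add_one_le_exp _
  have hlow : m ^ f ≤ ∑ a : Fin f → α, ∑ k, Real.exp (ε / 2 * (∑ i, Y k (a i) - f * ε)) := by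
    have : m ^ f = ∑ a : Fin f → α, (1 : ℝ) := by simp [hm]
    rw [this]
    refine sum_le_sum fun a _ => ?_
    obtain ⟨k, hk⟩ := hcon a
    refine le_trans ?_ (single_le_sum (fun _ _ => (Real.exp_pos _).le) (mem_univ k))
    exact Real.one_le_exp (mul_nonneg (by linarith) (by linarith))
  have hup : ∑ a : Fin f → α, ∑ k, Real.exp (ε / 2 * (∑ i, Y k (a i) - f * ε)) ≤
      m ^ f * (Fintype.card κ * Real.exp (-(f * ε ^ 2 / 4))) := by
    rw [sum_comm]
    calc _ ≤ ∑ k : κ, m ^ f * Real.exp (-(f * ε ^ 2 / 4)) := by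
          refine sum_le_sum fun k _ => ?_
          have h1 : ∀ a : Fin f → α, Real.exp (ε / 2 * (∑ i, Y k (a i) - f * ε)) =
              Real.exp (-(f * ε ^ 2 / 2)) * ∏ i, Real.exp (ε / 2 * Y k (a i)) := by
            intro a
            rw [← Real.exp_sum, ← Real.exp_add, ← mul_sum]
            congr 1
            ring
          simp_rw [h1]
          rw [← mul_sum, ← Fintype.sum_pow (fun x => Real.exp (ε / 2 * Y k x))]
          calc _ ≤ Real.exp (-(f * ε ^ 2 / 2)) * (m * Real.exp (ε ^ 2 / 4)) ^ f := by
                gcongr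
                exact hexp k
            _ = m ^ f * (Real.exp (-(f * ε ^ 2 / 2)) * Real.exp (f * (ε ^ 2 / 4))) := by
                rw [mul_pow, ← Real.exp_nat_mul]
                ring
            _ = _ := by
                rw [← Real.exp_add]
                congr 2
                ring
      _ = _ := by
          rw [sum_const, card_univ, nsmul_eq_mul]
          ring
  have : m ^ f * (Fintype.card κ * Real.exp (-(f * ε ^ 2 / 4))) < m ^ f * 1 := by gcongr
  linarith

lemma norm_le_of_re_rotations_le {z : ℂ} {δ : ℝ}
    (h : ∀ k : Fin 4, (Complex.I ^ (k : ℕ) * z).re ≤ δ) : ‖z‖ ≤ 2 * δ := by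
  have h0 := h 0
  have h1 := h 1
  have h2 := h 2
  have h3 := h 3
  simp [Complex.I_pow_three] at h0 h1 h2 h3
  have := Complex.norm_le_abs_re_add_abs_im z
  have : |z.re| ≤ δ := abs_le.2 ⟨by linarith, h0⟩
  have : |z.im| ≤ δ := abs_le.2 ⟨by linarith, by linarith⟩
  linarith

open ComplexConjugate in
lemma exists_seqCoeff_close {G : Type*} [AddCommGroup G] [Fintype G] [DecidableEq G]
    {B : Finset G} (hB : B.Nonempty) {f : ℕ} (hf0 : f ≠ 0) {ε : ℝ} (hε : 0 ≤ ε) (hε1 : ε ≤ 1)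
    (hf : 4 * Fintype.card G * Real.exp (-(f * ε ^ 2 / 4)) < 1) :
    ∃ a : Fin f → B, ∀ χ : AddChar G ℂ, ‖seqCoeff (fun i => (a i : G)) χ - coeff B χ‖ ≤ 2 * ε := by
  have hb0 : (#B : ℂ) ≠ 0 := by exact_mod_cast hB.card_pos.ne'
  have hne : Nonempty B := hB.to_subtype
  have hsum : ∀ χ : AddChar G ℂ, ∑ x : B, χ x = #B * coeff B χ := by
    intro χ
    rw [coeff, sum_coe_sort B (fun x => χ x)]
    field_simp
  have key := exists_sample_sum_lt (α := B) (κ := AddChar G ℂ × Fin 4)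
    (fun k x => (Complex.I ^ (k.2 : ℕ) * (k.1 x - coeff B k.1)).re) ?_ ?_ ?_ f hε hε1 ?_
  · obtain ⟨a, ha⟩ := key
    refine ⟨a, fun χ => norm_le_of_re_rotations_le fun k => ?_⟩
    have h1 := ha (χ, k)
    have hf0' : (f : ℂ) ≠ 0 := by exact_mod_cast hf0
    have hfpos : (0 : ℝ) < f := by positivity
    have h2 : Complex.I ^ (k : ℕ) * (seqCoeff (fun i => (a i : G)) χ - coeff B χ) =
        (∑ i, Complex.I ^ (k : ℕ) * (χ (a i) - coeff B χ)) / (f : ℝ) := by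
      rw [← mul_sum, sum_sub_distrib, sum_const, card_univ, Fintype.card_fin, nsmul_eq_mul,
        seqCoeff]
      push_cast
      field_simp
    rw [h2, Complex.div_ofReal_re, Complex.re_sum, div_le_iff₀ hfpos]
    linarith
  · intro k x
    refine (Complex.abs_re_le_norm _).trans ?_
    rw [norm_mul, norm_pow, Complex.norm_I, one_pow, one_mul]
    refine (norm_sub_le _ _).trans ?_
    have := norm_coeff_le_one B k.1
    rw [AddChar.norm_apply]
    linarith
  · intro k
    rw [← Complex.re_sum, ← mul_sum, sum_sub_distrib, hsum]
    simp
  · intro k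
    calc _ ≤ ∑ x : B, ‖k.1 x - coeff B k.1‖ ^ 2 := by
          refine sum_le_sum fun x _ => ?_
          have := Complex.abs_re_le_norm (Complex.I ^ (k.2 : ℕ) * (k.1 x - coeff B k.1))
          rw [norm_mul, norm_pow, Complex.norm_I, one_pow, one_mul] at this
          rw [← sq_abs]
          gcongr
      _ = ∑ x : B, (1 + ‖coeff B k.1‖ ^ 2 - 2 * (k.1 x * conj (coeff B k.1)).re) := by
          refine sum_congr rfl fun x _ => ?_
          rw [← Complex.normSq_eq_norm_sq, Complex.normSq_sub, Complex.normSq_eq_norm_sq,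
            Complex.normSq_eq_norm_sq, AddChar.norm_apply, one_pow]
      _ = #B - #B * ‖coeff B k.1‖ ^ 2 := by
          rw [sum_sub_distrib, ← mul_sum, ← Complex.re_sum, ← sum_mul, hsum, mul_assoc,
            Complex.mul_conj']
          have : ((#B : ℂ) * (‖coeff B k.1‖ : ℂ) ^ 2).re = #B * ‖coeff B k.1‖ ^ 2 := by
            have : ((#B : ℂ) * (‖coeff B k.1‖ : ℂ) ^ 2) = ((#B * ‖coeff B k.1‖ ^ 2 : ℝ) : ℂ) := by
              push_cast; rfl
            rw [this, Complex.ofReal_re]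
          rw [this]
          simp
          ring
      _ ≤ _ := by
          have : 0 ≤ (#B : ℝ) * ‖coeff B k.1‖ ^ 2 := by positivity
          simp only [Fintype.card_coe]
          linarith
  · rw [Fintype.card_prod, AddChar.card_eq, Fintype.card_fin]
    push_cast
    linarith

lemma sum_inv_rank_le {α : Type*} [DecidableEq α] (h : α → ℝ) (B : Finset α) :
    ∑ x ∈ B, (1 : ℝ) / #(B.filter fun y => h x ≤ h y) ≤ harmonic #B := by
  induction B using Finset.induction_on_min_value h with
  | empty => simp
  | insert a s ha hmin ih =>
    rw [sum_insert ha, card_insert_of_notMem ha, harmonic_succ]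
    have h1 : #((insert a s).filter fun y => h a ≤ h y) = #s + 1 := by
      rw [filter_true_of_mem, card_insert_of_notMem ha]
      intro y hy
      rcases mem_insert.1 hy with rfl | hy
      · exact le_rfl
      · exact hmin y hy
    rw [h1]
    have h2 : ∑ x ∈ s, (1 : ℝ) / #((insert a s).filter fun y => h x ≤ h y) ≤
        ∑ x ∈ s, (1 : ℝ) / #(s.filter fun y => h x ≤ h y) := by
      refine sum_le_sum fun x hx => ?_
      have hpos : 0 < #(s.filter fun y => h x ≤ h y) :=
        card_pos.2 ⟨x, mem_filter.2 ⟨hx, le_rfl⟩⟩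
      have hpos' : (0 : ℝ) < #(s.filter fun y => h x ≤ h y) := by exact_mod_cast hpos
      refine one_div_le_one_div_of_le hpos' ?_
      exact_mod_cast card_le_card (filter_subset_filter _ (subset_insert _ _))
    push_cast
    rw [one_div]
    linarith

lemma exists_le_mul_rank {α : Type*} [DecidableEq α] (h : α → ℝ) {B : Finset α}
    (hB : B.Nonempty) (hpos : 0 ≤ ∑ x ∈ B, h x) :
    ∃ x ∈ B, ∑ y ∈ B, h y ≤ (1 + Real.log #B) * (h x * #(B.filter fun y => h x ≤ h y)) := by
  by_contra! hcon
  have hrank := (sum_inv_rank_le h B).trans (harmonic_le_one_add_log #B)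
  have hlog : 0 ≤ Real.log #B := Real.log_natCast_nonneg _
  set H := 1 + Real.log #B with hH
  have hH0 : 0 < H := by linarith
  have hlt : ∑ x ∈ B, H * h x <
      ∑ x ∈ B, (∑ y ∈ B, h y) * ((1 : ℝ) / #(B.filter fun y => h x ≤ h y)) := by
    refine sum_lt_sum_of_nonempty hB fun x hx => ?_
    have hpos : 0 < #(B.filter fun y => h x ≤ h y) := card_pos.2 ⟨x, mem_filter.2 ⟨hx, le_rfl⟩⟩
    have hpos' : (0 : ℝ) < #(B.filter fun y => h x ≤ h y) := by exact_mod_cast hpos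
    rw [mul_one_div, lt_div_iff₀ hpos', mul_assoc]
    exact hcon x hx
  rw [← mul_sum, ← mul_sum] at hlt
  nlinarith

open ComplexConjugate in
/-- The part of the (unnormalised) inverse transform of `seqCoeff a` coming from coefficients
exceeding `3 * η / 4`. -/
noncomputable def largePart {G : Type*} [AddCommGroup G] [Fintype G] {f : ℕ} (a : Fin f → G)
    (η : ℝ) (x : G) : ℝ :=
  (∑ χ : AddChar G ℂ, (if 3 * η / 4 ≤ ‖seqCoeff a χ‖ then seqCoeff a χ else 0) * conj (χ x)).re

/-- A superlevel set of `largePart a η`. -/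
noncomputable def superlevel {G : Type*} [AddCommGroup G] [Fintype G] {f : ℕ} (a : Fin f → G)
    (η : ℝ) (x : G) : Finset G :=
  univ.filter fun y => largePart a η x ≤ largePart a η y

open ComplexConjugate in
lemma exists_dense_superlevel {G : Type*} [AddCommGroup G] [Fintype G] [DecidableEq G]
    {B : Finset G} (hB : B.Nonempty) {f : ℕ} (a : Fin f → G) {η : ℝ}
    (ha : ∀ χ : AddChar G ℂ, ‖seqCoeff a χ - coeff B χ‖ ≤ η / 4)
    (hV : 0 < ∑ χ : AddChar G ℂ with η ≤ ‖coeff B χ‖, ‖coeff B χ‖ ^ 2) :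
    ∃ x ∈ B, (#B : ℝ) ^ 2 * (∑ χ : AddChar G ℂ with η ≤ ‖coeff B χ‖, ‖coeff B χ‖ ^ 2) *
      #(superlevel a η x) ≤
      9 * Fintype.card G * (1 + Real.log #B) ^ 2 * (#(B ∩ superlevel a η x) : ℝ) ^ 2 := by
  set b : ℝ := (#B : ℝ) with hb
  have hb0 : 0 < b := by rw [hb]; exact_mod_cast hB.card_pos
  set n : ℝ := (Fintype.card G : ℝ) with hn
  set V := ∑ χ : AddChar G ℂ with η ≤ ‖coeff B χ‖, ‖coeff B χ‖ ^ 2 with hVdef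
  set s : AddChar G ℂ → ℂ := fun χ => if 3 * η / 4 ≤ ‖seqCoeff a χ‖ then seqCoeff a χ else 0
    with hs
  set ν := ∑ χ : AddChar G ℂ with 3 * η / 4 ≤ ‖seqCoeff a χ‖, ‖coeff B χ‖ ^ 2 with hν
  have hVν : V ≤ ν := by
    refine sum_le_sum_of_subset_of_nonneg ?_ fun _ _ _ => sq_nonneg _
    intro χ hχ
    simp only [mem_filter, mem_univ, true_and] at hχ ⊢
    have h1 := ha χ
    rw [norm_sub_rev] at h1
    have := norm_sub_norm_le (coeff B χ) (seqCoeff a χ)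
    linarith
  have hν0 : 0 < ν := lt_of_lt_of_le hV hVν
  have hsmall : ∀ χ, 3 * η / 4 ≤ ‖seqCoeff a χ‖ → η / 4 ≤ ‖coeff B χ‖ / 2 := by
    intro χ hχ
    have := norm_sub_norm_le (seqCoeff a χ) (coeff B χ)
    linarith [ha χ]
  have hsum : b * ν / 2 ≤ ∑ x ∈ B, largePart a η x := by
    have h1 : ∑ x ∈ B, largePart a η x = ∑ χ, (s χ * (b * conj (coeff B χ))).re := by
      unfold largePart
      rw [← Complex.re_sum, sum_comm, ← Complex.re_sum]
      congr 1
      refine sum_congr rfl fun χ _ => ?_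
      rw [← mul_sum, ← map_sum, coeff, map_div₀, Complex.conj_natCast, hb]
      push_cast
      have : (#B : ℂ) ≠ 0 := by exact_mod_cast hB.card_pos.ne'
      rw [mul_div_cancel₀ _ this]
    rw [h1, hν, sum_filter, mul_sum, sum_div]
    refine sum_le_sum fun χ _ => ?_
    simp only [hs]
    split_ifs with hχ
    · have h2 : seqCoeff a χ * (b * conj (coeff B χ)) =
          b * (((‖coeff B χ‖ ^ 2 : ℝ) : ℂ) +
            (seqCoeff a χ - coeff B χ) * conj (coeff B χ)) := by
        push_cast
        rw [← Complex.mul_conj']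
        ring_nf
      rw [h2, Complex.re_ofReal_mul, Complex.add_re, Complex.ofReal_re]
      have h3 := (abs_le.1 (Complex.abs_re_le_norm
        ((seqCoeff a χ - coeff B χ) * conj (coeff B χ)))).1
      rw [norm_mul, Complex.norm_conj] at h3
      have h4 : ‖seqCoeff a χ - coeff B χ‖ * ‖coeff B χ‖ ≤ ‖coeff B χ‖ / 2 * ‖coeff B χ‖ := by
        gcongr
        exact (ha χ).trans (hsmall χ hχ)
      rw [mul_div_assoc]
      refine mul_le_mul_of_nonneg_left ?_ hb0.le
      nlinarith
    · simp
  have hL2 : ∑ x, largePart a η x ^ 2 ≤ n * (9 / 4 * ν) := by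
    calc _ ≤ ∑ x, ‖∑ χ, s χ * conj (χ x)‖ ^ 2 := by
          refine sum_le_sum fun x _ => ?_
          rw [← sq_abs]
          gcongr
          exact Complex.abs_re_le_norm _
      _ = n * ∑ χ, ‖s χ‖ ^ 2 := sum_norm_sq_fourier_dual s
      _ ≤ _ := by
          refine mul_le_mul_of_nonneg_left ?_ (by positivity)
          rw [hν, sum_filter, mul_sum]
          refine sum_le_sum fun χ _ => ?_
          simp only [hs]
          split_ifs with hχ
          · have h1 : ‖seqCoeff a χ‖ ≤ 3 / 2 * ‖coeff B χ‖ := by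
              have := norm_sub_norm_le (seqCoeff a χ) (coeff B χ)
              linarith [ha χ, hsmall χ hχ]
            calc ‖seqCoeff a χ‖ ^ 2 ≤ (3 / 2 * ‖coeff B χ‖) ^ 2 := by gcongr
              _ = _ := by ring
          · simp
  have hbν : 0 < b * ν := by positivity
  obtain ⟨x, hxB, hx⟩ := exists_le_mul_rank (largePart a η) hB (by linarith)
  refine ⟨x, hxB, ?_⟩
  have hinter : B.filter (fun y => largePart a η x ≤ largePart a η y) = B ∩ superlevel a η x := by
    ext y; simp [superlevel]
  rw [hinter, ← hb] at hx
  set β : ℝ := (#(B ∩ superlevel a η x) : ℝ) with hβ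
  have hβ0 : 0 ≤ β := by positivity
  have hlog : 0 ≤ Real.log b := Real.log_natCast_nonneg _
  set H := 1 + Real.log b with hH
  have hH0 : 0 < H := by linarith
  set h0 := largePart a η x with hh0
  have h1 : b * ν / 2 ≤ H * (h0 * β) := hsum.trans hx
  have h0pos : 0 ≤ h0 := by
    by_contra! hneg
    have : H * (h0 * β) ≤ 0 :=
      mul_nonpos_of_nonneg_of_nonpos hH0.le (mul_nonpos_of_nonpos_of_nonneg hneg.le hβ0)
    linarith
  have h2 : #(superlevel a η x) * h0 ^ 2 ≤ n * (9 / 4 * ν) := by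
    refine le_trans ?_ hL2
    rw [← nsmul_eq_mul, ← sum_const]
    refine (sum_le_sum fun y hy => ?_).trans
      (sum_le_sum_of_subset_of_nonneg (subset_univ (superlevel a η x)) fun _ _ _ => sq_nonneg _)
    have : h0 ≤ largePart a η y := (mem_filter.1 hy).2
    gcongr
  have h3 : (b * ν / 2) ^ 2 ≤ (H * (h0 * β)) ^ 2 := by gcongr
  have h4 : (b * ν / 2) ^ 2 * #(superlevel a η x) ≤ (H * β) ^ 2 * (n * (9 / 4 * ν)) := by
    calc _ ≤ (H * (h0 * β)) ^ 2 * #(superlevel a η x) := by gcongr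
      _ = (H * β) ^ 2 * (#(superlevel a η x) * h0 ^ 2) := by ring
      _ ≤ _ := by gcongr
  have h5 : (b ^ 2 * ν * #(superlevel a η x)) * (ν / 4) ≤ (9 * n * H ^ 2 * β ^ 2) * (ν / 4) := by
    calc _ = (b * ν / 2) ^ 2 * #(superlevel a η x) := by ring
      _ ≤ _ := h4
      _ = _ := by ring
  refine le_trans ?_ (le_of_mul_le_mul_right h5 (by positivity))
  gcongr

lemma card_div_le_fourth_moment {G : Type*} [AddCommGroup G] [Fintype G] [DecidableEq G]
    {B : Finset G} (hB : B.Nonempty) {q : ℕ} (hq : 1 ≤ q) {L : ℝ} (hL : 0 < L) {f : ℕ}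
    (hf : 24 * q * L ≤ f) (hf' : f ≤ 25 * q * L) (hb : 24 * q * L ≤ #B)
    (h : ∀ a a' : Fin f → B,
      (#(univ.image fun p : Fin f × Fin f => (a p.1 + a' p.2 : G)) : ℝ) ≤ 4 * q * f * L) :
    Fintype.card G / (200 * q ^ 2 * L ^ 2) ≤ ∑ χ : AddChar G ℂ, ‖coeff B χ‖ ^ 4 := by
  have hq0 : (0 : ℝ) < q := by positivity
  have h1 := fourth_moment_of_card_image_le hB f (by positivity) h
  set M := ∑ χ : AddChar G ℂ, ‖coeff B χ‖ ^ 4 with hM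
  have hM0 : 0 ≤ M := sum_nonneg fun _ _ => by positivity
  set n : ℝ := (Fintype.card G : ℝ) with hn
  have hn0 : 0 < n := by rw [hn]; exact_mod_cast Fintype.card_pos
  have hb0 : (0 : ℝ) < #B := by exact_mod_cast hB.card_pos
  have hqL : 0 < q * L := by positivity
  have hf0 : (0 : ℝ) < f := by nlinarith
  have h2 : (f : ℝ) * #B * n ≤ 4 * q * L * (#B * n + 2 * f * n + f ^ 2 * #B * M) := by
    have : ((f : ℝ) * #B * n) * f ^ 3 ≤
        (4 * q * L * (#B * n + 2 * f * n + f ^ 2 * #B * M)) * f ^ 3 := by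
      calc _ = (f : ℝ) ^ 4 * #B * n := by ring
        _ ≤ _ := h1
        _ = _ := by ring
    exact le_of_mul_le_mul_right this (by positivity)
  have h3 : 4 * q * L * (#B * n) ≤ (f : ℝ) * #B * n / 6 := by
    have : (24 * q * L) * (#B * n) ≤ f * (#B * n) := by gcongr
    linarith
  have h4 : 4 * q * L * (2 * f * n) ≤ (f : ℝ) * #B * n / 3 := by
    have : (24 * q * L) * (f * n) ≤ #B * (f * n) := by gcongr
    linarith
  have h5 : (f : ℝ) * #B * n ≤ f * #B * (8 * q * L * f * M) := by nlinarith
  have h6 : n ≤ 8 * q * L * f * M := le_of_mul_le_mul_left h5 (by positivity)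
  have h7 : 8 * q * L * f * M ≤ 8 * q * L * (25 * q * L) * M := by gcongr
  rw [div_le_iff₀ (by positivity)]
  linarith

lemma not_independent_of_sparse {G : Type*} [AddCommGroup G] [Fintype G] [DecidableEq G]
    {q : ℕ} [NeZero q] (hq : 1 ≤ q) {φ : G → Fin q} {B : Finset G} {L : ℝ}
    (hLn : L = Real.log (Fintype.card G)) (hL : 2 ≤ L) {f₁ J : ℕ} {f m : ℕ → ℕ}
    (hf₁ : 24 * q * L ≤ f₁) (hf₁' : f₁ ≤ 25 * q * L)
    (hb : 24 * q * L ≤ #B) (hb2 : 6 * 10 ^ 9 * q ^ 3 * L ^ 7 ≤ (#B : ℝ) ^ 2)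
    (hJ1 : 1 ≤ J) (hJL : J ≤ L) (hJn : (Fintype.card G : ℝ) ≤ 4 ^ J)
    (hf : ∀ j, 512 * L * 4 ^ j ≤ f j) (hm : ∀ j, (2 : ℝ) ^ (m j + 1) ≤ 1600 * L ^ 2 * 4 ^ j)
    (hsums : ∀ a a' : Fin f₁ → G,
      Disjoint (zeroClass φ) (univ.image fun p : Fin f₁ × Fin f₁ => a p.1 + a' p.2) →
      (#(univ.image fun p : Fin f₁ × Fin f₁ => a p.1 + a' p.2) : ℝ) ≤ 4 * q * f₁ * L)
    (hslice : ∀ j ∈ Icc 1 J, ∀ (a : Fin (f j) → G) (x : G),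
      ¬ ∃ B' ⊆ superlevel a ((1 / 2) ^ j) x, B'.Nonempty ∧
      (∀ s ∈ B', ∀ t ∈ B', s + t ∉ zeroClass φ) ∧
      (64 * q * 2 ^ (m j + 1) * #(superlevel a ((1 / 2) ^ j) x) : ℝ) ≤ (#B' : ℝ) ^ 2) :
    ∃ s ∈ B, ∃ t ∈ B, s + t ∈ zeroClass φ := by
  by_contra! hind
  have hq1 : (1 : ℝ) ≤ q := by exact_mod_cast hq
  have hqL : 0 < q * L := by nlinarith
  have hb0 : (0 : ℝ) < #B := by linarith
  have hB : B.Nonempty := card_pos.1 (by exact_mod_cast hb0)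
  set n : ℝ := (Fintype.card G : ℝ) with hn
  have hn0 : 0 < n := by rw [hn]; exact_mod_cast Fintype.card_pos
  have hexpL : Real.exp L = n := by rw [hLn, Real.exp_log hn0]
  have hn4 : 4 < n := by
    rw [← hexpL]
    have h1 : Real.exp 2 ≤ Real.exp L := Real.exp_le_exp.2 hL
    have h2 : Real.exp 2 = Real.exp 1 * Real.exp 1 := by rw [← Real.exp_add]; norm_num
    have := Real.exp_one_gt_d9
    nlinarith
  have hbn : (#B : ℝ) ≤ n := by rw [hn]; exact_mod_cast card_le_univ B
  have hM := card_div_le_fourth_moment hB hq (by linarith) hf₁ hf₁' hb ?_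
  swap
  · intro a a'
    refine hsums (fun i => a i) (fun i => a' i) ?_
    rw [disjoint_right]
    intro x hx
    obtain ⟨p, -, rfl⟩ := mem_image.1 hx
    exact hind _ (a p.1).2 _ (a' p.2).2
  rw [← hn] at hM
  have ht2 := sum_norm_coeff_sq hB
  rw [← hn] at ht2
  obtain ⟨j, hj, hV⟩ := exists_dyadic_level (fun χ : AddChar G ℂ => ‖coeff B χ‖)
    (fun _ => norm_nonneg _) (fun χ => norm_coeff_le_one B χ) hJ1
    (c := n / (1600 * q ^ 2 * L ^ 3)) (by
      refine le_trans ?_ hM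
      have h1 : (1 / 4 : ℝ) ^ J * ∑ χ : AddChar G ℂ, ‖coeff B χ‖ ^ 2 ≤
          n / (400 * q ^ 2 * L ^ 2) := by
        have h2 : ∑ χ : AddChar G ℂ, ‖coeff B χ‖ ^ 2 = n / #B := by
          rw [eq_div_iff hb0.ne', ← ht2]; ring
        rw [h2, one_div, inv_pow, inv_mul_eq_div, div_div, div_le_div_iff₀ (by positivity)
          (by positivity)]
        have h3 : 400 * (q : ℝ) ^ 2 * L ^ 2 ≤ (#B : ℝ) ^ 2 := by
          refine le_trans ?_ hb2
          have e1 : (q : ℝ) ^ 2 ≤ q ^ 3 := pow_le_pow_right₀ hq1 (by norm_num)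
          have e2 : L ^ 2 ≤ L ^ 7 := pow_le_pow_right₀ (by linarith) (by norm_num)
          calc 400 * (q : ℝ) ^ 2 * L ^ 2 ≤ 6 * 10 ^ 9 * q ^ 2 * L ^ 2 := by
                gcongr
                norm_num
            _ ≤ _ := by gcongr
        have h4 : (#B : ℝ) ^ 2 ≤ #B * 4 ^ J := by
          rw [sq]
          exact mul_le_mul_of_nonneg_left (hbn.trans hJn) hb0.le
        have h5 : 400 * (q : ℝ) ^ 2 * L ^ 2 ≤ #B * 4 ^ J := h3.trans h4
        nlinarith
      have h2 : 4 * J * (n / (1600 * q ^ 2 * L ^ 3)) ≤ n / (400 * q ^ 2 * L ^ 2) := by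
        calc _ ≤ 4 * L * (n / (1600 * q ^ 2 * L ^ 3)) := by gcongr
          _ = _ := by field_simp; ring
      calc _ ≤ n / (400 * q ^ 2 * L ^ 2) + n / (400 * q ^ 2 * L ^ 2) := add_le_add h1 h2
        _ = _ := by field_simp; ring)
  set V := ∑ χ : AddChar G ℂ with (1 / 2) ^ j ≤ ‖coeff B χ‖, ‖coeff B χ‖ ^ 2 with hVdef
  have h4j : (1 / 4 : ℝ) ^ j * 4 ^ j = 1 := by rw [← mul_pow]; norm_num
  have hV0 : 0 < V := by
    have h1 : 0 < n / (1600 * q ^ 2 * L ^ 3) := by positivity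
    have h2 : 0 < (1 / 4 : ℝ) ^ j * V := by linarith
    exact pos_of_mul_pos_right h2 (by positivity)
  have hVle : 4 ^ j * n / (1600 * q ^ 2 * L ^ 3) ≤ V := by
    calc _ = 4 ^ j * (n / (1600 * q ^ 2 * L ^ 3)) := by ring
      _ ≤ 4 ^ j * ((1 / 4 : ℝ) ^ j * V) := by gcongr
      _ = _ := by rw [← mul_assoc, mul_comm (4 ^ j : ℝ), h4j, one_mul]
  have hfj := hf j
  have hfj0 : f j ≠ 0 := by
    rintro h0
    rw [h0] at hfj
    have : (0 : ℝ) < 512 * L * 4 ^ j := by positivity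
    simp at hfj
    linarith
  have hη1 : (1 / 2 : ℝ) ^ j ≤ 1 := pow_le_one₀ (by norm_num) (by norm_num)
  have hη0 : (0 : ℝ) < (1 / 2 : ℝ) ^ j := by positivity
  obtain ⟨a, ha⟩ := exists_seqCoeff_close hB hfj0 (ε := (1 / 2) ^ j / 8) (by linarith)
    (by linarith) (by
      have h1 : 2 * L ≤ f j * ((1 / 2 : ℝ) ^ j / 8) ^ 2 / 4 := by
        have h2 : ((1 / 2 : ℝ) ^ j / 8) ^ 2 = (1 / 4) ^ j / 64 := by
          rw [div_pow, ← pow_mul, mul_comm, pow_mul]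
          norm_num
        rw [h2]
        calc 2 * L = 512 * L * ((1 / 4 : ℝ) ^ j * 4 ^ j) / 256 := by rw [h4j]; ring
          _ = (512 * L * 4 ^ j) * (1 / 4 : ℝ) ^ j / 256 := by ring
          _ ≤ f j * (1 / 4 : ℝ) ^ j / 256 := by gcongr
          _ = _ := by ring
      calc 4 * n * Real.exp (-(f j * ((1 / 2 : ℝ) ^ j / 8) ^ 2 / 4))
          ≤ 4 * n * Real.exp (-(2 * L)) := by gcongr
        _ = 4 / n := by
            rw [Real.exp_neg, two_mul, Real.exp_add, hexpL]
            field_simp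
        _ < 1 := by rw [div_lt_one hn0]; exact hn4)
  obtain ⟨x, hxB, hx⟩ := exists_dense_superlevel hB (fun i => (a i : G)) (η := (1 / 2) ^ j)
    (fun χ => (ha χ).trans (by linarith)) hV0
  set X := superlevel (fun i => (a i : G)) ((1 / 2) ^ j) x with hX
  refine hslice j hj (fun i => (a i : G)) x ⟨B ∩ X, inter_subset_right, ⟨x, ?_⟩, ?_, ?_⟩
  · simp [hX, superlevel, hxB]
  · intro s hs t ht
    exact hind s (mem_of_mem_inter_left hs) t (mem_of_mem_inter_left ht)
  · rw [← hX]
    rw [← hVdef, ← hn] at hx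
    have hlogb : Real.log #B ≤ L := by
      rw [hLn]
      exact Real.log_le_log hb0 hbn
    have hlogb0 : 0 ≤ Real.log #B := Real.log_natCast_nonneg _
    have h1 : 9 * n * (1 + Real.log #B) ^ 2 * (#(B ∩ X) : ℝ) ^ 2 ≤
        9 * n * (2 * L) ^ 2 * (#(B ∩ X) : ℝ) ^ 2 := by
      gcongr
      linarith
    have h2 : 36 * n * L ^ 2 * (64 * q * (1600 * L ^ 2 * 4 ^ j)) ≤ (#B : ℝ) ^ 2 * V := by
      calc 36 * n * L ^ 2 * (64 * q * (1600 * L ^ 2 * 4 ^ j))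
          = (36 * 64 * 1600 * 1600 * q ^ 3 * L ^ 7) * (4 ^ j * n / (1600 * q ^ 2 * L ^ 3)) := by
            field_simp
        _ ≤ (6 * 10 ^ 9 * q ^ 3 * L ^ 7) * (4 ^ j * n / (1600 * q ^ 2 * L ^ 3)) := by
            refine mul_le_mul_of_nonneg_right ?_ (by positivity)
            have : 0 ≤ (q : ℝ) ^ 3 * L ^ 7 := by positivity
            linarith
        _ ≤ _ := by gcongr
    have h3 : 64 * q * 2 ^ (m j + 1) * (#X : ℝ) * (36 * n * L ^ 2) ≤
        (#(B ∩ X) : ℝ) ^ 2 * (36 * n * L ^ 2) := by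
      calc 64 * q * 2 ^ (m j + 1) * (#X : ℝ) * (36 * n * L ^ 2)
          ≤ 64 * q * (1600 * L ^ 2 * 4 ^ j) * (#X : ℝ) * (36 * n * L ^ 2) := by
            gcongr
            exact hm j
        _ = 36 * n * L ^ 2 * (64 * q * (1600 * L ^ 2 * 4 ^ j)) * #X := by ring
        _ ≤ (#B : ℝ) ^ 2 * V * #X := by gcongr
        _ ≤ _ := hx
        _ ≤ _ := h1
        _ = _ := by ring
    exact le_of_mul_le_mul_right h3 (by positivity)

lemma card_le_of_cover {ι α : Type*} [Fintype ι] {E : Finset α} (F : ι → Finset α) {c : ℝ}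
    (hF : ∀ i, (#(F i) : ℝ) ≤ c) (hE : ∀ x ∈ E, ∃ i, x ∈ F i) :
    (#E : ℝ) ≤ Fintype.card ι * c := by
  classical
  calc (#E : ℝ) ≤ #(univ.biUnion F) := by
        exact_mod_cast card_le_card fun x hx => mem_biUnion.2 ⟨_, mem_univ _, (hE x hx).choose_spec⟩
    _ ≤ ∑ i, (#(F i) : ℝ) := by exact_mod_cast card_biUnion_le
    _ ≤ ∑ _i : ι, c := sum_le_sum fun i _ => hF i
    _ = _ := by simp

lemma card_zeroClass_eq_compl_sumset_le {G : Type*} [AddCommGroup G] [Fintype G] [DecidableEq G]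
    {q : ℕ} [NeZero q] (hq : 2 ≤ q) (b : ℕ) {E : Finset (G → Fin q)}
    (hE : ∀ φ ∈ E, ∃ a : Fin b → G, zeroClass φ = (univ.image a + univ.image a)ᶜ) :
    (#E : ℝ) ≤ (Fintype.card G : ℝ) ^ b *
      ((q : ℝ) ^ Fintype.card G * Real.exp (-(Fintype.card G / q))) := by
  have := card_le_of_cover (E := E)
    (fun a : Fin b → G => univ.filter fun φ => zeroClass φ = (univ.image a + univ.image a)ᶜ)
    (fun a => card_zeroClass_eq_le hq _) (by simpa using hE)
  simpa using this

lemma card_sparse_sums_le {G : Type*} [AddCommGroup G] [Fintype G] [DecidableEq G]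
    {q : ℕ} [NeZero q] (hq : 2 ≤ q) (f : ℕ) (W : ℝ) {E : Finset (G → Fin q)}
    (hE : ∀ φ ∈ E, ∃ a a' : Fin f → G,
      Disjoint (zeroClass φ) (univ.image fun p : Fin f × Fin f => a p.1 + a' p.2) ∧
      W < #(univ.image fun p : Fin f × Fin f => a p.1 + a' p.2)) :
    (#E : ℝ) ≤ (Fintype.card G : ℝ) ^ (2 * f) *
      ((q : ℝ) ^ Fintype.card G * Real.exp (-(W / q))) := by
  have := card_le_of_cover (E := E)
    (fun a : (Fin f → G) × (Fin f → G) => univ.filter fun φ =>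
      Disjoint (zeroClass φ) (univ.image fun p : Fin f × Fin f => a.1 p.1 + a.2 p.2) ∧
      W < #(univ.image fun p : Fin f × Fin f => a.1 p.1 + a.2 p.2))
    (c := (q : ℝ) ^ Fintype.card G * Real.exp (-(W / q))) ?_ ?_
  · rw [two_mul, pow_add]
    simpa using this
  · intro a
    by_cases hW : W < #(univ.image fun p : Fin f × Fin f => a.1 p.1 + a.2 p.2)
    · simp only [hW, and_true]
      refine (card_avoid_le hq _).trans ?_
      gcongr
    · simp only [hW, and_false, filter_false, card_empty, Nat.cast_zero]
      positivity
  · intro φ hφ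
    obtain ⟨a, a', h⟩ := hE φ hφ
    exact ⟨(a, a'), by simpa using h⟩

lemma card_dense_superlevel_le {G : Type*} [AddCommGroup G] [Fintype G] [DecidableEq G]
    {q : ℕ} [NeZero q] (hq : 1 ≤ q) (f m : ℕ) (η : ℝ) {E : Finset (G → Fin q)}
    (hE : ∀ φ ∈ E, ∃ (a : Fin f → G) (x : G), ∃ B ⊆ superlevel a η x, B.Nonempty ∧
      (∀ s ∈ B, ∀ t ∈ B, s + t ∉ zeroClass φ) ∧
      (64 * q * 2 ^ (m + 1) * #(superlevel a η x) : ℝ) ≤ (#B : ℝ) ^ 2) :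
    (#E : ℝ) ≤ (Fintype.card G : ℝ) ^ (f + 1) *
      (Fintype.card G * (q : ℝ) ^ Fintype.card G * (1 / 4) ^ 2 ^ (m + 1)) := by
  classical
  have := card_le_of_cover (E := E)
    (fun p : (Fin f → G) × G => univ.filter fun φ => ∃ B ⊆ superlevel p.1 η p.2, B.Nonempty ∧
      (∀ s ∈ B, ∀ t ∈ B, s + t ∉ zeroClass φ) ∧
      (64 * q * 2 ^ (m + 1) * #(superlevel p.1 η p.2) : ℝ) ≤ (#B : ℝ) ^ 2)
    (c := Fintype.card G * (q : ℝ) ^ Fintype.card G * (1 / 4) ^ 2 ^ (m + 1)) ?_ ?_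
  · rw [pow_succ]
    simpa using this
  · intro p
    convert card_dense_independent_le hq (superlevel p.1 η p.2) m
  · intro φ hφ
    obtain ⟨a, x, h⟩ := hE φ hφ
    exact ⟨(a, x), by simpa using h⟩

lemma exists_good_colouring {G : Type*} [AddCommGroup G] [Fintype G] [DecidableEq G]
    {q : ℕ} [NeZero q] (hq : 2 ≤ q) {L : ℝ} (hLn : L = Real.log (Fintype.card G)) (hL : 3 ≤ L)
    {b f₁ J : ℕ} {f m : ℕ → ℕ} (hb : b * L ≤ Fintype.card G / (2 * q))
    (hnq : 6 ≤ (Fintype.card G : ℝ) / q) (hf₁ : 1 ≤ f₁) (hJL : J ≤ L)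
    (hm : ∀ j, (f j + 4) * L ≤ (2 : ℝ) ^ (m j + 1)) :
    ∃ φ : G → Fin q, (#(zeroClass φ) : ℝ) * q < 4 * Fintype.card G ∧
      (∀ a : Fin b → G, zeroClass φ ≠ (univ.image a + univ.image a)ᶜ) ∧
      (∀ a a' : Fin f₁ → G,
        Disjoint (zeroClass φ) (univ.image fun p : Fin f₁ × Fin f₁ => a p.1 + a' p.2) →
        (#(univ.image fun p : Fin f₁ × Fin f₁ => a p.1 + a' p.2) : ℝ) ≤ 4 * q * f₁ * L) ∧
      ∀ j ∈ Icc 1 J, ∀ (a : Fin (f j) → G) (x : G),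
        ¬ ∃ B' ⊆ superlevel a ((1 / 2) ^ j) x, B'.Nonempty ∧
        (∀ s ∈ B', ∀ t ∈ B', s + t ∉ zeroClass φ) ∧
        (64 * q * 2 ^ (m j + 1) * #(superlevel a ((1 / 2) ^ j) x) : ℝ) ≤ (#B' : ℝ) ^ 2 := by
  classical
  by_contra! hcon
  have hq0 : (0 : ℝ) < q := by positivity
  set n : ℝ := (Fintype.card G : ℝ) with hn
  have hcard : 0 < Fintype.card G := Fintype.card_pos
  have hn0 : 0 < n := by rw [hn]; exact_mod_cast hcard
  have hexpL : Real.exp L = n := by rw [hLn, Real.exp_log hn0]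
  have hnpow : ∀ k : ℕ, n ^ k = Real.exp (k * L) := by
    intro k; rw [← hexpL, ← Real.exp_nat_mul]
  have he3 : Real.exp (-3) ≤ 1 / 8 := by
    rw [Real.exp_neg, inv_eq_one_div]
    refine one_div_le_one_div_of_le (by norm_num) ?_
    have h2 : Real.exp 3 = Real.exp 1 ^ 3 := by rw [← Real.exp_nat_mul]; norm_num
    rw [h2]
    calc (8 : ℝ) = 2 ^ 3 := by norm_num
      _ ≤ _ := by
        gcongr
        linarith [Real.exp_one_gt_d9]
  set Q : ℝ := (q : ℝ) ^ Fintype.card G with hQ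
  have hQ0 : 0 < Q := by positivity
  set E₀ := univ.filter fun φ : G → Fin q => 4 * (Fintype.card G : ℝ) ≤ #(zeroClass φ) * q with hE₀
  set E₁ := univ.filter fun φ : G → Fin q =>
    ∃ a : Fin b → G, zeroClass φ = (univ.image a + univ.image a)ᶜ with hE₁
  set E₂ := univ.filter fun φ : G → Fin q => ∃ a a' : Fin f₁ → G,
      Disjoint (zeroClass φ) (univ.image fun p : Fin f₁ × Fin f₁ => a p.1 + a' p.2) ∧
      4 * q * f₁ * L < #(univ.image fun p : Fin f₁ × Fin f₁ => a p.1 + a' p.2) with hE₂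
  set E₃ : ℕ → Finset (G → Fin q) := fun j => univ.filter fun φ : G → Fin q =>
    ∃ (a : Fin (f j) → G) (x : G), ∃ B ⊆ superlevel a ((1 / 2) ^ j) x, B.Nonempty ∧
      (∀ s ∈ B, ∀ t ∈ B, s + t ∉ zeroClass φ) ∧
      (64 * q * 2 ^ (m j + 1) * #(superlevel a ((1 / 2) ^ j) x) : ℝ) ≤ (#B : ℝ) ^ 2 with hE₃
  set E₄ := (Icc 1 J).biUnion E₃ with hE₄
  have h0 : (#E₀ : ℝ) ≤ Q / 4 := card_zeroClass_large_le 4 (by norm_num) hcard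
  have h1 : (#E₁ : ℝ) ≤ Q * (1 / 8) := by
    refine (card_zeroClass_eq_compl_sumset_le hq b fun φ hφ => (mem_filter.1 hφ).2).trans ?_
    rw [← hn, hnpow, ← hQ]
    calc Real.exp (b * L) * (Q * Real.exp (-(n / q)))
        = Q * Real.exp (b * L - n / q) := by rw [sub_eq_add_neg, Real.exp_add]; ring
      _ ≤ Q * Real.exp (-3) := by
          have : n / (2 * q) = n / q / 2 := by field_simp
          gcongr
          linarith
      _ ≤ _ := by gcongr
  have h2 : (#E₂ : ℝ) ≤ Q * (1 / 8) := by
    refine (card_sparse_sums_le hq f₁ (4 * q * f₁ * L) fun φ hφ => (mem_filter.1 hφ).2).trans ?_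
    rw [← hn, hnpow, ← hQ]
    have hf₁' : (1 : ℝ) ≤ f₁ := by exact_mod_cast hf₁
    calc Real.exp ((2 * f₁ : ℕ) * L) * (Q * Real.exp (-(4 * q * f₁ * L / q)))
        = Q * Real.exp (-(2 * f₁ * L)) := by
          rw [mul_left_comm, ← Real.exp_add]
          congr 2
          push_cast
          field_simp
          ring
      _ ≤ Q * Real.exp (-3) := by
          gcongr
          nlinarith
      _ ≤ _ := by gcongr
  have h3 : ∀ j ∈ Icc 1 J, (#(E₃ j) : ℝ) ≤ Q * Real.exp (-(2 * L)) := by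
    intro j _
    refine (card_dense_superlevel_le (by omega) (f j) (m j) ((1 / 2) ^ j)
      fun φ hφ => (mem_filter.1 hφ).2).trans ?_
    rw [← hn, ← hQ]
    have h4 : (1 / 4 : ℝ) ^ 2 ^ (m j + 1) ≤ Real.exp (-((f j + 4) * L)) := by
      calc (1 / 4 : ℝ) ^ 2 ^ (m j + 1) ≤ Real.exp (-1) ^ 2 ^ (m j + 1) := by
            gcongr
            rw [Real.exp_neg, inv_eq_one_div]
            refine one_div_le_one_div_of_le (Real.exp_pos _) ?_
            linarith [Real.exp_one_lt_d9]
        _ = Real.exp (-(2 : ℝ) ^ (m j + 1)) := by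
            rw [← Real.exp_nat_mul]
            push_cast
            ring_nf
        _ ≤ _ := by
            gcongr
            exact hm j
    calc n ^ (f j + 1) * (n * Q * (1 / 4) ^ 2 ^ (m j + 1))
        ≤ n ^ (f j + 1) * (n * Q * Real.exp (-((f j + 4) * L))) := by gcongr
      _ = Q * (n ^ (f j + 2) * Real.exp (-((f j + 4) * L))) := by ring
      _ = _ := by
          rw [hnpow, ← Real.exp_add]
          congr 2
          push_cast
          ring
  have h4 : (#E₄ : ℝ) ≤ Q * (1 / 8) := by
    calc (#E₄ : ℝ) ≤ ∑ j ∈ Icc 1 J, (#(E₃ j) : ℝ) := by exact_mod_cast card_biUnion_le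
      _ ≤ ∑ j ∈ Icc 1 J, Q * Real.exp (-(2 * L)) := sum_le_sum h3
      _ = J * (Q * Real.exp (-(2 * L))) := by simp
      _ ≤ Real.exp L * (Q * Real.exp (-(2 * L))) := by
          gcongr
          linarith [Real.add_one_le_exp L]
      _ = Q * Real.exp (-L) := by
          rw [mul_left_comm, ← Real.exp_add]
          ring_nf
      _ ≤ Q * Real.exp (-3) := by gcongr
      _ ≤ _ := by gcongr
  have hcover : (univ : Finset (G → Fin q)) ⊆ E₀ ∪ (E₁ ∪ (E₂ ∪ E₄)) := by
    intro φ _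
    by_contra hφ
    simp only [mem_union, not_or] at hφ
    obtain ⟨k0, k1, k2, k4⟩ := hφ
    simp only [hE₀, hE₁, hE₂, hE₄, hE₃, mem_filter, mem_univ, true_and, mem_biUnion] at k0 k1 k2 k4
    push Not at k0 k1 k2 k4
    obtain ⟨j, hj, a, x, B, hB⟩ := hcon φ k0 k1 k2
    obtain ⟨hB1, hB2, hB3, hB4⟩ := hB
    exact absurd hB4 (not_le.2 (k4 j hj a x B hB1 hB2 hB3))
  have htot : (Q : ℝ) ≤ #E₀ + (#E₁ + (#E₂ + #E₄)) := by
    have k1 := card_le_card hcover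
    have k2 := card_union_le E₀ (E₁ ∪ (E₂ ∪ E₄))
    have k3 := card_union_le E₁ (E₂ ∪ E₄)
    have k4 := card_union_le E₂ E₄
    have k5 : q ^ Fintype.card G ≤ #E₀ + (#E₁ + (#E₂ + #E₄)) := by
      rw [card_univ, Fintype.card_fun, Fintype.card_fin] at k1
      omega
    rw [hQ]
    exact_mod_cast k5
  linarith

lemma exists_image_eq_of_card_le {α : Type*} [DecidableEq α] {B : Finset α} (hB : B.Nonempty)
    {b : ℕ} (hb : #B ≤ b) : ∃ a : Fin b → α, univ.image a = B := by
  obtain ⟨x, hx⟩ := hB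
  refine ⟨fun i => if h : (i : ℕ) < #B then B.equivFin.symm ⟨i, h⟩ else x, ?_⟩
  ext y
  simp only [mem_image, mem_univ, true_and]
  constructor
  · rintro ⟨i, rfl⟩
    split_ifs with h
    · exact (B.equivFin.symm ⟨i, h⟩).2
    · exact hx
  · intro hy
    refine ⟨⟨B.equivFin ⟨y, hy⟩, (B.equivFin ⟨y, hy⟩).2.trans_le hb⟩, ?_⟩
    simp

lemma exp_succ_le_four_pow {J : ℕ} (hJ : 3 ≤ J) : Real.exp (J + 1) ≤ 4 ^ J := by
  have he := Real.exp_one_lt_d9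
  induction J, hJ using Nat.le_induction with
  | base =>
    have h4 : Real.exp ((3 : ℕ) + 1) = Real.exp 1 ^ 4 := by rw [← Real.exp_nat_mul]; norm_num
    rw [h4]
    calc Real.exp 1 ^ 4 ≤ 2.7182818286 ^ 4 := by gcongr
      _ ≤ 4 ^ 3 := by norm_num
  | succ k _ ih =>
    push_cast
    rw [Real.exp_add, pow_succ]
    gcongr
    linarith

lemma exists_large_not_sumset {G : Type*} [AddCommGroup G] [Fintype G] [DecidableEq G]
    {L : ℝ} (hLn : L = Real.log (Fintype.card G)) (hL : 3 ≤ L) {q b : ℕ} (hq : 4 ≤ q)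
    (hbn : b * L ≤ Fintype.card G / (2 * q)) (hb : 25 * q * L ≤ b)
    (hb2 : 6 * 10 ^ 9 * (q : ℝ) ^ 3 * L ^ 7 ≤ (b : ℝ) ^ 2) :
    ∃ T : Finset G, (Fintype.card G : ℝ) - 4 * Fintype.card G / q ≤ #T ∧
      ∀ B : Finset G, B + B ≠ T := by
  have : NeZero q := ⟨by omega⟩
  have hqr : (4 : ℝ) ≤ q := by exact_mod_cast hq
  have hcard : 0 < Fintype.card G := Fintype.card_pos
  have hn0 : (0 : ℝ) < Fintype.card G := by exact_mod_cast hcard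
  have hqL : 1 ≤ q * L := by nlinarith
  choose m hm₁ hm₂ using fun j : ℕ =>
    exists_nat_pow_near (x := ((⌈512 * L * 4 ^ j⌉₊ : ℕ) + 4 : ℝ) * L) (y := 2)
      (by nlinarith [(Nat.cast_nonneg ⌈512 * L * 4 ^ j⌉₊ : (0 : ℝ) ≤ _)]) (by norm_num)
  have hf₁ : 24 * q * L ≤ (⌈24 * q * L⌉₊ : ℝ) := Nat.le_ceil _
  have hf₁' : (⌈24 * q * L⌉₊ : ℝ) ≤ 25 * q * L := by
    have := (Nat.ceil_lt_add_one (by positivity : 0 ≤ 24 * q * L)).le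
    linarith
  have hJ : 3 ≤ ⌊L⌋₊ := Nat.le_floor (by exact_mod_cast hL)
  have hJL : (⌊L⌋₊ : ℝ) ≤ L := Nat.floor_le (by linarith)
  have hJn : (Fintype.card G : ℝ) ≤ 4 ^ ⌊L⌋₊ := by
    refine le_trans ?_ (exp_succ_le_four_pow hJ)
    rw [← Real.exp_log hn0, ← hLn, Real.exp_le_exp]
    exact (Nat.lt_floor_add_one L).le
  have hm : ∀ j, (2 : ℝ) ^ (m j + 1) ≤ 1600 * L ^ 2 * 4 ^ j := by
    intro j
    have h1 := (Nat.ceil_lt_add_one (by positivity : 0 ≤ 512 * L * 4 ^ j)).le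
    have h4 : (1 : ℝ) ≤ 4 ^ j := one_le_pow₀ (by norm_num)
    have h5 : 5 * L ≤ 5 * L * (L * 4 ^ j) := by
      have : 1 ≤ L * 4 ^ j := by nlinarith
      nlinarith
    calc (2 : ℝ) ^ (m j + 1) = 2 * 2 ^ m j := by ring
      _ ≤ 2 * ((⌈512 * L * 4 ^ j⌉₊ + 4) * L) := by gcongr; exact hm₁ j
      _ ≤ 2 * ((512 * L * 4 ^ j + 1 + 4) * L) := by gcongr
      _ ≤ 1600 * L ^ 2 * 4 ^ j := by nlinarith
  have hnq : 6 ≤ (Fintype.card G : ℝ) / q := by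
    have h2 : (Fintype.card G : ℝ) / q = 2 * (Fintype.card G / (2 * q)) := by field_simp
    rw [h2]
    nlinarith
  have key := exists_good_colouring (G := G) (q := q) (b := b) (f₁ := ⌈24 * q * L⌉₊) (J := ⌊L⌋₊)
    (f := fun j => ⌈512 * L * 4 ^ j⌉₊) (m := m) (by omega) hLn hL hbn hnq
    (Nat.one_le_ceil_iff.2 (by positivity)) hJL fun j => (hm₂ j).le
  obtain ⟨φ, hS, hsmall, hsums, hslice⟩ := key
  refine ⟨(zeroClass φ)ᶜ, ?_, ?_⟩
  · rw [card_compl, Nat.cast_sub (card_le_univ _)]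
    have : (#(zeroClass φ) : ℝ) ≤ 4 * Fintype.card G / q := by
      rw [le_div_iff₀ (by positivity)]; exact hS.le
    linarith
  intro B hB
  rcases le_total (#B) b with h | h
  · have hne : B.Nonempty := by
      rw [nonempty_iff_ne_empty]
      rintro rfl
      have hz : zeroClass φ = univ := by simpa using hB.symm
      rw [hz, card_univ] at hS
      nlinarith
    obtain ⟨a, ha⟩ := exists_image_eq_of_card_le hne h
    exact hsmall a (by rw [ha, hB, compl_compl])
  · have hbB : (b : ℝ) ≤ #B := by exact_mod_cast h
    have key := not_independent_of_sparse (G := G) (q := q) (φ := φ) (B := B) (by omega) hLn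
      (by linarith) hf₁ hf₁' (by nlinarith) (hb2.trans (by gcongr)) (by omega) hJL hJn
      (fun j => Nat.le_ceil _) hm hsums hslice
    obtain ⟨s, hs, t, ht, hst⟩ := key
    have := add_mem_add hs ht
    rw [hB, mem_compl] at this
    exact this hst

lemma exists_not_sumset {G : Type*} [AddCommGroup G] [Fintype G] [DecidableEq G]
    (hG : 2 ≤ Fintype.card G) : ∃ T : Finset G, ∀ B : Finset G, B + B ≠ T := by
  have hninj : ¬ Function.Injective fun B : Finset G => B + B := by
    intro hinj
    rcases hG.eq_or_lt with h2 | h3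
    · have : Nontrivial G := Fintype.one_lt_card_iff_nontrivial.1 hG
      obtain ⟨g, hg⟩ := exists_ne (0 : G)
      have hgg : g + g = 0 := by
        have := card_nsmul_eq_zero (x := g)
        rwa [← h2, two_nsmul] at this
      have := @hinj {0} {g} (by simp [hgg])
      exact hg (singleton_injective this).symm
    · have h : ({0}ᶜ : Finset G) + {0}ᶜ = univ + univ := by
        ext x
        simp only [univ_add_univ, mem_univ, iff_true, mem_add, mem_compl, mem_singleton]
        obtain ⟨y, hy⟩ : ∃ y, y ∉ ({0, x} : Finset G) := by
          by_contra! hcon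
          have h1 : #(univ : Finset G) ≤ #({0, x} : Finset G) := card_le_card fun y _ => hcon y
          rw [card_univ] at h1
          have := card_le_two (a := (0 : G)) (b := x)
          omega
        simp only [mem_insert, mem_singleton, not_or] at hy
        exact ⟨y, hy.1, x - y, sub_ne_zero.2 (Ne.symm hy.2), by abel⟩
      have := @hinj {0}ᶜ univ h
      simp at this
  have hnsurj := mt Finite.injective_iff_surjective.2 hninj
  simpa [Function.Surjective] using hnsurj

lemma exists_large_not_sumset_of_roots {G : Type*} [AddCommGroup G] [Fintype G] [DecidableEq G]
    {A M : ℝ} (hA : A ^ 5 = Fintype.card G) (hM : M ^ 10 = Real.log (Fintype.card G))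
    (hA1 : 100 ≤ A) (hM1 : 1 ≤ M) (hM2 : 10 ^ 11 ≤ M ^ 5) (hMA : 4 * M ^ 19 ≤ A ^ 2) :
    ∃ T : Finset G, (Fintype.card G : ℝ) - 8 * A ^ 3 * M ^ 19 ≤ #T ∧
      ∀ B : Finset G, B + B ≠ T := by
  have hA0 : 0 < A := by linarith
  have hM0 : 0 < M := by linarith
  set q : ℕ := ⌊A ^ 2 / M ^ 19⌋₊ with hqdef
  have hu : 4 ≤ A ^ 2 / M ^ 19 := by rwa [le_div_iff₀ (by positivity)]
  have hq : 4 ≤ q := Nat.le_floor (by exact_mod_cast hu)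
  have hqr : (4 : ℝ) ≤ q := by exact_mod_cast hq
  have hqu : q * M ^ 19 ≤ A ^ 2 := by
    rw [← le_div_iff₀ (by positivity)]; exact Nat.floor_le (by positivity)
  have huq : A ^ 2 ≤ 2 * q * M ^ 19 := by
    rw [← div_le_iff₀ (by positivity)]
    have := Nat.lt_floor_add_one (A ^ 2 / M ^ 19)
    rw [← hqdef] at this
    linarith
  have hqM : q * M ^ 10 ≤ A ^ 2 := le_trans (by gcongr; norm_num) hqu
  have hL : 3 ≤ M ^ 10 := by
    calc (3 : ℝ) ≤ (10 ^ 11) ^ 2 := by norm_num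
      _ ≤ (M ^ 5) ^ 2 := by gcongr
      _ = M ^ 10 := by ring
  have hqM0 : 0 < q * M ^ 10 := by positivity
  have hmid : 25 * (q * M ^ 10) ≤ A ^ 5 / (4 * (q * M ^ 10)) := by
    rw [le_div_iff₀ (by positivity)]
    calc 25 * (q * M ^ 10) * (4 * (q * M ^ 10)) = 100 * (q * M ^ 10) ^ 2 := by ring
      _ ≤ A * (A ^ 2) ^ 2 := by gcongr
      _ = A ^ 5 := by ring
  set b : ℕ := ⌊A ^ 5 / (2 * (q * M ^ 10))⌋₊ with hbdef
  have hb : A ^ 5 / (4 * (q * M ^ 10)) ≤ b := by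
    have h1 := (Nat.lt_floor_add_one (A ^ 5 / (2 * (q * M ^ 10)))).le
    rw [← hbdef] at h1
    have h2 : A ^ 5 / (2 * (q * M ^ 10)) = 2 * (A ^ 5 / (4 * (q * M ^ 10))) := by
      field_simp; norm_num
    nlinarith
  have hpow : 96 * 10 ^ 9 * (q : ℝ) ^ 5 * M ^ 90 ≤ A ^ 10 := by
    calc 96 * 10 ^ 9 * (q : ℝ) ^ 5 * M ^ 90 ≤ 10 ^ 11 * q ^ 5 * M ^ 90 := by
          gcongr; norm_num
      _ ≤ M ^ 5 * q ^ 5 * M ^ 90 := by gcongr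
      _ = (q * M ^ 19) ^ 5 := by ring
      _ ≤ (A ^ 2) ^ 5 := by gcongr
      _ = A ^ 10 := by ring
  have key := exists_large_not_sumset (G := G) hM hL (b := b) hq ?_ ?_ ?_
  · obtain ⟨T, hT, hTB⟩ := key
    refine ⟨T, le_trans ?_ hT, hTB⟩
    have : 4 * (Fintype.card G : ℝ) / q ≤ 8 * A ^ 3 * M ^ 19 := by
      rw [← hA, div_le_iff₀ (by positivity)]
      calc 4 * A ^ 5 = 4 * A ^ 3 * A ^ 2 := by ring
        _ ≤ 4 * A ^ 3 * (2 * q * M ^ 19) := by gcongr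
        _ = 8 * A ^ 3 * M ^ 19 * q := by ring
    linarith
  · rw [← hA]
    calc (b : ℝ) * M ^ 10 ≤ A ^ 5 / (2 * (q * M ^ 10)) * M ^ 10 := by
          gcongr; exact Nat.floor_le (by positivity)
      _ = A ^ 5 / (2 * q) := by field_simp
  · linarith
  · calc 6 * 10 ^ 9 * (q : ℝ) ^ 3 * (M ^ 10) ^ 7
        ≤ (A ^ 5 / (4 * (q * M ^ 10))) ^ 2 := by
          rw [div_pow, le_div_iff₀ (by positivity)]
          calc _ = 96 * 10 ^ 9 * (q : ℝ) ^ 5 * M ^ 90 := by ring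
            _ ≤ A ^ 10 := hpow
            _ = _ := by ring
      _ ≤ (b : ℝ) ^ 2 := by gcongr

open Filter in
lemma exists_large_not_sumset_of_card_ge :
    ∃ N : ℝ, ∀ (G : Type) [AddCommGroup G] [Fintype G] [DecidableEq G], N ≤ Fintype.card G →
      ∃ T : Finset G,
        (Fintype.card G : ℝ) - 8 * (Fintype.card G : ℝ) ^ ((3 : ℝ) / 5) *
          Real.log (Fintype.card G) ^ ((19 : ℝ) / 10) ≤ #T ∧
        ∀ B : Finset G, B + B ≠ T := by
  have h1 : ∀ᶠ x : ℝ in atTop, 100 ≤ x ^ ((1 : ℝ) / 5) :=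
    (tendsto_rpow_atTop (by norm_num)).eventually_ge_atTop _
  have h2 : ∀ᶠ x : ℝ in atTop, 10 ^ 11 ≤ Real.log x ^ ((1 : ℝ) / 10) :=
    ((tendsto_rpow_atTop (by norm_num)).comp Real.tendsto_log_atTop).eventually_ge_atTop _
  have h3 : ∀ᶠ x : ℝ in atTop,
      ‖Real.log x ^ ((19 : ℝ) / 10)‖ ≤ 1 / 4 * ‖x ^ ((2 : ℝ) / 5)‖ :=
    (isLittleO_log_rpow_rpow_atTop ((19 : ℝ) / 10) (by norm_num)).bound (by norm_num)
  obtain ⟨N, hN⟩ := eventually_atTop.1 (((h1.and h2).and h3).and (eventually_ge_atTop 1))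
  refine ⟨N, fun G _ _ _ hG => ?_⟩
  obtain ⟨⟨⟨hA, hM⟩, hMA⟩, hn⟩ := hN _ hG
  have hL := Real.log_nonneg hn
  have hApow : ∀ k : ℕ, ((Fintype.card G : ℝ) ^ ((1 : ℝ) / 5)) ^ k =
      (Fintype.card G : ℝ) ^ ((k : ℝ) / 5) := fun k => by
    rw [← Real.rpow_mul_natCast (by positivity)]; ring_nf
  have hMpow : ∀ k : ℕ, (Real.log (Fintype.card G) ^ ((1 : ℝ) / 10)) ^ k =
      Real.log (Fintype.card G) ^ ((k : ℝ) / 10) := fun k => by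
    rw [← Real.rpow_mul_natCast hL]; ring_nf
  have hM1 : 1 ≤ Real.log (Fintype.card G) ^ ((1 : ℝ) / 10) := le_trans (by norm_num) hM
  rw [Real.norm_of_nonneg (by positivity), Real.norm_of_nonneg (by positivity)] at hMA
  have hA5 := hApow 5
  have hA2 := hApow 2
  have hA3 := hApow 3
  have hM10 := hMpow 10
  have hM19 := hMpow 19
  norm_num only [Real.rpow_one, Nat.cast_ofNat] at hA5 hA2 hA3 hM10 hM19 hMA hM1 hA hM ⊢
  rw [← hA3, ← hM19]
  refine exists_large_not_sumset_of_roots hA5 hM10 hA hM1 ?_ ?_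
  · exact le_trans (by norm_num) (hM.trans (le_self_pow₀ hM1 (by norm_num)))
  · rw [hM19, hA2]
    linarith

/-- every finite abelian group of order `n ≥ 2` contains a subset of size at
least `n - C n^{3/5} (log n)^{19/10}` which is not a sumset `B + B`. -/
theorem stmt2 :
    ∃ C c : ℝ, 0 < C ∧ 0 < c ∧
      ∀ (G : Type) [AddCommGroup G] [Fintype G] [DecidableEq G],
        2 ≤ Fintype.card G →
        ∃ T : Finset G,
          (T.card : ℝ) ≥ (Fintype.card G : ℝ) -
              C * (Fintype.card G : ℝ) ^ ((3 : ℝ) / 5) *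
                Real.log (Fintype.card G) ^ ((19 : ℝ) / 10) ∧
          ∀ B : Finset G, B + B ≠ T := by
  obtain ⟨N, hN⟩ := exists_large_not_sumset_of_card_ge
  have hlog2 : 0 < Real.log 2 ^ ((19 : ℝ) / 10) :=
    Real.rpow_pos_of_pos (Real.log_pos (by norm_num)) _
  refine ⟨max 8 (N / Real.log 2 ^ ((19 : ℝ) / 10)), 1, by positivity, one_pos, ?_⟩
  intro G _ _ _ hG
  have hGr : (2 : ℝ) ≤ Fintype.card G := by exact_mod_cast hG
  have hL : 0 ≤ Real.log (Fintype.card G) := Real.log_nonneg (by linarith)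
  rcases le_or_gt N (Fintype.card G) with h | h
  · obtain ⟨T, hT, hTB⟩ := hN G h
    refine ⟨T, le_trans ?_ hT, hTB⟩
    gcongr
    exact le_max_left _ _
  · obtain ⟨T, hTB⟩ := exists_not_sumset hG
    refine ⟨T, le_trans ?_ (Nat.cast_nonneg _), hTB⟩
    have h1 : (1 : ℝ) ≤ (Fintype.card G : ℝ) ^ ((3 : ℝ) / 5) :=
      Real.one_le_rpow (by linarith) (by norm_num)
    have hN0 : 0 ≤ N := by linarith
    rw [sub_nonpos]
    calc (Fintype.card G : ℝ) ≤ N := h.le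
      _ = N / Real.log 2 ^ ((19 : ℝ) / 10) * 1 * Real.log 2 ^ ((19 : ℝ) / 10) := by field_simp
      _ ≤ _ := by
        gcongr
        exact le_max_right _ _
end

section
/- There exists an absolute constant c₂ > 0 such that the following holds: for every ε > 0 there is p₀ such that for every prime p ≥ p₀, if A is a random subset of ℤ_p obtained by including each element independently with probability q = 1/√p, then with probability at least 1 − ε the sumset A + A contains no arithmetic progression of length greater than c₂·log p. -/
open scoped Pointwise Classical
open Finset

/-- The probability that a random subset of `α`, containing each element independently with
probability `q`, satisfies `E`. -/
noncomputable def bernoulliProb {α : Type*} [Fintype α] (q : ℝ) (E : Finset α → Prop) : ℝ :=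
  ∑ A : Finset α, if E A then q ^ #A * (1 - q) ^ (Fintype.card α - #A) else 0

section bernoulliProb

variable {α : Type*} [Fintype α] {q : ℝ}

lemma bernoulliProb_mono (hq0 : 0 ≤ q) (hq1 : q ≤ 1) {E F : Finset α → Prop}
    (h : ∀ A, E A → F A) : bernoulliProb q E ≤ bernoulliProb q F := by
  unfold bernoulliProb
  refine sum_le_sum fun A _ => ?_
  have hw : 0 ≤ q ^ #A * (1 - q) ^ (Fintype.card α - #A) :=
    mul_nonneg (pow_nonneg hq0 _) (pow_nonneg (sub_nonneg.2 hq1) _)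
  by_cases hE : E A
  · rw [if_pos hE, if_pos (h A hE)]
  · rw [if_neg hE]
    split_ifs
    exacts [hw, le_rfl]

lemma bernoulliProb_exists_le (hq0 : 0 ≤ q) (hq1 : q ≤ 1) {κ : Type*} (s : Finset κ)
    (E : κ → Finset α → Prop) :
    bernoulliProb q (fun A => ∃ i ∈ s, E i A) ≤ ∑ i ∈ s, bernoulliProb q (E i) := by
  unfold bernoulliProb
  rw [sum_comm]
  refine sum_le_sum fun A _ => ?_
  have hw : 0 ≤ q ^ #A * (1 - q) ^ (Fintype.card α - #A) :=
    mul_nonneg (pow_nonneg hq0 _) (pow_nonneg (sub_nonneg.2 hq1) _)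
  have hn : ∀ i ∈ s, 0 ≤ if E i A then q ^ #A * (1 - q) ^ (Fintype.card α - #A) else 0 := by
    intro i _
    split_ifs
    exacts [hw, le_rfl]
  split_ifs with h
  · obtain ⟨i, hi, hE⟩ := h
    refine le_trans ?_ (single_le_sum hn hi)
    rw [if_pos hE]
  · exact sum_nonneg hn

lemma bernoulliProb_or_le (hq0 : 0 ≤ q) (hq1 : q ≤ 1) (E F : Finset α → Prop) :
    bernoulliProb q (fun A => E A ∨ F A) ≤ bernoulliProb q E + bernoulliProb q F := by
  unfold bernoulliProb
  rw [← sum_add_distrib]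
  refine sum_le_sum fun A _ => ?_
  have hw : 0 ≤ q ^ #A * (1 - q) ^ (Fintype.card α - #A) :=
    mul_nonneg (pow_nonneg hq0 _) (pow_nonneg (sub_nonneg.2 hq1) _)
  by_cases hE : E A <;> by_cases hF : F A <;> simp [hE, hF, hw]

lemma bernoulliProb_add_not (E : Finset α → Prop) :
    bernoulliProb q E + bernoulliProb q (fun A => ¬ E A) = 1 := by
  unfold bernoulliProb
  rw [← sum_add_distrib]
  have h := Finset.sum_pow_mul_eq_add_pow q (1 - q) (univ : Finset α)
  rw [add_sub_cancel, one_pow, powerset_univ] at h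
  refine Eq.trans (sum_congr rfl fun A _ => ?_) h
  by_cases hE : E A <;> simp [hE]

lemma bernoulliProb_superset (B : Finset α) : bernoulliProb q (fun A => B ⊆ A) = q ^ #B := by
  have h := prod_add (fun _ : α => q) (fun i => if i ∈ B then 0 else 1 - q) univ
  have h1 : ∀ i : α, (q + if i ∈ B then 0 else 1 - q) = if i ∈ B then q else 1 := by
    intro i
    split_ifs <;> ring
  simp only [h1, prod_ite_mem, univ_inter, prod_const, powerset_univ] at h
  rw [h]
  unfold bernoulliProb
  refine sum_congr rfl fun A _ => ?_
  split_ifs with hBA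
  · congr 1
    rw [prod_congr rfl (g := fun _ => 1 - q)]
    · rw [prod_const, card_univ_sdiff]
    · intro i hi
      rw [if_neg fun hiB => (mem_sdiff.1 hi).2 (hBA hiB)]
  · obtain ⟨i, hiB, hiA⟩ := not_subset.1 hBA
    rw [prod_eq_zero (i := i) (by simp [hiA]) (by simp [hiB]), mul_zero]

lemma bernoulliProb_pairwiseDisjoint_le (hq0 : 0 ≤ q) (hq1 : q ≤ 1) {ι κ : Type*} (S : Finset ι)
    (I : ι → Finset κ) (F : ι → κ → Finset α) :
    bernoulliProb q (fun A => ∃ g : ι → κ, (∀ s ∈ S, g s ∈ I s ∧ F s (g s) ⊆ A) ∧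
      (S : Set ι).PairwiseDisjoint fun s => F s (g s)) ≤
    ∏ s ∈ S, ∑ i ∈ I s, q ^ #(F s i) := by
  let J := (S.pi I).filter fun g => ((S.attach : Finset S) : Set S).PairwiseDisjoint
    fun s => F s.1 (g s.1 s.2)
  calc _ ≤ bernoulliProb q (fun A => ∃ g ∈ J, S.attach.biUnion (fun s => F s.1 (g s.1 s.2)) ⊆ A) := by
        refine bernoulliProb_mono hq0 hq1 fun A => ?_
        rintro ⟨g, hg, hd⟩
        refine ⟨fun s _ => g s, ?_, ?_⟩
        · refine mem_filter.2 ⟨mem_pi.2 fun s hs => (hg s hs).1, fun s _ t _ hst => ?_⟩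
          exact hd s.2 t.2 fun h => hst (Subtype.ext h)
        · exact biUnion_subset.2 fun s _ => (hg s.1 s.2).2
    _ ≤ ∑ g ∈ J, q ^ #(S.attach.biUnion (fun s => F s.1 (g s.1 s.2))) := by
        refine (bernoulliProb_exists_le hq0 hq1 _ _).trans_eq ?_
        exact sum_congr rfl fun g _ => bernoulliProb_superset _
    _ = ∑ g ∈ J, ∏ s ∈ S.attach, q ^ #(F s.1 (g s.1 s.2)) := by
        refine sum_congr rfl fun g hg => ?_
        rw [card_biUnion (mem_filter.1 hg).2, prod_pow_eq_pow_sum]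
    _ ≤ ∑ g ∈ S.pi I, ∏ s ∈ S.attach, q ^ #(F s.1 (g s.1 s.2)) :=
        sum_le_sum_of_subset_of_nonneg (filter_subset _ _) fun _ _ _ =>
          prod_nonneg fun _ _ => pow_nonneg hq0 _
    _ = _ := (prod_sum S I fun s i => q ^ #(F s i)).symm

end bernoulliProb

section SumGraph

variable {G : Type*} [AddCommGroup G] [DecidableEq G]

/-- The vertex set of the path `x - a, a, y - a` of length two in the sum graph, where `t` is
`(a, x, y)`. -/
def cherry (t : G × G × G) : Finset G := {t.1, t.2.1 - t.1, t.2.2 - t.1}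

lemma card_cherry_le (t : G × G × G) : #(cherry t) ≤ 3 := card_le_three

lemma exists_disjoint_cherries_or_hitting (I : Finset (G × G × G)) (A : Finset G) (r : ℕ) :
    (∃ g : ℕ → G × G × G, (∀ i ∈ range r, g i ∈ I ∧ cherry (g i) ⊆ A) ∧
      ((range r : Finset ℕ) : Set ℕ).PairwiseDisjoint fun i => cherry (g i)) ∨
    ∃ W : Finset G, #W ≤ 3 * r ∧ ∀ t ∈ I, cherry t ⊆ A → ¬ Disjoint W (cherry t) := by
  induction r with
  | zero => exact Or.inl ⟨fun _ => 0, by simp, by simp⟩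
  | succ r ih =>
    rcases ih with ⟨g, hg, hd⟩ | ⟨W, hW, h⟩
    · by_cases hex : ∃ t ∈ I, cherry t ⊆ A ∧
          Disjoint ((range r).biUnion fun i => cherry (g i)) (cherry t)
      · obtain ⟨t, htI, htA, ht⟩ := hex
        rw [disjoint_biUnion_left] at ht
        have hlt : ∀ i < r, Function.update g r t i = g i := fun i hi =>
          Function.update_of_ne hi.ne _ _
        refine Or.inl ⟨Function.update g r t, ?_, ?_⟩
        · intro i hi
          rcases Nat.lt_succ_iff_lt_or_eq.1 (mem_range.1 hi) with hi | rfl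
          · rw [hlt i hi]
            exact hg i (mem_range.2 hi)
          · rw [Function.update_self]
            exact ⟨htI, htA⟩
        · intro i hi j hj hij
          simp only [coe_range, Set.mem_Iio] at hi hj
          change Disjoint (cherry _) (cherry _)
          rcases Nat.lt_succ_iff_lt_or_eq.1 hi with hi | rfl <;>
            rcases Nat.lt_succ_iff_lt_or_eq.1 hj with hj | rfl
          · rw [hlt i hi, hlt j hj]
            exact hd (by simpa using hi) (by simpa using hj) hij
          · rw [hlt i hi, Function.update_self]
            exact ht i (mem_range.2 hi)
          · rw [hlt j hj, Function.update_self]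
            exact (ht j (mem_range.2 hj)).symm
          · exact absurd rfl hij
      · push Not at hex
        refine Or.inr ⟨(range r).biUnion fun i => cherry (g i), ?_, hex⟩
        refine (card_biUnion_le_card_mul _ _ 3 fun i _ => card_cherry_le _).trans ?_
        rw [card_range]
        omega
    · exact Or.inr ⟨W, by omega, h⟩

variable [Fintype G]

lemma exists_matching_of_subset_add {A P : Finset G} (hP : P ⊆ A + A) {I : G → Finset G}
    (hI : ∀ x a, a ∈ I x ∨ x - a ∈ I x) {D r : ℕ} (hD : ∀ a, #{x ∈ P | x - a ∈ A} ≤ D)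
    {W : Finset G} (hWr : #W ≤ 3 * r)
    (hW : ∀ t ∈ univ ×ˢ P.offDiag, cherry t ⊆ A → ¬ Disjoint W (cherry t)) :
    ∃ S ∈ P.powersetCard (#P - 3 * r * D), ∃ g : G → G,
      (∀ x ∈ S, g x ∈ I x ∧ ({g x, x - g x} : Finset G) ⊆ A) ∧
      (S : Set G).PairwiseDisjoint fun x => ({g x, x - g x} : Finset G) := by
  set B := W.biUnion fun a => {x ∈ P | x - a ∈ A} with hB
  have hBcard : #B ≤ 3 * r * D :=
    (card_biUnion_le_card_mul _ _ D fun a _ => hD a).trans (Nat.mul_le_mul_right D hWr)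
  obtain ⟨S, hS, hScard⟩ := exists_subset_card_eq (s := P \ B) (n := #P - 3 * r * D)
    (by have := le_card_sdiff B P; omega)
  have hrep : ∀ x, ∃ a, x ∈ P → a ∈ I x ∧ a ∈ A ∧ x - a ∈ A := by
    intro x
    by_cases hx : x ∈ P
    · obtain ⟨a, ha, b, hb, rfl⟩ := mem_add.1 (hP hx)
      rcases hI (a + b) a with h | h
      · exact ⟨a, fun _ => ⟨h, ha, by simpa using hb⟩⟩
      · exact ⟨a + b - a, fun _ => ⟨h, by simpa using hb, by simpa using ha⟩⟩
    · exact ⟨0, fun h => absurd h hx⟩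
  choose g hg using hrep
  have hSP : ∀ x ∈ S, x ∈ P := fun x hx => (mem_sdiff.1 (hS hx)).1
  refine ⟨S, mem_powersetCard.2 ⟨hSP, hScard⟩, g, fun x hx => ?_, fun x hx y hy hxy => ?_⟩
  · obtain ⟨h1, h2, h3⟩ := hg x (hSP x hx)
    exact ⟨h1, by simp [insert_subset_iff, h2, h3]⟩
  · have hedge : ∀ z ∈ S, ∀ c ∈ ({g z, z - g z} : Finset G), c ∈ A ∧ z - c ∈ A := by
      intro z hz c hc
      obtain ⟨-, h2, h3⟩ := hg z (hSP z hz)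
      rcases mem_insert.1 hc with rfl | hc
      · exact ⟨h2, h3⟩
      · rw [mem_singleton.1 hc]
        exact ⟨h3, by simpa using h2⟩
    have hout : ∀ z ∈ S, ∀ c, z - c ∈ A → c ∉ W := by
      intro z hz c hc hcW
      exact (mem_sdiff.1 (hS hz)).2
        (mem_biUnion.2 ⟨c, hcW, mem_filter.2 ⟨hSP z hz, hc⟩⟩)
    refine disjoint_left.2 fun c hcx hcy => ?_
    obtain ⟨hc, hxc⟩ := hedge x hx c hcx
    obtain ⟨-, hyc⟩ := hedge y hy c hcy
    refine hW (c, x, y) (by simp [hSP x hx, hSP y hy, hxy]) ?_ ?_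
    · simp [cherry, insert_subset_iff, hc, hxc, hyc]
    · simp [cherry, hout x hx c hxc, hout x hx (x - c) (by simpa using hc),
        hout y hy (y - c) (by simpa using hc)]

lemma sum_pow_card_cherry_le {q : ℝ} (hq0 : 0 ≤ q) (hq1 : q ≤ 1)
    (hq : Fintype.card G * q ^ 2 = 1) (hG : ∀ a b : G, a + a = b + b → a = b) (P : Finset G) :
    ∑ t ∈ univ ×ˢ P.offDiag, q ^ #(cherry t) ≤ 3 * #P ^ 2 * q := by
  have hone : ∀ x : G, ∑ a : G, (if a + a = x then q ^ 2 else 0) ≤ q := by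
    intro x
    have hc : #{a : G | a + a = x} ≤ 1 := card_le_one.2 fun a ha b hb => by
      simp only [mem_filter, mem_univ, true_and] at ha hb
      exact hG a b (ha.trans hb.symm)
    rw [← sum_filter, sum_const, nsmul_eq_mul]
    have : (#{a : G | a + a = x} : ℝ) ≤ 1 := by exact_mod_cast hc
    nlinarith [sq_nonneg q]
  have hterm : ∀ u ∈ P.offDiag, ∀ a : G, q ^ #(cherry (a, u)) ≤
      q ^ 3 + (if a + a = u.1 then q ^ 2 else 0) + (if a + a = u.2 then q ^ 2 else 0) := by
    intro u hu a
    have hne : u.1 - a ≠ u.2 - a := fun h => (mem_offDiag.1 hu).2.2 (sub_left_injective h)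
    have h2 : 2 ≤ #(cherry (a, u)) := by
      rw [← card_pair hne]
      exact card_le_card (subset_insert _ _)
    have hle : q ^ #(cherry (a, u)) ≤ q ^ 2 := pow_le_pow_of_le_one hq0 hq1 h2
    have h3 := pow_nonneg hq0 3
    have h2' := pow_nonneg hq0 2
    by_cases ha : a + a = u.1
    · rw [if_pos ha]
      split_ifs <;> linarith
    by_cases hb : a + a = u.2
    · rw [if_neg ha, if_pos hb]
      linarith
    · rw [if_neg ha, if_neg hb, cherry, card_eq_three.2 ⟨_, _, _, ?_, ?_, hne, rfl⟩]
      · simp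
      · exact fun h => ha (eq_sub_iff_add_eq.1 h)
      · exact fun h => hb (eq_sub_iff_add_eq.1 h)
  rw [sum_product_right]
  calc _ ≤ ∑ u ∈ P.offDiag, 3 * q := by
        refine sum_le_sum fun u hu => (sum_le_sum fun a _ => hterm u hu a).trans ?_
        rw [sum_add_distrib, sum_add_distrib, sum_const, card_univ, nsmul_eq_mul]
        have : (Fintype.card G : ℝ) * q ^ 3 = q := by
          rw [pow_succ, ← mul_assoc, hq, one_mul]
        linarith [hone u.1, hone u.2]
    _ ≤ _ := by
        rw [sum_const, nsmul_eq_mul]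
        have : (#P.offDiag : ℝ) ≤ #P ^ 2 := by
          have h : #P.offDiag ≤ #P ^ 2 := by
            rw [offDiag_card, sq]
            exact Nat.sub_le _ _
          exact_mod_cast h
        nlinarith

lemma bernoulliProb_subset_add_le {q : ℝ} (hq0 : 0 ≤ q) (hq1 : q ≤ 1)
    (hq : Fintype.card G * q ^ 2 = 1) (hG : ∀ a b : G, a + a = b + b → a = b) {I : G → Finset G}
    (hI : ∀ x a, a ∈ I x ∨ x - a ∈ I x) {M : ℝ}
    (hM : ∀ x, ∑ a ∈ I x, q ^ #({a, x - a} : Finset G) ≤ M) (D r : ℕ) (P : Finset G) :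
    bernoulliProb q (fun A => P ⊆ A + A) ≤
      Fintype.card G * #P ^ D * q ^ D + (3 * #P ^ 2 * q) ^ r +
        (#P).choose (#P - 3 * r * D) * M ^ (#P - 3 * r * D) := by
  let star : G × Finset G → Finset G := fun u => u.2.image fun x => x - u.1
  have hstar : bernoulliProb q (fun A => ∃ u ∈ univ ×ˢ P.powersetCard D, star u ⊆ A) ≤
      Fintype.card G * #P ^ D * q ^ D := by
    refine (bernoulliProb_exists_le hq0 hq1 _ _).trans ?_
    rw [sum_congr rfl (g := fun _ => q ^ D)]
    · rw [sum_const, nsmul_eq_mul, card_product, card_powersetCard, card_univ, Nat.cast_mul]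
      have : ((#P).choose D : ℝ) ≤ #P ^ D := by exact_mod_cast Nat.choose_le_pow _ _
      gcongr
    · intro u hu
      rw [bernoulliProb_superset, card_image_of_injective _ sub_left_injective,
        (mem_powersetCard.1 (mem_product.1 hu).2).2]
  have hcherry := (bernoulliProb_pairwiseDisjoint_le hq0 hq1 (range r)
    (fun _ => univ ×ˢ P.offDiag) (fun _ t => cherry (G := G) t)).trans
    (prod_le_prod (fun _ _ => sum_nonneg fun _ _ => pow_nonneg hq0 _)
      fun _ _ => sum_pow_card_cherry_le hq0 hq1 hq hG P)
  rw [prod_const, card_range] at hcherry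
  have hmatch := (bernoulliProb_exists_le hq0 hq1 (P.powersetCard (#P - 3 * r * D))
    fun S A => ∃ g : G → G, (∀ x ∈ S, g x ∈ I x ∧ ({g x, x - g x} : Finset G) ⊆ A) ∧
      (S : Set G).PairwiseDisjoint fun x => ({g x, x - g x} : Finset G)).trans
    (sum_le_sum (g := fun _ => M ^ (#P - 3 * r * D)) fun S hS => by
      refine (bernoulliProb_pairwiseDisjoint_le hq0 hq1 S I
        fun x a => ({a, x - a} : Finset G)).trans ?_
      rw [← (mem_powersetCard.1 hS).2, ← prod_const]
      exact prod_le_prod (fun _ _ => sum_nonneg fun _ _ => pow_nonneg hq0 _) fun x _ => hM x)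
  rw [sum_const, nsmul_eq_mul, card_powersetCard] at hmatch
  refine le_trans ?_ (add_le_add (add_le_add hstar hcherry) hmatch)
  refine le_trans ?_ ((bernoulliProb_or_le hq0 hq1 _ _).trans
    (add_le_add_left (bernoulliProb_or_le hq0 hq1 _ _) _))
  refine bernoulliProb_mono hq0 hq1 fun A hA => ?_
  by_cases hs : ∃ a, D ≤ #{x ∈ P | x - a ∈ A}
  · obtain ⟨a, ha⟩ := hs
    obtain ⟨T, hT, hTD⟩ := exists_subset_card_eq ha
    refine Or.inl (Or.inl ⟨(a, T), ?_, image_subset_iff.2 fun x hx => (mem_filter.1 (hT hx)).2⟩)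
    exact mem_product.2 ⟨mem_univ _, mem_powersetCard.2 ⟨hT.trans (filter_subset _ _), hTD⟩⟩
  · push Not at hs
    rcases exists_disjoint_cherries_or_hitting (univ ×ˢ P.offDiag) A r with h | ⟨W, hWr, hW⟩
    · exact Or.inl (Or.inr h)
    · exact Or.inr (exists_matching_of_subset_add hA hI (fun a => (hs a).le) hWr hW)

end SumGraph

/-- Representatives of the unordered pairs of elements of `ZMod p` with sum `x`. -/
def pairReps {p : ℕ} [NeZero p] (x : ZMod p) : Finset (ZMod p) := {a | a.val ≤ (x - a).val}

lemma mem_pairReps_or {p : ℕ} [NeZero p] (x a : ZMod p) :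
    a ∈ pairReps x ∨ x - a ∈ pairReps x := by
  simp only [pairReps, mem_filter, mem_univ, true_and, sub_sub_cancel]
  exact le_total _ _

lemma sum_pow_card_pairReps_le {p : ℕ} [NeZero p] (hG : ∀ a b : ZMod p, a + a = b + b → a = b)
    {q : ℝ} (hq0 : 0 ≤ q) (hq : p * q ^ 2 = 1) (hq8 : q ≤ 1 / 8) (x : ZMod p) :
    ∑ a ∈ pairReps x, q ^ #({a, x - a} : Finset (ZMod p)) ≤ 3 / 4 := by
  have hdiag : #{a : ZMod p | a + a = x} ≤ 1 := card_le_one.2 fun a ha b hb => by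
    simp only [mem_filter, mem_univ, true_and] at ha hb
    exact hG a b (ha.trans hb.symm)
  have himg : #((pairReps x).image fun a => x - a) = #(pairReps x) :=
    card_image_of_injective _ sub_right_injective
  have hinter : pairReps x ∩ (pairReps x).image (fun a => x - a) ⊆
      ({a | a + a = x} : Finset (ZMod p)) := by
    intro a ha
    obtain ⟨h1, h2⟩ := mem_inter.1 ha
    obtain ⟨b, hb, rfl⟩ := mem_image.1 h2
    simp only [pairReps, mem_filter, mem_univ, true_and, sub_sub_cancel] at h1 hb ⊢
    have := ZMod.val_injective p (le_antisymm h1 hb)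
    nth_rewrite 2 [this]
    exact sub_add_cancel x b
  have hcard : 2 * #(pairReps x) ≤ p + 1 := by
    have h1 := card_union_add_card_inter (pairReps x) ((pairReps x).image fun a => x - a)
    have h2 := card_le_univ (pairReps x ∪ (pairReps x).image fun a => x - a)
    rw [ZMod.card] at h2
    have h3 := (card_le_card hinter).trans hdiag
    omega
  have hterm : ∀ a : ZMod p, q ^ #({a, x - a} : Finset (ZMod p)) ≤
      q ^ 2 + if a + a = x then q else 0 := by
    intro a
    split_ifs with h
    · rw [← eq_sub_iff_add_eq.2 h]
      simp [sq_nonneg]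
    · rw [card_pair fun h' => h (eq_sub_iff_add_eq.1 h'), add_zero]
  calc _ ≤ ∑ a ∈ pairReps x, (q ^ 2 + if a + a = x then q else 0) :=
        sum_le_sum fun a _ => hterm a
    _ ≤ #(pairReps x) * q ^ 2 + ∑ a : ZMod p, if a + a = x then q else 0 := by
        rw [sum_add_distrib, sum_const, nsmul_eq_mul]
        refine add_le_add_right (sum_le_sum_of_subset_of_nonneg (subset_univ _) fun _ _ _ => ?_) _
        split_ifs
        exacts [hq0, le_rfl]
    _ ≤ (p + 1) / 2 * q ^ 2 + 1 * q := by
        rw [← sum_filter, sum_const, nsmul_eq_mul]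
        have h1 : (2 * #(pairReps x) : ℝ) ≤ p + 1 := by exact_mod_cast hcard
        have h2 : (#{a : ZMod p | a + a = x} : ℝ) ≤ 1 := by exact_mod_cast hdiag
        gcongr
        linarith
    _ ≤ 3 / 4 := by nlinarith

lemma choose_sub_le_pow {n : ℕ} (hn : 1 ≤ n) (l : ℕ) : n.choose (n - l) ≤ n ^ l := by
  rcases le_total l n with h | h
  · rw [Nat.choose_symm h]
    exact Nat.choose_le_pow _ _
  · rw [Nat.sub_eq_zero_of_le h, Nat.choose_zero_right]
    exact Nat.one_le_pow _ _ hn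

lemma three_quarters_pow_le {y : ℝ} (hy : 0 < y) {n : ℕ} (hn : 12 * Real.log y ≤ n) :
    (3 / 4 : ℝ) ^ n ≤ (y ^ 3)⁻¹ := by
  have h1 : (3 / 4 : ℝ) ≤ Real.exp (-(1 / 4)) := by
    linarith [Real.add_one_le_exp (-(1 / 4) : ℝ)]
  calc (3 / 4 : ℝ) ^ n ≤ Real.exp (-(1 / 4)) ^ n := by gcongr
    _ = Real.exp (-(n / 4)) := by rw [← Real.exp_nat_mul]; congr 1; ring
    _ ≤ Real.exp (-(3 * Real.log y)) := by gcongr; linarith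
    _ = (y ^ 3)⁻¹ := by
        rw [Real.exp_neg, mul_comm, Real.exp_mul, Real.exp_log hy]
        norm_cast

lemma union_bound_le {x : ℝ} (hx : 1 ≤ x) {K : ℕ} (hK1 : 1 ≤ K)
    (hK : 12 * Real.log (x ^ 2) ≤ K) :
    (x ^ 2) ^ 2 * (x ^ 2 * K ^ 10 * (1 / x) ^ 10 + (3 * K ^ 2 * (1 / x)) ^ 5 +
      K.choose (K - 3 * 5 * 10) * (3 / 4 : ℝ) ^ (K - 3 * 5 * 10)) ≤
    (244 + (4 / 3) ^ 150) * K ^ 150 / x := by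
  have hx0 : 0 < x := by linarith
  have hK' : (1 : ℝ) ≤ K := by exact_mod_cast hK1
  have hpow : (K : ℝ) ^ 10 ≤ K ^ 150 := pow_le_pow_right₀ hK' (by norm_num)
  have hinv : ∀ n : ℕ, n ≠ 0 → (1 / x) ^ n ≤ 1 / x := fun n hn =>
    pow_le_of_le_one (by positivity) (by rw [div_le_one hx0]; exact hx) hn
  have h1 : (x ^ 2) ^ 2 * (x ^ 2 * K ^ 10 * (1 / x) ^ 10) ≤ K ^ 150 * (1 / x) := by
    calc _ = (K : ℝ) ^ 10 * (1 / x) ^ 4 := by field_simp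
      _ ≤ _ := by gcongr; exact hinv 4 (by norm_num)
  have h2 : (x ^ 2) ^ 2 * (3 * K ^ 2 * (1 / x)) ^ 5 ≤ 243 * K ^ 150 * (1 / x) := by
    calc _ = 243 * (K : ℝ) ^ 10 * (1 / x) := by field_simp; norm_num
      _ ≤ _ := by gcongr
  have h3 : (x ^ 2) ^ 2 * (K.choose (K - 3 * 5 * 10) * (3 / 4 : ℝ) ^ (K - 3 * 5 * 10)) ≤
      (4 / 3) ^ 150 * K ^ 150 * (1 / x) := by
    have hc : (K.choose (K - 3 * 5 * 10) : ℝ) ≤ K ^ 150 := by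
      exact_mod_cast choose_sub_le_pow hK1 150
    have hq : (3 / 4 : ℝ) ^ (K - 3 * 5 * 10) ≤ (4 / 3) ^ 150 * ((x ^ 2) ^ 3)⁻¹ := by
      calc (3 / 4 : ℝ) ^ (K - 3 * 5 * 10)
          = (4 / 3) ^ 150 * (3 / 4) ^ (K - 3 * 5 * 10 + 150) := by
            rw [pow_add, mul_left_comm, ← mul_pow]; norm_num
        _ ≤ (4 / 3) ^ 150 * (3 / 4) ^ K := by
            refine mul_le_mul_of_nonneg_left ?_ (by positivity)
            exact pow_le_pow_of_le_one (by norm_num) (by norm_num) (by omega)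
        _ ≤ _ := mul_le_mul_of_nonneg_left (three_quarters_pow_le (by positivity) hK)
            (by positivity)
    calc _ ≤ (x ^ 2) ^ 2 * (K ^ 150 * ((4 / 3) ^ 150 * ((x ^ 2) ^ 3)⁻¹)) := by gcongr
      _ = (4 / 3) ^ 150 * K ^ 150 * (1 / x) ^ 2 := by
          generalize ((4 / 3 : ℝ)) ^ 150 = c
          field_simp
      _ ≤ _ := by gcongr; exact hinv 2 (by norm_num)
  calc _ ≤ (K : ℝ) ^ 150 * (1 / x) + 243 * K ^ 150 * (1 / x) +
        (4 / 3) ^ 150 * K ^ 150 * (1 / x) := by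
        rw [mul_add, mul_add]
        exact add_le_add (add_le_add h1 h2) h3
    _ = _ := by
        generalize ((4 / 3 : ℝ)) ^ 150 = c
        ring

lemma eventually_log_pow_div_le {ε : ℝ} (hε : 0 < ε) (c : ℝ) (n : ℕ) :
    ∀ᶠ x : ℝ in Filter.atTop, c * (26 * Real.log x) ^ n / x ≤ ε := by
  have h := (Real.isLittleO_pow_log_id_atTop (n := n)).tendsto_div_nhds_zero.const_mul (c * 26 ^ n)
  rw [mul_zero] at h
  filter_upwards [h.eventually_le_const hε] with x hx
  refine le_trans (le_of_eq ?_) hx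
  simp only [id]
  ring

lemma bernoulliProb_exists_progression_le {p : ℕ} [Fact p.Prime] (hp : 64 ≤ p) (K : ℕ) :
    bernoulliProb (1 / √(p : ℝ)) (fun A : Finset (ZMod p) => ∃ b d : ZMod p,
      #((range K).image fun i : ℕ => b + (i : ZMod p) * d) = K ∧
        ((range K).image fun i : ℕ => b + (i : ZMod p) * d) ⊆ A + A) ≤
    (p : ℝ) ^ 2 * (p * K ^ 10 * (1 / √(p : ℝ)) ^ 10 + (3 * K ^ 2 * (1 / √(p : ℝ))) ^ 5 +
      K.choose (K - 3 * 5 * 10) * (3 / 4 : ℝ) ^ (K - 3 * 5 * 10)) := by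
  have hp0 : (64 : ℝ) ≤ p := by exact_mod_cast hp
  have hs : 8 ≤ √(p : ℝ) := Real.le_sqrt_of_sq_le (by norm_num1; exact hp0)
  have hq0 : 0 ≤ 1 / √(p : ℝ) := by positivity
  have hq8 : 1 / √(p : ℝ) ≤ 1 / 8 := one_div_le_one_div_of_le (by norm_num) hs
  have hq1 : 1 / √(p : ℝ) ≤ 1 := by linarith
  have hq : (p : ℝ) * (1 / √(p : ℝ)) ^ 2 = 1 := by
    rw [div_pow, Real.sq_sqrt (by positivity), one_pow, mul_one_div_cancel (by positivity)]
  have h2 : (2 : ZMod p) ≠ 0 := by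
    intro h
    have h' : ((2 : ℕ) : ZMod p) = 0 := by exact_mod_cast h
    have := Nat.le_of_dvd two_pos ((ZMod.natCast_eq_zero_iff 2 p).1 h')
    omega
  have hG : ∀ a b : ZMod p, a + a = b + b → a = b := fun a b h => by
    rw [← two_mul, ← two_mul] at h
    exact mul_left_cancel₀ h2 h
  let prog : ZMod p × ZMod p → Finset (ZMod p) :=
    fun u => (range K).image fun i : ℕ => u.1 + (i : ZMod p) * u.2
  set B : ℝ := p * K ^ 10 * (1 / √(p : ℝ)) ^ 10 + (3 * K ^ 2 * (1 / √(p : ℝ))) ^ 5 +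
      K.choose (K - 3 * 5 * 10) * (3 / 4 : ℝ) ^ (K - 3 * 5 * 10)
  have hB0 : 0 ≤ B := add_nonneg (by positivity)
    (mul_nonneg (Nat.cast_nonneg _) (pow_nonneg (by norm_num) _))
  calc _ ≤ bernoulliProb (1 / √(p : ℝ)) (fun A : Finset (ZMod p) =>
          ∃ u ∈ ({u | #(prog u) = K} : Finset (ZMod p × ZMod p)), prog u ⊆ A + A) := by
        refine bernoulliProb_mono hq0 hq1 fun A => ?_
        rintro ⟨b, d, hc, hA⟩
        exact ⟨(b, d), by simpa [prog] using hc, hA⟩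
    _ ≤ ∑ u ∈ ({u | #(prog u) = K} : Finset (ZMod p × ZMod p)), B := by
        refine (bernoulliProb_exists_le hq0 hq1 _ _).trans (sum_le_sum fun u hu => ?_)
        have h := bernoulliProb_subset_add_le hq0 hq1 (by rw [ZMod.card]; exact hq) hG
          mem_pairReps_or (sum_pow_card_pairReps_le hG hq0 hq hq8) 10 5 (prog u)
        rwa [(mem_filter.1 hu).2, ZMod.card] at h
    _ ≤ (p : ℝ) ^ 2 * B := by
        rw [sum_const, nsmul_eq_mul]
        have hc : (#({u | #(prog u) = K} : Finset (ZMod p × ZMod p)) : ℝ) ≤ (p : ℝ) ^ 2 := by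
          have h := card_filter_le (univ : Finset (ZMod p × ZMod p)) fun u => #(prog u) = K
          rw [card_univ, Fintype.card_prod, ZMod.card, ← sq] at h
          exact_mod_cast h
        exact mul_le_mul_of_nonneg_right hc hB0

lemma image_natCast_bind {R : Type} [NatCast R] [DecidableEq R] (s : Finset ℕ) (f : R → R) :
    (image f do
      let a ← s
      pure (a : R)) = s.image fun i : ℕ => f i := by
  ext y
  simp [Finset.bind_def, Finset.pure_def]

/-- upper bound in Theorem 1.8. For a random subset `A` of `ℤ_p` with
density `q = 1/√p`, whp the sumset `A + A` contains no arithmetic progression of length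
greater than `c₂ log p`. -/
theorem stmt12 :
    ∃ c₂ : ℝ, 0 < c₂ ∧
      ∀ ε : ℝ, 0 < ε →
        ∃ p₀ : ℕ, ∀ (p : ℕ) [Fact p.Prime], p₀ ≤ p →
          (∑ A ∈ (Finset.univ : Finset (ZMod p)).powerset,
              (if ∀ (k : ℕ) (b d : ZMod p), d ≠ 0 → c₂ * Real.log p < k →
                    ¬ ((((Finset.range k).image fun i => b + (i : ZMod p) * d).card = k) ∧
                      ((Finset.range k).image fun i => b + (i : ZMod p) * d) ⊆ A + A)
                then (1 / Real.sqrt p) ^ A.card * (1 - 1 / Real.sqrt p) ^ (p - A.card)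
                else 0))
            ≥ 1 - ε := by
  refine ⟨12, by norm_num, fun ε hε => ?_⟩
  have hlim := (Real.tendsto_sqrt_atTop.comp tendsto_natCast_atTop_atTop).eventually
    (eventually_log_pow_div_le hε (244 + (4 / 3) ^ 150) 150)
  obtain ⟨p₁, hp₁⟩ := Filter.eventually_atTop.1 hlim
  refine ⟨max p₁ 64, fun p _ hp => ?_⟩
  have hp64 : 64 ≤ p := (le_max_right _ _).trans hp
  have hp0 : (64 : ℝ) ≤ p := by exact_mod_cast hp64
  have hs : 8 ≤ √(p : ℝ) := Real.le_sqrt_of_sq_le (by norm_num1; exact hp0)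
  have hsq : √(p : ℝ) ^ 2 = p := Real.sq_sqrt (by positivity)
  have hlog : Real.log p = 2 * Real.log (√(p : ℝ)) := by
    rw [← hsq, Real.log_pow, hsq]
    norm_num
  have hlog1 : 1 ≤ Real.log p := by
    rw [Real.le_log_iff_exp_le (by positivity)]
    linarith [Real.exp_one_lt_d9]
  set K := ⌊12 * Real.log p⌋₊ + 1 with hK
  have hKlo : 12 * Real.log p ≤ K := by
    rw [hK]
    push_cast
    exact (Nat.lt_floor_add_one _).le
  have hKhi : (K : ℝ) ≤ 26 * Real.log (√(p : ℝ)) := by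
    have := Nat.floor_le (a := 12 * Real.log p) (by positivity)
    rw [hK]
    push_cast
    linarith
  have hbad := bernoulliProb_exists_progression_le hp64 K
  have hnum := union_bound_le (x := √(p : ℝ)) (by linarith) (K := K) (by omega)
    (by rw [hsq]; exact hKlo)
  rw [hsq] at hnum
  have hfin : (244 + (4 / 3 : ℝ) ^ 150) * (K : ℝ) ^ 150 / √(p : ℝ) ≤ ε := by
    refine le_trans ?_ (hp₁ p ((le_max_left _ _).trans hp))
    simp only [Function.comp_apply]
    gcongr
  let good : Finset (ZMod p) → Prop := fun A => ∀ (k : ℕ) (b d : ZMod p), d ≠ 0 →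
    12 * Real.log p < k → ¬ (#((range k).image fun i : ℕ => b + (i : ZMod p) * d) = k ∧
      ((range k).image fun i : ℕ => b + (i : ZMod p) * d) ⊆ A + A)
  have hq0 : 0 ≤ 1 / √(p : ℝ) := by positivity
  have hq1 : 1 / √(p : ℝ) ≤ 1 := by
    rw [div_le_one (by positivity)]
    linarith
  have hnot : bernoulliProb (1 / √(p : ℝ)) (fun A => ¬ good A) ≤ ε := by
    refine le_trans (bernoulliProb_mono hq0 hq1 fun A hA => ?_) (hbad.trans (hnum.trans hfin))
    simp only [good] at hA
    push Not at hA
    obtain ⟨k, b, d, -, hk, hcard, hsub⟩ := hA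
    have hKk : K ≤ k := by
      have := (Nat.floor_lt (by positivity)).2 hk
      omega
    have hrange : range K ⊆ range k := range_subset_range.2 hKk
    refine ⟨b, d, ?_, (image_subset_image hrange).trans hsub⟩
    have hinj := card_image_iff.1 (hcard.trans (card_range k).symm)
    rw [card_image_of_injOn (hinj.mono (coe_subset.2 hrange)), card_range]
  have htotal := bernoulliProb_add_not (q := 1 / √(p : ℝ)) good
  have hgood : 1 - ε ≤ bernoulliProb (1 / √(p : ℝ)) good := by linarith
  unfold bernoulliProb at hgood
  rw [ZMod.card] at hgood
  rw [powerset_univ, ge_iff_le]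
  simp only [image_natCast_bind]
  convert hgood using 1
end

section
/- There exists an absolute constant c₁ > 0 such that the following holds: for every ε > 0 there is p₀ such that for every prime p ≥ p₀, if A is a random subset of ℤ_p obtained by including each element independently with probability q = 1/√p, then with probability at least 1 − ε the sumset A + A contains an arithmetic progression of length at least c₁·log p. -/
open scoped Pointwise Classical
open Finset

/-- The expectation of `F A`, where `A ⊆ U` contains each element of `U` independently with
probability `q`. -/
noncomputable def bernoulliExp {α : Type*} [DecidableEq α] (q : ℝ) (U : Finset α)
    (F : Finset α → ℝ) : ℝ :=
  ∑ A ∈ U.powerset, q ^ #A * (1 - q) ^ #(U \ A) * F A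

section bernoulliExp

variable {α ι : Type*} [DecidableEq α] {q : ℝ}

theorem bernoulliExp_congr {U : Finset α} {F G : Finset α → ℝ} (h : ∀ A ⊆ U, F A = G A) :
    bernoulliExp q U F = bernoulliExp q U G :=
  sum_congr rfl fun A hA => by rw [h A (mem_powerset.1 hA)]

theorem bernoulliExp_mono (h0 : 0 ≤ q) (h1 : q ≤ 1) {U : Finset α} {F G : Finset α → ℝ}
    (h : ∀ A ⊆ U, F A ≤ G A) : bernoulliExp q U F ≤ bernoulliExp q U G :=
  sum_le_sum fun A hA => mul_le_mul_of_nonneg_left (h A (mem_powerset.1 hA))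
    (mul_nonneg (pow_nonneg h0 _) (pow_nonneg (sub_nonneg.2 h1) _))

theorem bernoulliExp_const (U : Finset α) (c : ℝ) : bernoulliExp q U (fun _ => c) = c := by
  have h := Finset.prod_add (fun _ => q) (fun _ => 1 - q) U
  simp only [prod_const, add_sub_cancel, one_pow] at h
  rw [bernoulliExp, ← sum_mul, ← h, one_mul]

theorem bernoulliExp_add (U : Finset α) (F G : Finset α → ℝ) :
    bernoulliExp q U (fun A => F A + G A) = bernoulliExp q U F + bernoulliExp q U G := by
  simp only [bernoulliExp, mul_add, sum_add_distrib]

theorem bernoulliExp_const_mul (U : Finset α) (c : ℝ) (F : Finset α → ℝ) :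
    bernoulliExp q U (fun A => c * F A) = c * bernoulliExp q U F := by
  simp only [bernoulliExp, mul_sum, mul_left_comm]

theorem bernoulliExp_one_sub (U : Finset α) (F : Finset α → ℝ) :
    bernoulliExp q U (fun A => 1 - F A) = 1 - bernoulliExp q U F := by
  have h := bernoulliExp_add (q := q) U (fun A => 1 - F A) F
  simp only [sub_add_cancel, bernoulliExp_const] at h
  linarith

theorem bernoulliExp_union {U V : Finset α} (h : Disjoint U V) (F : Finset α → ℝ) :
    bernoulliExp q (U ∪ V) F =
      bernoulliExp q U fun A => bernoulliExp q V fun B => F (A ∪ B) := by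
  simp only [bernoulliExp, mul_sum]
  rw [← sum_product']
  have key : ∀ A B, A ⊆ U → B ⊆ V → Disjoint A B ∧ (U ∪ V) \ (A ∪ B) = U \ A ∪ V \ B ∧
      Disjoint (U \ A) (V \ B) ∧ (A ∪ B) ∩ U = A ∧ (A ∪ B) ∩ V = B := by
    intro A B hA hB
    have hd := Finset.disjoint_left.1 h
    refine ⟨h.mono hA hB, ?_, h.mono sdiff_subset sdiff_subset, ?_, ?_⟩ <;> ext x <;>
      have := @hA x <;> have := @hB x <;> have := @hd x <;> simp <;> tauto
  refine sum_bij' (fun A _ => (A ∩ U, A ∩ V)) (fun x _ => x.1 ∪ x.2) ?_ ?_ ?_ ?_ ?_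
  · intro A _
    simp [inter_subset_right]
  · rintro ⟨A, B⟩ hx
    simp only [mem_product, mem_powerset] at hx ⊢
    exact union_subset_union hx.1 hx.2
  · intro A hA
    simp only
    rw [← inter_union_distrib_left, inter_eq_left.2 (mem_powerset.1 hA)]
  · rintro ⟨A, B⟩ hx
    simp only [mem_product, mem_powerset] at hx
    obtain ⟨-, -, -, h4, h5⟩ := key A B hx.1 hx.2
    simp only [h4, h5]
  · intro A hA
    obtain ⟨h1, h2, h3, -, -⟩ := key (A ∩ U) (A ∩ V) inter_subset_right inter_subset_right
    have e : A ∩ U ∪ A ∩ V = A := by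
      rw [← inter_union_distrib_left, inter_eq_left.2 (mem_powerset.1 hA)]
    rw [e] at h2
    simp only
    rw [e, h2, card_union_of_disjoint h3]
    nth_rewrite 1 [← e]
    rw [card_union_of_disjoint h1, pow_add, pow_add]
    ring

theorem bernoulliExp_prod (J : Finset ι) (U : ι → Finset α) (f : ι → Finset α → ℝ)
    (hd : (J : Set ι).PairwiseDisjoint U) {T : Finset α} (hT : ∀ j ∈ J, U j ⊆ T) :
    bernoulliExp q T (fun A => ∏ j ∈ J, f j (A ∩ U j)) = ∏ j ∈ J, bernoulliExp q (U j) (f j) := by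
  induction J using Finset.induction_on generalizing T with
  | empty => simp [bernoulliExp_const]
  | insert a J ha ih =>
    have hdis : ∀ j ∈ J, Disjoint (U j) (U a) := fun j hj =>
      hd (by simp [hj]) (by simp) fun e => ha (e ▸ hj)
    have ih' := ih (hd.subset (by simp)) (T := T \ U a) fun j hj =>
      subset_sdiff.2 ⟨hT j (by simp [hj]), hdis j hj⟩
    have hTU : T = U a ∪ T \ U a := (union_sdiff_of_subset (hT a (by simp))).symm
    rw [prod_insert ha, ← ih', mul_comm, ← bernoulliExp_const_mul, hTU,
      bernoulliExp_union disjoint_sdiff]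
    rw [← hTU]
    refine bernoulliExp_congr fun A hA => ?_
    rw [mul_comm, ← bernoulliExp_const_mul]
    refine bernoulliExp_congr fun B hB => ?_
    have hB' := (subset_sdiff.1 hB).2
    rw [prod_insert ha, union_inter_distrib_right, inter_eq_left.2 hA,
      disjoint_iff_inter_eq_empty.1 hB', union_empty]
    congr 1
    refine prod_congr rfl fun j hj => ?_
    rw [union_inter_distrib_right,
      disjoint_iff_inter_eq_empty.1 ((hdis j hj).symm.mono_left hA), empty_union]

theorem bernoulliExp_ite_nonempty (U : Finset α) (a b : ℝ) :
    bernoulliExp q U (fun A => if A.Nonempty then a else b) = a + (b - a) * (1 - q) ^ #U := by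
  have h : bernoulliExp q U (fun A => if A.Nonempty then 0 else b - a) =
      (b - a) * (1 - q) ^ #U := by
    rw [bernoulliExp, sum_eq_single ∅]
    · simp [mul_comm]
    · intro A _ hA
      simp [nonempty_iff_ne_empty.2 hA]
    · simp
  rw [← h, ← bernoulliExp_const (q := q) U a, ← bernoulliExp_add, bernoulliExp_const]
  refine bernoulliExp_congr fun A _ => ?_
  split_ifs <;> ring

theorem bernoulliExp_few_hit_le (h0 : 0 ≤ q) (h1 : q ≤ 1) (J : Finset ι) (U : ι → Finset α)
    (hd : (J : Set ι).PairwiseDisjoint U) {T : Finset α} (hT : ∀ j ∈ J, U j ⊆ T) {m : ℕ}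
    (hm : ∀ j ∈ J, #(U j) = m) (t : ℕ) :
    bernoulliExp q T (fun A => if #{j ∈ J | (A ∩ U j).Nonempty} < t then 1 else 0) ≤
      2 ^ t * ((1 + (1 - q) ^ m) / 2) ^ #J := by
  have h := bernoulliExp_prod (q := q) J U
    (fun _ A => if A.Nonempty then 1 / 2 else 1) hd hT
  have e : ∏ j ∈ J, bernoulliExp q (U j) (fun A => if A.Nonempty then (1 / 2 : ℝ) else 1) =
      ((1 + (1 - q) ^ m) / 2) ^ #J := by
    refine prod_eq_pow_card fun j hj => ?_
    rw [bernoulliExp_ite_nonempty, hm j hj]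
    ring
  rw [← e, ← h, ← bernoulliExp_const_mul]
  refine bernoulliExp_mono h0 h1 fun A _ => ?_
  rw [prod_ite, prod_const_one, mul_one, prod_const]
  split_ifs with hlt
  · calc (1 : ℝ) = 2 ^ t * (1 / 2) ^ t := by rw [← mul_pow]; norm_num
      _ ≤ _ := by
        gcongr ?_ * ?_
        exact pow_le_pow_of_le_one (by norm_num) (by norm_num) hlt.le
  · positivity

theorem bernoulliExp_all_blocks_missed (V : ℕ → Finset α) {N k n : ℕ} {T : Finset α}
    (hd : ((range (N * k) : Finset ℕ) : Set ℕ).PairwiseDisjoint V)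
    (hT : ∀ y < N * k, V y ⊆ T) (hn : ∀ y < N * k, #(V y) = n) :
    bernoulliExp q T (fun A => ∏ l ∈ range N,
      (1 - ∏ i ∈ range k, if (A ∩ V (l * k + i)).Nonempty then (1 : ℝ) else 0)) =
      (1 - (1 - (1 - q) ^ n) ^ k) ^ N := by
  have hlt : ∀ l < N, ∀ i < k, l * k + i < N * k := by
    intro l hl i hi
    calc l * k + i < (l + 1) * k := by rw [add_mul]; omega
      _ ≤ N * k := Nat.mul_le_mul_right _ hl
  have hinj : ∀ l l' i i', i < k → i' < k → l * k + i = l' * k + i' → l = l' ∧ i = i' := by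
    intro l l' i i' hi hi' he
    have e : ∀ l i, i < k → (l * k + i) / k = l := by
      intro l i hi
      rw [mul_comm, Nat.mul_add_div (by omega), Nat.div_eq_of_lt hi, add_zero]
    have : l = l' := by rw [← e l i hi, he, e l' i' hi']
    subst this
    exact ⟨rfl, by omega⟩
  set U : ℕ → Finset α := fun l => (range k).biUnion fun i => V (l * k + i) with hU
  have hVU : ∀ l, ∀ i ∈ range k, V (l * k + i) ⊆ U l := fun l i hi =>
    subset_biUnion_of_mem (fun i => V (l * k + i)) hi
  have h := bernoulliExp_prod (q := q) (T := T) (range N) U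
    (fun l A => 1 - ∏ i ∈ range k, if (A ∩ V (l * k + i)).Nonempty then (1 : ℝ) else 0) ?_ ?_
  · refine Eq.trans (bernoulliExp_congr fun A _ => ?_) (h.trans ?_)
    · refine prod_congr rfl fun l _ => ?_
      congr 1
      refine prod_congr rfl fun i hi => ?_
      rw [inter_assoc, inter_eq_right.2 (hVU l i hi)]
    · conv_rhs => rw [← card_range N]
      refine prod_eq_pow_card fun l hl => ?_
      rw [mem_range] at hl
      rw [bernoulliExp_one_sub, bernoulliExp_prod (range k) (fun i => V (l * k + i))
        (fun _ A => if A.Nonempty then (1 : ℝ) else 0) ?_ (hVU l)]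
      · congr 1
        conv_rhs => rw [← card_range k]
        refine prod_eq_pow_card fun i hi => ?_
        rw [bernoulliExp_ite_nonempty, hn _ (hlt l hl i (mem_range.1 hi))]
        ring
      · intro i hi i' hi' hne
        simp only [coe_range, Set.mem_Iio] at hi hi'
        exact hd (by simpa using hlt l hl i hi) (by simpa using hlt l hl i' hi') (by omega)
  · intro l hl l' hl' hne
    simp only [coe_range, Set.mem_Iio] at hl hl'
    simp only [Function.onFun, hU, disjoint_biUnion_left, disjoint_biUnion_right, mem_range]
    intro i hi i' hi'
    refine hd (by simpa using hlt l hl _ ‹_›) (by simpa using hlt l' hl' _ ‹_›) fun e => hne ?_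
    exact (hinj _ _ _ _ ‹_› ‹_› e).1
  · intro l hl
    exact biUnion_subset.2 fun i hi => hT _ (hlt l (mem_range.1 hl) i (mem_range.1 hi))

end bernoulliExp

theorem ZMod.natCast_inj_of_lt {p a b : ℕ} (ha : a < p) (hb : b < p)
    (h : (a : ZMod p) = b) : a = b := by
  rw [ZMod.natCast_eq_natCast_iff', Nat.mod_eq_of_lt ha, Nat.mod_eq_of_lt hb] at h
  exact h

/-- Blocks of `M` consecutive residues, any two of which are more than `M` apart. -/
def residueBlock (p M j : ℕ) : Finset (ZMod p) :=
  (Ico (2 * M * (j + 1)) (2 * M * (j + 1) + M)).image Nat.cast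

section residueBlock

variable {p M J : ℕ}

theorem residueBlock_index_bound {j b : ℕ} (hp : 4 * M * (J + 1) ≤ p) (hj : j < J)
    (hb : b ∈ Ico (2 * M * (j + 1)) (2 * M * (j + 1) + M)) : 2 * M ≤ b ∧ 2 * b + 2 * M < p := by
  rw [mem_Ico] at hb
  have h1 : 2 * M * (j + 1) ≤ 2 * M * J := Nat.mul_le_mul_left _ hj
  have h2 : 2 * M ≤ 2 * M * (j + 1) := Nat.le_mul_of_pos_right _ (by omega)
  have h3 : 4 * M * (J + 1) = 2 * (2 * M * J) + 4 * M := by ring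
  omega

theorem eq_of_close_mem_blocks {j j' b b' : ℕ}
    (hb : b ∈ Ico (2 * M * (j + 1)) (2 * M * (j + 1) + M))
    (hb' : b' ∈ Ico (2 * M * (j' + 1)) (2 * M * (j' + 1) + M))
    (h : b < b' + M) (h' : b' < b + M) : j = j' := by
  rw [mem_Ico] at hb hb'
  rcases lt_trichotomy j j' with hlt | heq | hlt
  · have h1 : 2 * M * (j + 1 + 1) ≤ 2 * M * (j' + 1) := Nat.mul_le_mul_left _ (by omega)
    have h2 : 2 * M * (j + 1 + 1) = 2 * M * (j + 1) + 2 * M := by ring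
    omega
  · exact heq
  · have h1 : 2 * M * (j' + 1 + 1) ≤ 2 * M * (j + 1) := Nat.mul_le_mul_left _ (by omega)
    have h2 : 2 * M * (j' + 1 + 1) = 2 * M * (j' + 1) + 2 * M := by ring
    omega

theorem card_residueBlock {j : ℕ} (hp : 4 * M * (J + 1) ≤ p) (hj : j < J) :
    #(residueBlock p M j) = M := by
  rw [residueBlock, card_image_of_injOn, Nat.card_Ico, Nat.add_sub_cancel_left]
  intro a ha b hb h
  have h1 := residueBlock_index_bound hp hj ha
  have h2 := residueBlock_index_bound hp hj hb
  exact ZMod.natCast_inj_of_lt (by omega) (by omega) h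

theorem pairwiseDisjoint_residueBlock (hp : 4 * M * (J + 1) ≤ p) :
    ((range J : Finset ℕ) : Set ℕ).PairwiseDisjoint (residueBlock p M) := by
  intro j hj j' hj' hne
  simp only [coe_range, Set.mem_Iio] at hj hj'
  refine Finset.disjoint_left.2 fun x hx hx' => hne ?_
  obtain ⟨b, hb, rfl⟩ := mem_image.1 hx
  obtain ⟨b', hb', he⟩ := mem_image.1 hx'
  have h1 := residueBlock_index_bound hp hj hb
  have h2 := residueBlock_index_bound hp hj' hb'
  have h3 := ZMod.natCast_inj_of_lt (by omega) (by omega) he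
  subst h3
  have hM := mem_Ico.1 hb
  exact eq_of_close_mem_blocks hb hb' (by omega) (by omega)

theorem exists_disjoint_reflections (hp : 4 * M * (J + 1) ≤ p) {B : Finset (ZMod p)} {t : ℕ}
    (ht : t ≤ #{j ∈ range J | (B ∩ residueBlock p M j).Nonempty}) :
    ∃ V : ℕ → Finset (ZMod p), ((range M : Finset ℕ) : Set ℕ).PairwiseDisjoint V ∧
      (∀ y < M, Disjoint (V y) ((range J).biUnion (residueBlock p M))) ∧
      (∀ y < M, #(V y) = t) ∧ ∀ y, ∀ x ∈ V y, ∃ b ∈ B, b + x = y := by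
  obtain ⟨K, hK, rfl⟩ := exists_subset_card_eq ht
  have hex : ∀ j ∈ K, ∃ b ∈ Ico (2 * M * (j + 1)) (2 * M * (j + 1) + M),
      j < J ∧ (b : ZMod p) ∈ B := by
    intro j hj
    obtain ⟨hj, x, hx⟩ := mem_filter.1 (hK hj)
    rw [mem_inter, residueBlock, mem_image] at hx
    obtain ⟨hxB, b, hb, rfl⟩ := hx
    exact ⟨b, hb, mem_range.1 hj, hxB⟩
  choose! β hβ hJ hB using hex
  have hbd : ∀ j ∈ K, 2 * M ≤ β j ∧ 2 * β j + 2 * M < p := fun j hj =>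
    residueBlock_index_bound hp (hJ j hj) (hβ j hj)
  have key : ∀ y < M, ∀ y' < M, ∀ j ∈ K, ∀ j' ∈ K,
      (y : ZMod p) - β j = y' - β j' → y = y' ∧ j = j' := by
    intro y hy y' hy' j hj j' hj' h
    have h1 := hbd j hj
    have h2 := hbd j' hj'
    have e : ((y + β j' : ℕ) : ZMod p) = (y' + β j : ℕ) := by
      push_cast
      linear_combination h
    have e' := ZMod.natCast_inj_of_lt (by omega) (by omega) e
    have ejj := eq_of_close_mem_blocks (hβ j hj) (hβ j' hj') (by omega) (by omega)
    subst ejj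
    exact ⟨by omega, rfl⟩
  refine ⟨fun y => K.image fun j => (y : ZMod p) - β j, ?_, ?_, ?_, ?_⟩
  · intro y hy y' hy' hne
    simp only [coe_range, Set.mem_Iio] at hy hy'
    refine Finset.disjoint_left.2 fun x hx hx' => hne ?_
    obtain ⟨j, hj, rfl⟩ := mem_image.1 hx
    obtain ⟨j', hj', he⟩ := mem_image.1 hx'
    exact (key y hy y' hy' j hj j' hj' he.symm).1
  · intro y hy
    refine Finset.disjoint_left.2 fun x hx hx' => ?_
    obtain ⟨j, hj, rfl⟩ := mem_image.1 hx
    obtain ⟨i, hi, hx'⟩ := mem_biUnion.1 hx'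
    obtain ⟨b, hb, he⟩ := mem_image.1 hx'
    have h1 := hbd j hj
    have h2 := residueBlock_index_bound hp (mem_range.1 hi) hb
    have e : ((b + β j : ℕ) : ZMod p) = (y : ℕ) := by
      push_cast
      linear_combination he
    have e' := ZMod.natCast_inj_of_lt (by omega) (by omega) e
    omega
  · intro y hy
    exact card_image_of_injOn fun j hj j' hj' h => (key y hy y hy j hj j' hj' h).2
  · intro y x hx
    obtain ⟨j, hj, rfl⟩ := mem_image.1 hx
    exact ⟨β j, hB j hj, by ring⟩

end residueBlock

theorem bernoulliExp_no_interval_le {p M J N k t : ℕ} [NeZero p] {q : ℝ} (h0 : 0 ≤ q) (h1 : q ≤ 1)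
    (hp : 4 * M * (J + 1) ≤ p) (hNk : N * k ≤ M) :
    bernoulliExp q (univ : Finset (ZMod p))
      (fun A => if ∃ b : ZMod p, ∀ i < k, b + (i : ZMod p) ∈ A + A then 0 else 1) ≤
      2 ^ t * ((1 + (1 - q) ^ M) / 2) ^ J + (1 - (1 - (1 - q) ^ t) ^ k) ^ N := by
  set S := (range J).biUnion (residueBlock p M) with hS
  have hq : (1 - q) ^ t ∈ Set.Icc (0 : ℝ) 1 :=
    ⟨pow_nonneg (by linarith) _, pow_le_one₀ (by linarith) (by linarith)⟩
  have hR : 0 ≤ (1 - (1 - (1 - q) ^ t) ^ k) ^ N :=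
    pow_nonneg (sub_nonneg.2 (pow_le_one₀ (by linarith [hq.2]) (by linarith [hq.1]))) _
  have hfew := bernoulliExp_few_hit_le h0 h1 (range J) (residueBlock p M)
    (pairwiseDisjoint_residueBlock hp) (T := S) (fun j hj => subset_biUnion_of_mem _ hj)
    (fun j hj => card_residueBlock hp (mem_range.1 hj)) t
  rw [card_range] at hfew
  rw [← union_sdiff_of_subset (subset_univ S), bernoulliExp_union disjoint_sdiff]
  refine le_trans (bernoulliExp_mono h0 h1 (G := fun B =>
    (if #{j ∈ range J | (B ∩ residueBlock p M j).Nonempty} < t then 1 else 0) +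
      (1 - (1 - (1 - q) ^ t) ^ k) ^ N) fun B _ => ?_) ?_
  · split_ifs with hlt
    · refine le_trans (bernoulliExp_mono h0 h1 (G := fun _ => 1) fun C _ => ?_) ?_
      · split_ifs <;> norm_num
      · rw [bernoulliExp_const]
        linarith
    · obtain ⟨V, hd, hVS, hcard, hsum⟩ := exists_disjoint_reflections hp (not_lt.1 hlt)
      rw [zero_add, ← bernoulliExp_all_blocks_missed V (T := univ \ S)
        (hd.subset fun y hy => ?_)
        (fun y hy => subset_sdiff.2 ⟨subset_univ _, hVS y (hy.trans_le hNk)⟩)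
        (fun y hy => hcard y (hy.trans_le hNk))]
      · refine bernoulliExp_mono h0 h1 fun C _ => ?_
        have hind : ∀ l, (∏ i ∈ range k, if (C ∩ V (l * k + i)).Nonempty then (1 : ℝ) else 0) =
            if ∀ i ∈ range k, (C ∩ V (l * k + i)).Nonempty then 1 else 0 := fun l => by
          rw [prod_ite_zero, prod_const_one]
        split_ifs with hgood
        · refine prod_nonneg fun l _ => ?_
          rw [hind]
          split_ifs <;> norm_num
        · refine (prod_eq_one fun l _ => ?_).ge
          rw [hind, if_neg, sub_zero]
          refine fun hall => hgood ⟨(l * k : ℕ), fun i hi => ?_⟩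
          obtain ⟨x, hx⟩ := hall i (mem_range.2 hi)
          rw [mem_inter] at hx
          obtain ⟨b, hb, he⟩ := hsum _ x hx.2
          rw [← Nat.cast_add, ← he]
          exact add_mem_add (mem_union_left _ hb) (mem_union_right _ hx.1)
      · simp only [coe_range, Set.mem_Iio] at hy ⊢
        exact hy.trans_le hNk
  · rw [bernoulliExp_add, bernoulliExp_const]
    linarith

theorem few_hit_bound_le_exp {u : ℝ} {p M J t : ℕ} (hu : 2 ≤ u) (hp : (p : ℝ) = u ^ 8)
    (hM : (M : ℝ) ≤ u ^ 2) (hJ : p < 4 * M * (J + 2)) (ht : (t : ℝ) ≤ u ^ 4 / 100 + 1) :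
    2 ^ t * ((1 + (1 - 1 / u ^ 4) ^ M) / 2) ^ J ≤ Real.exp (1 - u ^ 4 / 50) := by
  have hu2 : 4 ≤ u ^ 2 := by nlinarith
  have hu4 : 16 ≤ u ^ 4 := by nlinarith
  set q : ℝ := 1 / u ^ 4 with hq
  have hqu : q * u ^ 4 = 1 := by rw [hq]; field_simp
  have hq0 : 0 < q := by positivity
  have hq1 : q ≤ 1 := by nlinarith
  have hMq : M * q ≤ 1 := by
    have : (M : ℝ) ≤ u ^ 4 := by nlinarith
    nlinarith
  have hM0 : (0 : ℝ) ≤ M * q := by positivity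
  have hπ : (1 - q) ^ M ≤ 1 - M * q / 2 := by
    have h1 : 1 + (M : ℝ) * q ≤ (1 + q) ^ M := one_add_mul_le_pow (by linarith) M
    have h2 : (1 - q) ^ M * (1 + q) ^ M ≤ 1 := by
      rw [← mul_pow]
      exact pow_le_one₀ (by nlinarith) (by nlinarith)
    have h3 : 0 ≤ (1 - q) ^ M := pow_nonneg (by linarith) _
    have h4 : (1 - q) ^ M * (1 + M * q) ≤ 1 := le_trans (by gcongr) h2
    by_contra! h5
    nlinarith
  have hJM : u ^ 4 / 32 ≤ J * (M * q / 4) := by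
    have h1 : (p : ℝ) ≤ 4 * M * (J + 2) := by exact_mod_cast hJ.le
    have h2 : u ^ 2 ≤ u ^ 8 / 16 := by
      have h6 : 64 ≤ u ^ 6 := by nlinarith
      nlinarith
    have h3 : u ^ 8 / 8 ≤ J * M := by
      rw [hp] at h1
      nlinarith
    calc u ^ 4 / 32 = u ^ 8 / 8 * q / 4 := by
          linear_combination (-u ^ 4 / 32) * hqu
      _ ≤ J * M * q / 4 := by gcongr
      _ = _ := by ring
  have hpow : ((1 + (1 - q) ^ M) / 2) ^ J ≤ Real.exp (-(J * (M * q / 4))) := by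
    have h1 : (1 + (1 - q) ^ M) / 2 ≤ Real.exp (-(M * q / 4)) := by
      have := Real.add_one_le_exp (-(M * q / 4))
      linarith
    have h3 : 0 ≤ (1 - q) ^ M := pow_nonneg (by linarith) _
    refine (pow_le_pow_left₀ (by linarith) h1 J).trans ?_
    rw [← Real.exp_nat_mul]
    exact Real.exp_le_exp.2 (by linarith)
  have htwo : (2 : ℝ) ^ t ≤ Real.exp t := by
    have h1 : (2 : ℝ) ≤ Real.exp 1 := by
      have := Real.add_one_le_exp 1
      linarith
    refine (pow_le_pow_left₀ (by norm_num) h1 t).trans ?_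
    rw [← Real.exp_nat_mul, mul_one]
  have h3 : 0 ≤ (1 - q) ^ M := pow_nonneg (by linarith) _
  calc _ ≤ Real.exp t * Real.exp (-(J * (M * q / 4))) := by gcongr
    _ ≤ _ := by
      rw [← Real.exp_add]
      exact Real.exp_le_exp.2 (by linarith)

theorem all_missed_bound_le_exp {u L : ℝ} {M N k t : ℕ} (hu : 2 ≤ u) (hk0 : 0 < k)
    (hL : (k : ℝ) ≤ L) (hM : u ^ 2 / 2 ≤ M) (hN : M ≤ 2 * k * N) (ht : u ^ 4 / 100 ≤ t)
    (hk : (101 : ℝ) ^ k ≤ 101 * u) :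
    (1 - (1 - (1 - 1 / u ^ 4) ^ t) ^ k) ^ N ≤ Real.exp (-(u / (404 * L))) := by
  have hu2 : 4 ≤ u ^ 2 := by nlinarith
  have hu4 : 16 ≤ u ^ 4 := by nlinarith
  set q : ℝ := 1 / u ^ 4 with hq
  have hqu : q * u ^ 4 = 1 := by rw [hq]; field_simp
  have hq0 : 0 < q := by positivity
  have hq1 : q ≤ 1 := by nlinarith
  have hk0' : (0 : ℝ) < k := by exact_mod_cast hk0
  have h3 : 0 ≤ (1 - q) ^ t := pow_nonneg (by linarith) _
  have hδ : (1 : ℝ) / 101 ≤ 1 - (1 - q) ^ t := by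
    have h1 : 1 + (t : ℝ) * q ≤ (1 + q) ^ t := one_add_mul_le_pow (by linarith) t
    have h2 : (1 - q) ^ t * (1 + q) ^ t ≤ 1 := by
      rw [← mul_pow]
      exact pow_le_one₀ (by nlinarith) (by nlinarith)
    have h4 : (1 - q) ^ t * (1 + t * q) ≤ 1 := le_trans (by gcongr) h2
    have h5 : 1 / 100 ≤ t * q := by nlinarith
    nlinarith
  have hδk : 1 / (101 * u) ≤ (1 - (1 - q) ^ t) ^ k := by
    calc 1 / (101 * u) ≤ 1 / 101 ^ k := by gcongr
      _ = (1 / 101) ^ k := by rw [div_pow, one_pow]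
      _ ≤ _ := by gcongr
  have hδ1 : (1 - (1 - q) ^ t) ^ k ≤ 1 := pow_le_one₀ (by linarith) (by linarith)
  have hNu : u / (404 * L) ≤ N * (1 / (101 * u)) := by
    have h1 : (M : ℝ) ≤ 2 * k * N := by exact_mod_cast hN
    have h2 : u ^ 2 ≤ 4 * k * N := by linarith
    calc u / (404 * L) ≤ u / (404 * k) := by gcongr
      _ ≤ N * (1 / (101 * u)) := by
        rw [mul_one_div, div_le_div_iff₀ (by positivity) (by positivity)]
        nlinarith
  have h1 : 1 - (1 - (1 - q) ^ t) ^ k ≤ Real.exp (-(1 / (101 * u))) := by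
    have := Real.add_one_le_exp (-(1 / (101 * u)))
    linarith
  refine (pow_le_pow_left₀ (by linarith) h1 N).trans ?_
  rw [← Real.exp_nat_mul]
  exact Real.exp_le_exp.2 (by linarith)

theorem eventually_error_bounds {ε : ℝ} (hε : 0 < ε) :
    ∀ᶠ x : ℝ in Filter.atTop, 2 ≤ x ^ (1 / 8 : ℝ) ∧ 2 ≤ Real.log x ∧
      Real.log x ≤ (x ^ (1 / 8 : ℝ)) ^ 2 / 2 ∧
      Real.exp (1 - (x ^ (1 / 8 : ℝ)) ^ 4 / 50) ≤ ε / 2 ∧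
      Real.exp (-(x ^ (1 / 8 : ℝ) / (404 * Real.log x))) ≤ ε / 2 := by
  have hu : Filter.Tendsto (fun x : ℝ => x ^ (1 / 8 : ℝ)) Filter.atTop Filter.atTop :=
    tendsto_rpow_atTop (by norm_num)
  set R : ℝ := max 1 (-Real.log (ε / 2)) with hR
  have hR1 : 1 ≤ R := le_max_left _ _
  have hexp : ∀ z, z ≤ -R → Real.exp z ≤ ε / 2 := by
    intro z hz
    rw [← Real.exp_log (half_pos hε)]
    exact Real.exp_le_exp.2 (by linarith [le_max_right 1 (-Real.log (ε / 2))])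
  have hlog := (isLittleO_log_rpow_atTop (r := 1 / 8) (by norm_num)).bound
    (c := 1 / (404 * R)) (by positivity)
  filter_upwards [hu.eventually_ge_atTop 2, hu.eventually_ge_atTop (50 * (R + 1)),
    Real.tendsto_log_atTop.eventually_ge_atTop 2, hlog] with x h1 h2 h3 h4
  set u : ℝ := x ^ (1 / 8 : ℝ)
  rw [Real.norm_of_nonneg (by linarith), Real.norm_of_nonneg (by linarith)] at h4
  have h5 : 404 * R * Real.log x ≤ u := by
    rw [one_div, inv_mul_eq_div, le_div_iff₀ (by positivity)] at h4
    linarith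
  have h6 : u ≤ u ^ 4 := le_self_pow₀ (by linarith) (by norm_num)
  refine ⟨h1, h3, by nlinarith, hexp _ (by linarith), hexp _ ?_⟩
  rw [neg_le_neg_iff, le_div_iff₀ (by positivity)]
  linarith

/-- lower bound in Theorem 1.8. For a random subset `A` of `ℤ_p` with
density `q = 1/√p`, whp the sumset `A + A` contains an arithmetic progression of length
at least `c₁ log p`. -/
theorem stmt13 :
    ∃ c₁ : ℝ, 0 < c₁ ∧
      ∀ ε : ℝ, 0 < ε →
        ∃ p₀ : ℕ, ∀ (p : ℕ) [Fact p.Prime], p₀ ≤ p →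
          (∑ A ∈ (Finset.univ : Finset (ZMod p)).powerset,
              (if ∃ (k : ℕ) (b d : ZMod p), d ≠ 0 ∧ c₁ * Real.log p ≤ k ∧
                    (((Finset.range k).image fun i => b + (i : ZMod p) * d).card = k) ∧
                    ((Finset.range k).image fun i => b + (i : ZMod p) * d) ⊆ A + A
                then (1 / Real.sqrt p) ^ A.card * (1 - 1 / Real.sqrt p) ^ (p - A.card)
                else 0))
            ≥ 1 - ε := by
  have hlog101 : 1 ≤ Real.log 101 := by
    rw [Real.le_log_iff_exp_le (by norm_num)]
    linarith [Real.exp_one_lt_d9]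
  refine ⟨1 / (8 * Real.log 101), by positivity, fun ε hε => ?_⟩
  obtain ⟨p₀, hp₀⟩ := Filter.eventually_atTop.1
    (tendsto_natCast_atTop_atTop.eventually (eventually_error_bounds hε))
  refine ⟨p₀, fun p hprime hp => ?_⟩
  obtain ⟨hu, hL2, hLu, hexp1, hexp2⟩ := hp₀ p hp
  set u : ℝ := (p : ℝ) ^ (1 / 8 : ℝ) with hudef
  set L : ℝ := Real.log p with hLdef
  have hpos : (0 : ℝ) < p := by exact_mod_cast hprime.out.pos
  have hpu : (p : ℝ) = u ^ 8 := by
    rw [hudef, ← Real.rpow_natCast, ← Real.rpow_mul hpos.le]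
    norm_num
  have hsqrt : Real.sqrt p = u ^ 4 := by
    rw [hpu, show u ^ 8 = (u ^ 4) ^ 2 by ring, Real.sqrt_sq (by positivity)]
  have huexp : u = Real.exp (L / 8) := by
    rw [hudef, Real.rpow_def_of_pos hpos, ← hLdef]
    ring_nf
  have hu2 : 4 ≤ u ^ 2 := by nlinarith
  have hu4 : 16 ≤ u ^ 4 := by nlinarith
  rw [hsqrt]
  set c : ℝ := 1 / (8 * Real.log 101) with hc
  have hc0 : 0 < c := by positivity
  have hc2 : c ≤ 1 / 2 := by
    rw [hc]
    gcongr
    linarith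
  have hq0 : 0 ≤ 1 / u ^ 4 := by positivity
  have hq1 : 1 / u ^ 4 ≤ 1 := by
    rw [div_le_one (by positivity)]
    linarith
  set M := ⌊u ^ 2⌋₊ with hM
  set k := ⌈c * L⌉₊ with hk
  set t := ⌈u ^ 4 / 100⌉₊ with ht
  have hMle : (M : ℝ) ≤ u ^ 2 := Nat.floor_le (by positivity)
  have hMge : u ^ 2 / 2 ≤ M := by linarith [Nat.lt_floor_add_one (u ^ 2)]
  have hk0 : 0 < k := Nat.ceil_pos.2 (by positivity)
  have hkc : (k : ℝ) < c * L + 1 := Nat.ceil_lt_add_one (by positivity)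
  have hkL : (k : ℝ) ≤ L := by nlinarith
  have hkM : k ≤ M := by
    have : (k : ℝ) ≤ M := by linarith
    exact_mod_cast this
  have hk101 : (101 : ℝ) ^ k ≤ 101 * u := by
    have h1 : (101 : ℝ) = Real.exp (Real.log 101) := (Real.exp_log (by norm_num)).symm
    have h2 : c * Real.log 101 = 1 / 8 := by
      rw [hc]
      field_simp
    rw [huexp]
    nth_rewrite 1 2 [h1]
    rw [← Real.exp_nat_mul, ← Real.exp_add]
    refine Real.exp_le_exp.2 ?_
    nlinarith
  have hM16 : 16 * M ≤ p := by
    have : (16 : ℝ) * M ≤ p := by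
      rw [hpu]
      nlinarith [mul_le_mul hu4 hu2 (by norm_num) (by positivity)]
    exact_mod_cast this
  obtain ⟨J, hJ⟩ : ∃ J, p / (4 * M) = J + 1 :=
    Nat.exists_eq_add_of_le' ((Nat.one_le_div_iff (by omega)).2 (by omega))
  have hJ1 : 4 * M * (J + 1) ≤ p := hJ ▸ Nat.mul_div_le p (4 * M)
  have hJ2 : p < 4 * M * (J + 2) := by
    have := Nat.lt_mul_div_succ p (b := 4 * M) (by omega)
    rwa [hJ] at this
  have hN1 : M / k * k ≤ M := Nat.div_mul_le_self M k
  have hN2 : M ≤ 2 * k * (M / k) := by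
    have h1 := Nat.lt_mul_div_succ M hk0
    have h2 : 1 ≤ M / k := (Nat.one_le_div_iff hk0).2 hkM
    nlinarith
  have hbad := bernoulliExp_no_interval_le (t := t) hq0 hq1 hJ1 hN1
  have hb1 := few_hit_bound_le_exp hu hpu hMle hJ2
    (Nat.ceil_lt_add_one (by positivity : 0 ≤ u ^ 4 / 100)).le
  have hb2 := all_missed_bound_le_exp hu hk0 hkL hMge hN2 (Nat.le_ceil (u ^ 4 / 100)) hk101
  calc
    1 - ε ≤ 1 - bernoulliExp (1 / u ^ 4) (univ : Finset (ZMod p)) (fun A =>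
        if ∃ b : ZMod p, ∀ i < k, b + (i : ZMod p) ∈ A + A then 0 else 1) := by linarith
    _ ≤ _ := by
      rw [← bernoulliExp_one_sub, bernoulliExp]
      refine sum_le_sum fun A _ => ?_
      have hcard : #(univ \ A) = p - #A := by
        rw [card_sdiff_of_subset (subset_univ A), card_univ, ZMod.card]
      rw [hcard]
      have hw : 0 ≤ (1 / u ^ 4) ^ #A * (1 - 1 / u ^ 4) ^ (p - #A) :=
        mul_nonneg (pow_nonneg hq0 _) (pow_nonneg (sub_nonneg.2 hq1) _)
      by_cases hgood : ∃ b : ZMod p, ∀ i < k, b + (i : ZMod p) ∈ A + A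
      · rw [if_pos hgood, sub_zero, mul_one, if_pos]
        obtain ⟨b, hb⟩ := hgood
        have himg : (range k >>= fun a => pure (a : ZMod p)) = (range k).image Nat.cast := by
          ext x
          simp [Finset.bind_def, eq_comm]
        refine ⟨k, b, 1, one_ne_zero, Nat.le_ceil _, ?_, ?_⟩
        · rw [himg, image_image, card_image_of_injOn, card_range]
          intro i hi j hj h
          simp only [coe_range, Set.mem_Iio] at hi hj
          exact ZMod.natCast_inj_of_lt (p := p) (by omega) (by omega) (by simpa using h)
        · intro x hx
          rw [himg, image_image] at hx
          obtain ⟨i, hi, rfl⟩ := mem_image.1 hx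
          simpa using hb i (mem_range.1 hi)
      · rw [if_neg hgood, sub_self, mul_zero]
        split_ifs
        · exact hw
        · exact le_rfl
end
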